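/- Let p be a prime with p ≠ 2, 3, 7. If p ≡ 1, 2 or 4 (mod 7), write p = x^2 + 7y^2 with integers x, y; then Σ_{k=0}^{p−1} k^2·C(2k,k)^3 ≡ (736/1323)x^2 − (272/441)p + 20p^2/(1323x^2) (mod p^3) and Σ_{k=0}^{p−1} k^3·C(2k,k)^3 ≡ −(5408/27783)x^2 + (2992/9261)p − 1774p^2/(27783x^2) (mod p^3). If p ≡ 3, 5 or 6 (mod 7), then Σ_{k=0}^{p−1} k^2·C(2k,k)^3 ≡ (8/63)R_7(p) − (256/1323)p (mod p^2) and Σ_{k=0}^{p−1} k^3·C(2k,k)^3 ≡ −(256/1323)R_7(p) + (128/27783)p (mod p^2). -/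

import Mathlib

/-- `a ≡ b (mod p^r)` for rationals: the numerator of `a - b` in lowest terms
is divisible by `p^r`. -/
def ratCongr (p r : ℕ) (a b : ℚ) : Prop := (p : ℤ)^r ∣ (a - b).num
/-- `R_7(p) = Σ_{k=0}^{(p-1)/2} C(2k,k)^3/(k+1)`. -/
def R7 (p : ℕ) : ℚ :=
  ∑ k ∈ Finset.range ((p-1)/2 + 1), ((2*k).choose k : ℚ)^3 / (k+1)


section cong
variable {p : ℕ} [hp : Fact p.Prime]

/-- `q` lies in `p^r ℤ_p`. -/
def Pd (p : ℕ) [hp : Fact p.Prime] (r : ℕ) (q : ℚ_[p]) : Prop :=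
  ∃ c : ℤ_[p], q = (p : ℚ_[p]) ^ r * (c : ℚ_[p])

theorem Pd.add {r : ℕ} {a b : ℚ_[p]} (ha : Pd p r a) (hb : Pd p r b) : Pd p r (a + b) := by
  obtain ⟨c, rfl⟩ := ha
  obtain ⟨d, rfl⟩ := hb
  exact ⟨c + d, by push_cast; ring⟩

theorem Pd.mul {r s : ℕ} {a b : ℚ_[p]} (ha : Pd p r a) (hb : Pd p s b) :
    Pd p (r + s) (a * b) := by
  obtain ⟨c, rfl⟩ := ha
  obtain ⟨d, rfl⟩ := hb
  exact ⟨c * d, by push_cast; ring⟩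

theorem Pd.neg {r : ℕ} {a : ℚ_[p]} (ha : Pd p r a) : Pd p r (-a) := by
  obtain ⟨c, rfl⟩ := ha
  exact ⟨-c, by push_cast; ring⟩

theorem Pd.sub {r : ℕ} {a b : ℚ_[p]} (ha : Pd p r a) (hb : Pd p r b) : Pd p r (a - b) := by
  rw [sub_eq_add_neg]; exact ha.add hb.neg

theorem Pd.mono {r s : ℕ} {a : ℚ_[p]} (ha : Pd p r a) (h : s ≤ r) : Pd p s a := by
  obtain ⟨c, rfl⟩ := ha
  refine ⟨(p : ℤ_[p]) ^ (r - s) * c, ?_⟩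
  push_cast
  rw [← mul_assoc, ← pow_add, Nat.add_sub_cancel' h]

theorem Pd.mul_left {r : ℕ} {a b : ℚ_[p]} (ha : Pd p 0 a) (hb : Pd p r b) : Pd p r (a * b) := by
  have := ha.mul hb
  rwa [zero_add] at this

theorem Pd.mul_right {r : ℕ} {a b : ℚ_[p]} (ha : Pd p r a) (hb : Pd p 0 b) : Pd p r (a * b) :=
  ha.mul hb

theorem Pd.pow {a : ℚ_[p]} {r : ℕ} (ha : Pd p r a) (n : ℕ) : Pd p (r * n) (a ^ n) := by
  obtain ⟨c, rfl⟩ := ha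
  exact ⟨c ^ n, by push_cast; rw [mul_pow, ← pow_mul]⟩

theorem Pd.pow0 {a : ℚ_[p]} (ha : Pd p 0 a) (n : ℕ) : Pd p 0 (a ^ n) := by
  have := ha.pow n
  rwa [zero_mul] at this

theorem Pd.zero (r : ℕ) : Pd p r 0 := ⟨0, by simp⟩

theorem Pd.intCast (n : ℤ) : Pd p 0 (n : ℚ_[p]) := ⟨n, by simp⟩
theorem Pd.natCast (n : ℕ) : Pd p 0 (n : ℚ_[p]) := ⟨n, by simp⟩
theorem Pd.one : Pd p 0 (1 : ℚ_[p]) := ⟨1, by simp⟩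
theorem Pd.ofNat (n : ℕ) [n.AtLeastTwo] : Pd p 0 (OfNat.ofNat n : ℚ_[p]) :=
  Pd.natCast (OfNat.ofNat n)
theorem Pd.ppow (r : ℕ) : Pd p r ((p : ℚ_[p]) ^ r) := ⟨1, by simp⟩
theorem Pd.p1 : Pd p 1 (p : ℚ_[p]) := ⟨1, by simp⟩

theorem Pd.sum {ι : Type*} {r : ℕ} (s : Finset ι) (g : ι → ℚ_[p]) (h : ∀ i ∈ s, Pd p r (g i)) :
    Pd p r (∑ i ∈ s, g i) := by
  classical
  induction s using Finset.induction_on with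
  | empty => simpa using Pd.zero r
  | insert a s ha ih =>
    rw [Finset.sum_insert ha]
    exact (h _ (Finset.mem_insert_self _ _)).add
      (ih fun i hi => h _ (Finset.mem_insert_of_mem hi))

theorem Pd.iff_norm {r : ℕ} {a : ℚ_[p]} : Pd p r a ↔ ‖a‖ ≤ (p : ℝ) ^ (-r : ℤ) := by
  have hp0 : (p : ℚ_[p]) ≠ 0 := by exact_mod_cast hp.out.ne_zero
  have hpr : (0 : ℝ) < p := by exact_mod_cast hp.out.pos
  constructor
  · rintro ⟨c, rfl⟩
    rw [norm_mul, Padic.norm_p_pow]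
    exact mul_le_of_le_one_right (by positivity) c.2
  · intro h
    refine ⟨⟨a / (p : ℚ_[p]) ^ r, ?_⟩, ?_⟩
    · rw [norm_div, Padic.norm_p_pow]
      rw [div_le_one (by positivity)]
      exact h
    · field_simp

theorem Pd.inv_of_not {a : ℚ_[p]} (h0 : Pd p 0 a) (h : ¬ Pd p 1 a) : Pd p 0 a⁻¹ := by
  obtain ⟨c, rfl⟩ := h0
  have : ‖c‖ = 1 := by
    by_contra hc
    have h1 : ‖c‖ < 1 := lt_of_le_of_ne c.2 hc
    have := (PadicInt.norm_lt_one_iff_dvd c).1 h1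
    obtain ⟨d, rfl⟩ := this
    exact h ⟨d, by push_cast; ring⟩
  rw [Pd.iff_norm]
  simp [norm_inv]
  simp [this]

theorem Pd.inv_nat {n : ℕ} (h : ¬ p ∣ n) : Pd p 0 ((n : ℚ_[p])⁻¹) := by
  apply Pd.inv_of_not (Pd.natCast n)
  rintro ⟨c, hc⟩
  apply h
  have : (n : ℤ_[p]) = p * c := by
    apply Subtype.ext
    simpa using hc
  have h2 : ‖(n : ℤ_[p])‖ < 1 := (PadicInt.norm_lt_one_iff_dvd _).2 ⟨c, this⟩
  have h3 : ‖((n : ℤ) : ℤ_[p])‖ < 1 := by exact_mod_cast h2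
  have := (PadicInt.norm_int_lt_one_iff_dvd (n : ℤ)).1 h3
  exact_mod_cast this

theorem Pd.inv_int {n : ℤ} (h : ¬ (p : ℤ) ∣ n) : Pd p 0 ((n : ℚ_[p])⁻¹) := by
  obtain ⟨m, hm | hm⟩ := Int.eq_nat_or_neg n
  · subst hm
    have h1 : ¬ p ∣ m := fun h2 => h (by exact_mod_cast h2)
    exact_mod_cast Pd.inv_nat h1
  · subst hm
    have h1 : ¬ p ∣ m := fun h2 => h (by rw [dvd_neg]; exact_mod_cast h2)
    push_cast
    rw [inv_neg]
    exact (Pd.inv_nat h1).neg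

theorem Pd.of_dvd {n : ℤ} {r : ℕ} (h : (p : ℤ) ^ r ∣ n) : Pd p r (n : ℚ_[p]) := by
  obtain ⟨c, rfl⟩ := h
  exact ⟨c, by push_cast; ring⟩

theorem Pd.dvd_int {n : ℤ} {r : ℕ} (h : Pd p r (n : ℚ_[p])) : (p : ℤ) ^ r ∣ n := by
  rw [Pd.iff_norm] at h
  have h3 : ‖((n : ℤ) : ℤ_[p])‖ ≤ (p : ℝ) ^ (-r : ℤ) := by
    simpa [PadicInt.norm_def] using h
  exact_mod_cast PadicInt.norm_int_le_pow_iff_dvd.1 h3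

theorem Pd.dvd_num {q : ℚ} {r : ℕ} (h : Pd p r (q : ℚ_[p])) : (p : ℤ) ^ r ∣ q.num := by
  apply Pd.dvd_int
  have : ((q.num : ℤ) : ℚ_[p]) = (q : ℚ_[p]) * (q.den : ℚ_[p]) := by
    have := Rat.mul_den_eq_num q
    exact_mod_cast this.symm
  rw [this]
  exact h.mul (Pd.natCast _)

theorem Pd.not_one : ¬ Pd p 1 (1 : ℚ_[p]) := by
  intro h
  have h2 : Pd p 1 (((1 : ℤ)) : ℚ_[p]) := by simpa using h
  have h3 := Pd.dvd_int h2
  rw [pow_one] at h3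
  have h4 : p ∣ 1 := by exact_mod_cast h3
  exact hp.out.one_lt.ne' (Nat.dvd_one.1 h4)

theorem Pd.cancel {a b : ℚ_[p]} {r : ℕ} (h : Pd p r (a * b)) (ha : Pd p 0 a⁻¹) (h0 : a ≠ 0) :
    Pd p r b := by
  have := ha.mul_left h
  rwa [← mul_assoc, inv_mul_cancel₀ h0, one_mul] at this

end cong

/-! ### The linear-weight sum -/

theorem sun_step (n : ℕ) :
    (8 * (2 * n + 1) * ∑ k ∈ Finset.range (n + 1), (((n + k).choose k : ℕ) : ℚ) ^ 2) * n ^ 2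
      = n ^ 2 * (4 * n * ∑ k ∈ Finset.range n, (((n + k - 1).choose k : ℕ) : ℚ) ^ 2
        + (21 * n + 8) * ((2 * n).choose n : ℚ) ^ 2) := by
  rcases Nat.eq_zero_or_pos n with rfl | hn
  · simp
  have key : ∀ m ≤ n, (∑ k ∈ Finset.range m, (8 * (2 * n + 1) * (((n + k).choose k : ℕ) : ℚ) ^ 2
      - 4 * n * (((n + k - 1).choose k : ℕ) : ℚ) ^ 2)) * n ^ 2
      = m ^ 2 * (8 * m + 12 * n) * (((n + m - 1).choose m : ℕ) : ℚ) ^ 2 := by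
    intro m hm
    induction m with
    | zero => simp
    | succ m ih =>
      rw [Finset.sum_range_succ, add_mul, ih (by omega)]
      have h1 : (((n + m).choose m : ℕ) : ℚ) * n = (((n + m - 1).choose m : ℕ) : ℚ) * (n + m) := by
        have h := Nat.add_one_mul_choose_eq (n + m - 1) (n - 1)
        have e1 : n + m - 1 + 1 = n + m := by omega
        have e2 : n - 1 + 1 = n := by omega
        rw [e1, e2] at h
        have e3 : (n + m).choose n = (n + m).choose m := by
          rw [Nat.choose_symm_add]
        have e4 : (n + m - 1).choose (n - 1) = (n + m - 1).choose m := by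
          rw [← Nat.choose_symm (by omega : m ≤ n + m - 1)]
          congr 1; omega
        rw [e3, e4] at h
        have : ((n + m : ℕ) : ℚ) * ((n + m - 1).choose m : ℕ) = ((n + m).choose m : ℕ) * n := by
          exact_mod_cast h
        push_cast at this
        linarith
      have h2 : (((n + (m + 1) - 1).choose (m + 1) : ℕ) : ℚ) * (m + 1)
          = (((n + m - 1).choose m : ℕ) : ℚ) * (n + m) := by
        have h := Nat.add_one_mul_choose_eq (n + m - 1) m
        have e1 : n + m - 1 + 1 = n + m := by omega
        have e2 : n + (m + 1) - 1 = n + m := by omega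
        rw [e1] at h
        rw [e2]
        have : ((n + m : ℕ) : ℚ) * ((n + m - 1).choose m : ℕ)
          = ((n + m).choose (m + 1) : ℕ) * (m + 1) := by exact_mod_cast h
        push_cast at this
        linarith
      push_cast
      set A := (((n + m).choose m : ℕ) : ℚ)
      set B := (((n + m - 1).choose m : ℕ) : ℚ)
      set C := (((n + (m + 1) - 1).choose (m + 1) : ℕ) : ℚ)
      have h1' : A ^ 2 * n ^ 2 = B ^ 2 * (n + m) ^ 2 := by
        rw [← mul_pow, h1, mul_pow]
      have h2' : (m + 1) ^ 2 * C ^ 2 = B ^ 2 * (n + m) ^ 2 := by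
        rw [← mul_pow, mul_comm, h2, mul_pow]
      linear_combination 8 * (2 * (n : ℚ) + 1) * h1' - (8 * ((m : ℚ) + 1) + 12 * n) * h2'
  have hk := key n le_rfl
  rw [Finset.sum_sub_distrib, ← Finset.mul_sum, ← Finset.mul_sum] at hk
  have h3 : ((2 * n).choose n : ℚ) = 2 * (((n + n - 1).choose n : ℕ) : ℚ) := by
    have h := Nat.add_one_mul_choose_eq (n + n - 1) (n - 1)
    have e1 : n + n - 1 + 1 = 2 * n := by omega
    have e2 : n - 1 + 1 = n := by omega
    have e4 : (n + n - 1).choose (n - 1) = (n + n - 1).choose n := by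
      rw [← Nat.choose_symm (by omega : n ≤ n + n - 1)]
      congr 1; omega
    rw [e1, e2, e4] at h
    have hq : ((2 * n : ℕ) : ℚ) * ((n + n - 1).choose n : ℕ) = ((2 * n).choose n : ℕ) * n := by
      exact_mod_cast h
    have hn' : (n : ℚ) ≠ 0 := by positivity
    apply mul_right_cancel₀ hn'
    rw [← hq]; push_cast; ring
  rw [Finset.sum_range_succ]
  have e5 : n + n = 2 * n := by ring
  rw [e5] at hk h3 ⊢
  rw [h3] at *
  linear_combination hk

theorem sun_identity (n : ℕ) :
    ∑ k ∈ Finset.range n, (21 * (k : ℚ) + 8) * ((2 * k).choose k : ℚ) ^ 3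
      = 4 * n * ((2 * n).choose n : ℚ) *
        ∑ k ∈ Finset.range n, (((n + k - 1).choose k : ℕ) : ℚ) ^ 2 := by
  induction n with
  | zero => simp
  | succ n ih =>
    rw [Finset.sum_range_succ, ih]
    rcases Nat.eq_zero_or_pos n with rfl | hn
    · norm_num
    have h := sun_step n
    have hn' : (n : ℚ) ≠ 0 := by positivity
    have h' : (8 * (2 * n + 1) * ∑ k ∈ Finset.range (n + 1), (((n + k).choose k : ℕ) : ℚ) ^ 2)
      = (4 * n * ∑ k ∈ Finset.range n, (((n + k - 1).choose k : ℕ) : ℚ) ^ 2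
        + (21 * n + 8) * ((2 * n).choose n : ℚ) ^ 2) := by
      apply mul_right_cancel₀ (pow_ne_zero 2 hn')
      rw [h]; ring
    have h4 : ((n : ℚ) + 1) * ((2 * (n + 1)).choose (n + 1) : ℚ)
        = 2 * (2 * n + 1) * ((2 * n).choose n : ℚ) := by
      have := Nat.succ_mul_centralBinom_succ n
      simp only [Nat.centralBinom] at this
      exact_mod_cast this
    have e : ∀ k, n + 1 + k - 1 = n + k := fun k => by omega
    simp only [e]
    push_cast
    linear_combination (-(2 * n).choose n : ℚ) * h' - 4 * (∑ k ∈ Finset.range (n + 1), (((n + k).choose k : ℕ) : ℚ) ^ 2) * h4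

theorem choose_two_p {p : ℕ} (hp : p.Prime) : (p : ℤ) ^ 2 ∣ ((2 * p).choose p : ℤ) - 2 := by
  have h := Nat.sum_range_choose_sq p
  rw [Finset.sum_range_succ, ← Finset.sum_erase_add (Finset.range p) _
    (Finset.mem_range.2 hp.pos)] at h
  simp only [Nat.choose_self, Nat.choose_zero_right, one_pow] at h
  have h2 : p ^ 2 ∣ ∑ x ∈ (Finset.range p).erase 0, p.choose x ^ 2 := by
    apply Finset.dvd_sum
    intro i hi
    rw [Finset.mem_erase, Finset.mem_range] at hi
    exact pow_dvd_pow_of_dvd (hp.dvd_choose_self hi.1 hi.2) 2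
  rw [← h]
  push_cast
  rw [add_assoc, one_add_one_eq_two, add_sub_cancel_right]
  exact_mod_cast h2


/-- cube of the central binomial coefficient -/
def uu (k : ℕ) : ℤ := ((2 * k).choose k : ℤ) ^ 3

theorem uu_succ (k : ℕ) : ((k : ℤ) + 1) ^ 3 * uu (k + 1) = 8 * (2 * k + 1) ^ 3 * uu k := by
  have h4 : ((k : ℤ) + 1) * ((2 * (k + 1)).choose (k + 1) : ℤ)
        = 2 * (2 * k + 1) * ((2 * k).choose k : ℤ) := by
    have := Nat.succ_mul_centralBinom_succ k
    simp only [Nat.centralBinom] at this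
    exact_mod_cast this
  unfold uu
  rw [← mul_pow, h4]; ring

section quad
open Polynomial

/-- truncated generating polynomial -/
noncomputable def FF (N j : ℕ) : ℤ[X] := ∑ k ∈ Finset.range N, C ((k : ℤ) ^ j * uu k) * X ^ k

theorem FF_theta (N j : ℕ) : X * derivative (FF N j) = FF N (j + 1) := by
  unfold FF
  rw [derivative_sum, Finset.mul_sum]
  refine Finset.sum_congr rfl fun k _ => ?_
  rw [derivative_C_mul_X_pow]
  rcases k with _ | k
  · simp
  · simp only [Nat.add_sub_cancel, pow_succ, map_mul]
    ring

theorem FF_L (N : ℕ) : (1 - 64 * X) * FF N 3 - 96 * X * FF N 2 - 48 * X * FF N 1 - 8 * X * FF N 0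
    = - C ((N : ℤ) ^ 3 * uu N) * X ^ N := by
  induction N with
  | zero => simp [FF]
  | succ N ih =>
    have e : ∀ j, FF (N + 1) j = FF N j + C ((N : ℤ) ^ j * uu N) * X ^ N := fun j => by
      unfold FF; rw [Finset.sum_range_succ]
    simp only [e]
    have h := congrArg (C : ℤ → ℤ[X]) (uu_succ N)
    push_cast
    simp only [map_mul, map_pow, map_add, map_one, map_natCast, map_ofNat] at h ih ⊢
    linear_combination ih + X ^ (N + 1) * h

theorem FF_eval (N j : ℕ) : (FF N j).eval 1 = ∑ k ∈ Finset.range N, (k : ℤ) ^ j * uu k := by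
  unfold FF
  rw [eval_finsetSum]
  simp

/-- the quadratic first integral -/
noncomputable def QQ (N : ℕ) : ℤ[X] :=
  (1 - 64 * X) * (2 * FF N 0 * FF N 2 - FF N 1 ^ 2) - 64 * X * FF N 0 * FF N 1
    - 16 * X * FF N 0 ^ 2

theorem QQ_theta (N : ℕ) :
    X * derivative (QQ N) = - 2 * C ((N : ℤ) ^ 3 * uu N) * X ^ N * FF N 0 := by
  have h0 := FF_theta N 0
  have h1 := FF_theta N 1
  have h2 := FF_theta N 2
  have h := FF_L N
  generalize C ((N : ℤ) ^ 3 * uu N) = w at h ⊢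
  unfold QQ
  simp only [derivative_mul, derivative_sub, derivative_pow, derivative_X, derivative_one,
    derivative_ofNat, map_ofNat, Nat.cast_ofNat]
  norm_num at h0 h1 h2 ⊢
  linear_combination 2 * FF N 0 * h + (2 * (1 - 64 * X) * FF N 0) * h2 +
    (-2 * FF N 1 * (1 - 64 * X) - 64 * X * FF N 0) * h1 +
    (2 * (1 - 64 * X) * FF N 2 - 64 * X * FF N 1 - 32 * X * FF N 0) * h0

theorem quad_rel {p : ℕ} (hp : p.Prime) :
    (p : ℤ) ^ 3 ∣ (QQ p).eval 1 + 2 * p ^ 2 * uu p := by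
  have hc : ∀ m : ℕ, (m : ℤ) * (QQ p).coeff m =
      -2 * p ^ 3 * uu p * (if p ≤ m then (FF p 0).coeff (m - p) else 0) := by
    intro m
    have h := congrArg (fun f => coeff f m) (QQ_theta p)
    have e : X * derivative (QQ p) = derivative (QQ p) * X := mul_comm _ _
    have e2 : - 2 * C ((p : ℤ) ^ 3 * uu p) * X ^ p * FF p 0
      = C (-2 * p ^ 3 * uu p) * (FF p 0 * X ^ p) := by
      simp only [map_mul, map_pow, map_natCast, map_ofNat, map_neg]; ring
    simp only [e2] at h
    rw [coeff_C_mul, coeff_mul_X_pow'] at h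
    rw [← h]
    rcases m with _ | m
    · simp
    · rw [coeff_X_mul, coeff_derivative]; push_cast; ring
  have hF : ∀ i, p ≤ i → (FF p 0).coeff i = 0 := by
    intro i hi
    unfold FF
    rw [finsetSum_coeff]
    apply Finset.sum_eq_zero
    intro k hk
    rw [coeff_C_mul_X_pow, if_neg]
    have := Finset.mem_range.1 hk
    omega
  have hF0 : (FF p 0).coeff 0 = 1 := by
    unfold FF
    rw [finsetSum_coeff, Finset.sum_eq_single 0]
    · simp [uu]
    · intro b _ hb
      rw [coeff_C_mul_X_pow, if_neg (Ne.symm hb)]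
    · intro h; exact absurd (Finset.mem_range.2 hp.pos) h
  have hF1 : ∀ j, (FF p (j+1)).coeff 0 = 0 := by
    intro j
    rw [← FF_theta]; simp
  have hp0 : (p : ℤ) ≠ 0 := by exact_mod_cast hp.ne_zero
  have hq0 : (QQ p).coeff 0 = 0 := by
    have a1 := hF1 0
    have a2 := hF1 1
    rw [coeff_zero_eq_eval_zero] at *
    unfold QQ
    simp at a1 a2 ⊢
    rw [a1, a2]; simp
  have hqp : (QQ p).coeff p = -2 * p ^ 2 * uu p := by
    apply mul_left_cancel₀ hp0
    rw [hc, if_pos le_rfl, Nat.sub_self, hF0]; ring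
  have hqm : ∀ m, m ≠ p → (p : ℤ) ^ 3 ∣ (QQ p).coeff m := by
    intro m hm
    by_cases hd : p ∣ m
    · by_cases hm0 : m = 0
      · rw [hm0, hq0]; exact dvd_zero _
      obtain ⟨c, rfl⟩ := hd
      have hc0 : c ≠ 0 := by rintro rfl; simp at hm0
      have hc1 : c ≠ 1 := by rintro rfl; simp at hm
      have h2 : p * 2 ≤ p * c := Nat.mul_le_mul_left _ (by omega)
      have h := hc (p * c)
      rw [if_pos (by omega), hF _ (by omega), mul_zero] at h
      have h3 : ((p * c : ℕ) : ℤ) ≠ 0 := by exact_mod_cast hm0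
      rw [(mul_eq_zero.1 h).resolve_left h3]
      exact dvd_zero _
    · have hcop : IsCoprime ((p : ℤ) ^ 3) (m : ℤ) := by
        apply IsCoprime.pow_left
        exact Nat.isCoprime_iff_coprime.2 ((Nat.Prime.coprime_iff_not_dvd hp).2 hd)
      apply hcop.dvd_of_dvd_mul_left
      rw [hc]
      exact ⟨-2 * uu p * (if p ≤ m then (FF p 0).coeff (m - p) else 0), by ring⟩
  rw [eval_eq_sum_range' (show (QQ p).natDegree < (QQ p).natDegree + p + 1 by omega)]
  rw [← Finset.sum_erase_add _ _ (Finset.mem_range.2 (show p < (QQ p).natDegree + p + 1 by omega))]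
  rw [hqp]
  simp only [one_pow, mul_one]
  rw [add_assoc, show -2 * (p:ℤ) ^ 2 * uu p + 2 * p ^ 2 * uu p = 0 by ring, add_zero]
  apply Finset.dvd_sum
  intro i hi
  exact hqm i (Finset.mem_erase.1 hi).1

end quad

section sums
variable {p : ℕ}

/-- the sums `S_j` -/
noncomputable def SS (p j : ℕ) : ℤ := ∑ k ∈ Finset.range p, (k : ℤ) ^ j * uu k

theorem rel3 (p : ℕ) : 63 * SS p 3 + 96 * SS p 2 + 48 * SS p 1 + 8 * SS p 0 = p ^ 3 * uu p := by
  have h := congrArg (Polynomial.eval 1) (FF_L p)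
  simp [FF_eval] at h
  unfold SS
  simp
  linarith

theorem uu_p (hp : p.Prime) : (p : ℤ) ^ 2 ∣ uu p - 8 := by
  have h := choose_two_p hp
  have : uu p - 8 = (((2 * p).choose p : ℤ) - 2) *
    (((2 * p).choose p : ℤ) ^ 2 + 2 * ((2 * p).choose p : ℤ) + 4) := by unfold uu; ring
  rw [this]
  exact h.mul_right _

theorem rel_quad (hp : p.Prime) :
    (p : ℤ) ^ 3 ∣ 63 * (2 * SS p 0 * SS p 2 - SS p 1 ^ 2) + 64 * SS p 0 * SS p 1 + 16 * SS p 0 ^ 2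
      - 16 * p ^ 2 := by
  have h := quad_rel hp
  obtain ⟨c, hc⟩ := uu_p hp
  have e : (QQ p).eval 1 = - (63 * (2 * SS p 0 * SS p 2 - SS p 1 ^ 2) + 64 * SS p 0 * SS p 1
      + 16 * SS p 0 ^ 2) := by
    unfold QQ SS
    simp [FF_eval]
    ring
  rw [e] at h
  obtain ⟨d, hd⟩ := h
  refine ⟨-d + 2 * p * c, ?_⟩
  linear_combination -hd + 2 * (p : ℤ) ^ 2 * hc

theorem rel1 (hp : p.Prime) : (p : ℤ) ^ 3 ∣ 21 * SS p 1 + 8 * SS p 0 - 8 * p := by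
  have h := sun_identity p
  have e : 21 * SS p 1 + 8 * SS p 0 = 4 * p * ((2 * p).choose p : ℤ) *
        ∑ k ∈ Finset.range p, (((p + k - 1).choose k : ℕ) : ℤ) ^ 2 := by
    have : ((21 * SS p 1 + 8 * SS p 0 : ℤ) : ℚ) = ((4 * p * ((2 * p).choose p : ℤ) *
        ∑ k ∈ Finset.range p, (((p + k - 1).choose k : ℕ) : ℤ) ^ 2 : ℤ) : ℚ) := by
      push_cast
      rw [← h]
      unfold SS uu
      push_cast
      rw [Finset.mul_sum, Finset.mul_sum, ← Finset.sum_add_distrib]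
      refine Finset.sum_congr rfl fun k _ => ?_
      ring
    exact_mod_cast this
  have h2 : (p : ℤ) ^ 2 ∣ (∑ k ∈ Finset.range p, (((p + k - 1).choose k : ℕ) : ℤ) ^ 2) - 1 := by
    rw [← Finset.sum_erase_add (Finset.range p) _ (Finset.mem_range.2 hp.pos)]
    simp only [Nat.choose_zero_right, Nat.cast_one, one_pow, add_sub_cancel_right]
    apply Finset.dvd_sum
    intro i hi
    rw [Finset.mem_erase, Finset.mem_range] at hi
    apply pow_dvd_pow_of_dvd
    norm_cast
    apply hp.dvd_choose <;> omega
  obtain ⟨c, hc⟩ := h2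
  obtain ⟨d, hd⟩ := choose_two_p hp
  rw [e]
  refine ⟨4 * ((2 * p).choose p : ℤ) * c + 4 * d, ?_⟩
  linear_combination 4 * p * ((2 * p).choose p : ℤ) * hc + 4 * p * hd

theorem p_dvd_choose (hp : p.Prime) {k : ℕ} (h1 : p ≤ 2 * k) (h2 : k < p) :
    p ∣ (2 * k).choose k := by
  apply hp.dvd_choose <;> omega

theorem relR_id (N : ℕ) : ∑ k ∈ Finset.range N,
    (63 * (k : ℚ) ^ 2 + 32 * k + 16 - 8 / (k + 1)) * (uu k : ℚ) = (N : ℚ) ^ 2 * (uu N : ℚ) := by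
  induction N with
  | zero => simp
  | succ N ih =>
    rw [Finset.sum_range_succ, ih]
    have h : ((N : ℚ) + 1) ^ 3 * uu (N + 1) = 8 * (2 * N + 1) ^ 3 * uu N := by
      exact_mod_cast uu_succ N
    have hN : ((N : ℚ) + 1) ≠ 0 := by positivity
    push_cast
    field_simp
    linear_combination -h


theorem relR [hp : Fact p.Prime] (hp2 : p ≠ 2) :
    Pd p 2 (63 * (SS p 2 : ℚ_[p]) + 32 * SS p 1 + 16 * SS p 0 - 8 * ((R7 p : ℚ) : ℚ_[p])) := by
  have h2 : 2 < p := lt_of_le_of_ne hp.out.two_le (Ne.symm hp2)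
  have hp0 : (p : ℚ_[p]) ≠ 0 := by exact_mod_cast hp.out.ne_zero
  have h := relR_id p
  have hs : ∑ k ∈ Finset.range p, (63 * (k : ℚ) ^ 2 + 32 * k + 16 - 8 / (k + 1)) * (uu k : ℚ)
      = 63 * (SS p 2 : ℚ) + 32 * SS p 1 + 16 * SS p 0 - 8 * R7 p
        - 8 * ∑ k ∈ Finset.Ico ((p-1)/2 + 1) p, (uu k : ℚ) / (k + 1) := by
    have e : R7 p + ∑ k ∈ Finset.Ico ((p-1)/2 + 1) p, (uu k : ℚ) / (k + 1)
      = ∑ k ∈ Finset.range p, (uu k : ℚ) / (k + 1) := by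
      rw [← Finset.sum_range_add_sum_Ico (fun k => (uu k : ℚ) / (k + 1))
        (show (p-1)/2 + 1 ≤ p by omega)]
      simp [R7, uu]
    rw [sub_sub, ← mul_add, e]
    unfold SS
    push_cast
    simp only [Finset.mul_sum, ← Finset.sum_add_distrib, ← Finset.sum_sub_distrib]
    refine Finset.sum_congr rfl fun k _ => ?_
    ring
  rw [hs] at h
  have h3 : 63 * (SS p 2 : ℚ_[p]) + 32 * SS p 1 + 16 * SS p 0 - 8 * ((R7 p : ℚ) : ℚ_[p])
      = p ^ 2 * (uu p : ℚ_[p])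
        + 8 * ∑ k ∈ Finset.Ico ((p-1)/2 + 1) p, (uu k : ℚ_[p]) / (k + 1) := by
    have := congrArg (fun q : ℚ => (q : ℚ_[p])) h
    push_cast at this
    linear_combination this
  rw [h3]
  refine ((Pd.ppow 2).mul_right (Pd.intCast _)).add ((Pd.ofNat 8).mul_left (Pd.sum _ _ ?_))
  intro k hk
  rw [Finset.mem_Ico] at hk
  have hu : ∃ c : ℤ, uu k = p ^ 3 * c := by
    have := p_dvd_choose hp.out (show p ≤ 2 * k by omega) hk.2
    obtain ⟨c, hc⟩ := this
    refine ⟨c ^ 3, ?_⟩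
    unfold uu
    rw [hc]; push_cast; ring
  obtain ⟨c, hc⟩ := hu
  rw [hc]
  by_cases hkp : k + 1 = p
  · have : ((k : ℚ_[p]) + 1) = p := by exact_mod_cast hkp
    rw [this]
    refine ⟨c, ?_⟩
    push_cast
    field_simp
  · rw [div_eq_mul_inv]
    have h5 : ¬ p ∣ k + 1 := by
      intro h6
      have := Nat.le_of_dvd (by omega) h6
      omega
    have h4 := Pd.inv_nat (p := p) h5
    push_cast at h4 ⊢
    exact (((Pd.ppow 3).mul_right (Pd.intCast _)).mul_right h4).mono (by norm_num)

end sums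

section conclude
variable {p : ℕ} [hp : Fact p.Prime]

theorem not_dvd_of_small {q : ℕ} (hq : q.Prime) (h : p ≠ q) : ¬ p ∣ q := fun h2 =>
  h ((Nat.prime_dvd_prime_iff_eq hp.out hq).1 h2)

theorem inv3 (h : p ≠ 3) : Pd p 0 ((3 : ℚ_[p])⁻¹) := by
  exact_mod_cast Pd.inv_nat (p := p) (not_dvd_of_small Nat.prime_three h)
theorem inv7 (h : p ≠ 7) : Pd p 0 ((7 : ℚ_[p])⁻¹) := by
  exact_mod_cast Pd.inv_nat (p := p) (not_dvd_of_small (by norm_num) h)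
theorem inv2 (h : p ≠ 2) : Pd p 0 ((2 : ℚ_[p])⁻¹) := by
  exact_mod_cast Pd.inv_nat (p := p) (not_dvd_of_small Nat.prime_two h)

theorem S_cast (p j : ℕ) : ∑ k ∈ Finset.range p, (k:ℚ)^j * ((2*k).choose k : ℚ)^3 = (SS p j : ℚ) := by
  unfold SS uu
  push_cast
  rfl

theorem final_inert (hp2 : p ≠ 2) (hp3 : p ≠ 3) (hp7 : p ≠ 7) (h0 : Pd p 2 (SS p 0 : ℚ_[p])) :
    ratCongr p 2
        (∑ k ∈ Finset.range p, (k:ℚ)^2 * ((2*k).choose k : ℚ)^3)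
        (8/63*R7 p - 256/1323*(p:ℚ)) ∧
      ratCongr p 2
        (∑ k ∈ Finset.range p, (k:ℚ)^3 * ((2*k).choose k : ℚ)^3)
        (-(256/1323)*R7 p + 128/27783*(p:ℚ)) := by
  have i3 := inv3 hp3
  have i7 := inv7 hp7
  have hR := relR hp2
  have h1 := (Pd.of_dvd (p := p) (rel1 hp.out)).mono (show 2 ≤ 3 by norm_num)
  have h3 : Pd p 2 ((63 * SS p 3 + 96 * SS p 2 + 48 * SS p 1 + 8 * SS p 0 : ℤ) : ℚ_[p]) := by
    apply Pd.of_dvd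
    rw [rel3]
    exact Dvd.intro _ (by ring : (p : ℤ) ^ 2 * (p * uu p) = _)
  rw [S_cast, S_cast]
  push_cast at h1 h3
  have k1 : Pd p 2 ((SS p 1 : ℚ_[p]) - 8 / 21 * p) := by
    have := (i3.mul_left (i7.mul_left (h1.sub ((Pd.ofNat 8).mul_left h0))))
    convert this using 1
    ring
  have k2 : Pd p 2 ((SS p 2 : ℚ_[p]) - (8/63*(R7 p : ℚ) - 256/1323*(p:ℚ_[p]))) := by
    have := i3.mul_left (i3.mul_left (i7.mul_left ((hR.sub ((Pd.ofNat 32).mul_left k1)).sub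
      ((Pd.ofNat 16).mul_left h0))))
    convert this using 1
    ring
  have k3 : Pd p 2 ((SS p 3 : ℚ_[p]) - (-(256/1323)*(R7 p : ℚ) + 128/27783*(p:ℚ_[p]))) := by
    have := i3.mul_left (i3.mul_left (i7.mul_left (((h3.sub ((Pd.ofNat 96).mul_left k2)).sub
      ((Pd.ofNat 48).mul_left k1)).sub ((Pd.ofNat 8).mul_left h0))))
    convert this using 1
    ring
  constructor
  · apply Pd.dvd_num; push_cast; exact k2
  · apply Pd.dvd_num; push_cast; exact k3

theorem final_split (hp3 : p ≠ 3) (hp7 : p ≠ 7) (hp2 : p ≠ 2) (x : ℤ) (hx : ¬ (p : ℤ) ∣ x)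
    (h0 : Pd p 3 ((SS p 0 : ℚ_[p]) - (4 * x ^ 2 - 2 * p - p ^ 2 / (4 * x ^ 2)))) :
    ratCongr p 3
        (∑ k ∈ Finset.range p, (k:ℚ)^2 * ((2*k).choose k : ℚ)^3)
        (736/1323*(x:ℚ)^2 - 272/441*(p:ℚ) + 20*(p:ℚ)^2/(1323*(x:ℚ)^2)) ∧
      ratCongr p 3
        (∑ k ∈ Finset.range p, (k:ℚ)^3 * ((2*k).choose k : ℚ)^3)
        (-(5408/27783)*(x:ℚ)^2 + 2992/9261*(p:ℚ) - 1774*(p:ℚ)^2/(27783*(x:ℚ)^2)) := by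
  have i3 := inv3 hp3
  have i7 := inv7 hp7
  have i2 := inv2 hp2
  have ix := Pd.inv_int hx
  have h1 := (Pd.of_dvd (p := p) (rel1 hp.out))
  have hq := (Pd.of_dvd (p := p) (rel_quad hp.out))
  have h3 : Pd p 3 ((63 * SS p 3 + 96 * SS p 2 + 48 * SS p 1 + 8 * SS p 0 : ℤ) : ℚ_[p]) := by
    apply Pd.of_dvd
    rw [rel3]
    exact Dvd.intro _ rfl
  rw [S_cast, S_cast]
  push_cast at h1 h3 hq
  have hx0 : (x : ℚ_[p]) ≠ 0 := by
    intro h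
    apply hx
    have : x = 0 := by exact_mod_cast h
    rw [this]; exact dvd_zero _
  set X : ℚ_[p] := (x : ℚ_[p]) with hX
  set s0 : ℚ_[p] := 4 * X ^ 2 - 2 * p - p ^ 2 / (4 * X ^ 2) with hs0
  have hp1 : Pd p 0 (p : ℚ_[p]) := Pd.p1.mono (by norm_num)
  have x0 : Pd p 0 X := Pd.intCast _
  have iX : Pd p 0 X⁻¹ := ix
  have i4x : Pd p 0 ((4 * X ^ 2)⁻¹) := by
    have := (i2.mul_left i2).mul_left (iX.pow0 2)
    convert this using 1
    field_simp; norm_num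
  have s0i : Pd p 0 s0 := by
    rw [hs0]
    refine (((Pd.ofNat 4).mul_left (x0.pow0 2)).sub ((Pd.ofNat 2).mul_left hp1)).sub ?_
    rw [div_eq_mul_inv]
    exact (hp1.pow0 2).mul_left i4x
  have k1 : Pd p 3 ((SS p 1 : ℚ_[p]) - (8 * p - 8 * s0) / 21) := by
    have := (i3.mul_left (i7.mul_left (h1.sub ((Pd.ofNat 8).mul_left h0))))
    convert this using 1
    ring
  have I0 : Pd p 0 (SS p 0 : ℚ_[p]) := Pd.intCast _
  have I1 : Pd p 0 (SS p 1 : ℚ_[p]) := Pd.intCast _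
  have I2 : Pd p 0 (SS p 2 : ℚ_[p]) := Pd.intCast _
  set s1 : ℚ_[p] := (8 * p - 8 * s0) / 21 with hs1
  have s1i : Pd p 0 s1 := by
    have := i3.mul_left (i7.mul_left ((Pd.ofNat 8).mul_left (hp1.sub s0i)))
    convert this using 1
    rw [hs1]; ring
  have hq2 : Pd p 3 (63 * (2 * s0 * SS p 2 - s1 ^ 2) + 64 * s0 * s1 + 16 * s0 ^ 2 - 16 * p ^ 2) := by
    have a1 := hq.sub (((((Pd.ofNat 126).mul_left I2)).add ((Pd.ofNat 64).mul_left I1)).add ((Pd.ofNat 16).mul_left (I0.add s0i)) |>.mul_left h0)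
    have a2 := a1.add ((((Pd.ofNat 63).mul_left (I1.add s1i)).sub ((Pd.ofNat 64).mul_left s0i)).mul_left k1)
    convert a2 using 1
    ring
  set s2 : ℚ_[p] := 736/1323*X^2 - 272/441*(p:ℚ_[p]) + 20*(p:ℚ_[p])^2/(1323*X^2) with hs2
  -- s2 solves the quadratic relation
  have hsol : Pd p 3 (63 * (2 * s0 * s2 - s1 ^ 2) + 64 * s0 * s1 + 16 * s0 ^ 2 - 16 * p ^ 2) := by
    have : 63 * (2 * s0 * s2 - s1 ^ 2) + 64 * s0 * s1 + 16 * s0 ^ 2 - 16 * p ^ 2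
      = p ^ 3 * (- 88 * 7⁻¹ * X⁻¹ ^ 2 - 11 * 7⁻¹ * p * X⁻¹ ^ 4) := by
      rw [hs1, hs2, hs0]
      field_simp
      ring
    rw [this]
    refine (Pd.ppow 3).mul_right (Pd.sub ?_ ?_)
    · exact ((Pd.ofNat 88).neg.mul_left i7).mul_left (iX.pow0 2)
    · exact (((Pd.ofNat 11).mul_left i7).mul_left hp1).mul_left (iX.pow0 4)
  have hs0n : ¬ Pd p 1 s0 := by
    intro h
    have a1 : Pd p 1 (4 * X ^ 2) := by
      have a2 : Pd p 1 ((p : ℚ_[p]) * (2 + p * (4 * X ^ 2)⁻¹)) :=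
        Pd.p1.mul_right ((Pd.ofNat 2).add (hp1.mul_left i4x))
      have := h.add a2
      convert this using 1
      rw [hs0]; field_simp; ring
    have := i4x.mul_left a1
    rw [inv_mul_cancel₀ (by simp [hx0])] at this
    exact Pd.not_one this
  have is0 := Pd.inv_of_not s0i hs0n
  have s0n0 : s0 ≠ 0 := fun h => hs0n (h ▸ Pd.zero 1)
  have k2 : Pd p 3 ((SS p 2 : ℚ_[p]) - s2) := by
    have := is0.mul_left (i2.mul_left (i3.mul_left (i3.mul_left (i7.mul_left (hq2.sub hsol)))))
    convert this using 1
    field_simp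
    ring
  have k3 : Pd p 3 ((SS p 3 : ℚ_[p]) - (-(5408/27783)*X^2 + 2992/9261*(p:ℚ_[p])
      - 1774*(p:ℚ_[p])^2/(27783*X^2))) := by
    have := i3.mul_left (i3.mul_left (i7.mul_left (((h3.sub ((Pd.ofNat 96).mul_left k2)).sub
      ((Pd.ofNat 48).mul_left k1)).sub ((Pd.ofNat 8).mul_left h0))))
    convert this using 1
    rw [hs2, hs1, hs0]
    field_simp
    ring
  constructor
  · apply Pd.dvd_num; push_cast; exact k2
  · apply Pd.dvd_num; push_cast; exact k3

end conclude


section clausen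
open Polynomial

/-- coefficients in Clausen formula -/
def tt (k j : ℕ) : ℚ := ((k + j).choose (2 * j) : ℚ) * ((2 * j).choose j : ℚ) ^ 2

/-- Clausen polynomials -/
noncomputable def cp (k : ℕ) : ℚ[X] := ∑ j ∈ Finset.range (k + 1), C (tt k j) * X ^ j

theorem tt_zero {k j : ℕ} (h : k < j) : tt k j = 0 := by
  unfold tt
  rw [Nat.choose_eq_zero_of_lt (by omega)]
  simp

theorem cp_coeff (k j : ℕ) : (cp k).coeff j = tt k j := by
  unfold cp
  rw [finsetSum_coeff]
  simp only [coeff_C_mul_X_pow]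
  rw [Finset.sum_ite_eq]
  split_ifs with h
  · rfl
  · rw [tt_zero]; simpa using h

theorem ch_down (m r : ℕ) : ((m.choose (r + 1) : ℕ) : ℚ) * (r + 1) = (m.choose r : ℕ) * (m - r) := by
  rcases le_or_gt r m with h | h
  · have := Nat.choose_succ_right_eq m r
    rw [← Nat.cast_sub h]
    exact_mod_cast this
  · rw [Nat.choose_eq_zero_of_lt h, Nat.choose_eq_zero_of_lt (by omega)]; simp

theorem ch_up (m r : ℕ) : (((m + 1).choose (r + 1) : ℕ) : ℚ) * (r + 1) = (m.choose r : ℕ) * (m + 1) := by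
  have := Nat.add_one_mul_choose_eq m r
  have h2 : (((m + 1) * m.choose r : ℕ) : ℚ) = (((m + 1).choose (r + 1) * (r + 1) : ℕ) : ℚ) := by
    rw [this]
  push_cast at h2
  linarith

theorem cb_succ (j : ℕ) : ((j : ℚ) + 1) * ((2 * (j + 1)).choose (j + 1) : ℚ)
        = 2 * (2 * j + 1) * ((2 * j).choose j : ℚ) := by
  have := Nat.succ_mul_centralBinom_succ j
  simp only [Nat.centralBinom] at this
  exact_mod_cast this

theorem tt_rec (k : ℕ) (j : ℕ) :
    (2 * (k : ℚ) + 3) * ((2 * k + 5) ^ 2 * (tt (k + 2) (j+1) + 4 * tt (k + 2) j)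
        + (k + 2) ^ 2 * tt (k + 1) (j+1) - (k + 3) ^ 2 * tt (k + 3) (j+1))
      + (2 * k + 5) * ((2 * k + 3) ^ 2 * (tt (k + 1) (j+1) + 4 * tt (k + 1) j)
        + (k + 1) ^ 2 * tt k (j+1) - (k + 2) ^ 2 * tt (k + 2) (j+1))
      = 2 * (2 * k + 3) ^ 2 * (2 * k + 5) * (tt (k + 1) (j+1) + 4 * tt (k + 1) j) := by
  have hcb := cb_succ j
  have hj : (j : ℚ) + 1 ≠ 0 := by positivity
  have hcb' : ((2 * (j + 1)).choose (j + 1) : ℚ)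
        = 2 * (2 * j + 1) * ((2 * j).choose j : ℚ) / (j + 1) := by
    rw [← hcb]; field_simp
  rcases j with _ | i
  · unfold tt
    rw [hcb']
    have d : ∀ m : ℕ, ((m.choose 2 : ℕ) : ℚ) = m * (m - 1) / 2 := fun m => Nat.cast_choose_two ℚ m
    simp [d]
    ring
  · -- everything in terms of B
    set B : ℚ := (((k + i + 2).choose (2 * i + 1) : ℕ) : ℚ) with hB
    have p1 : (0 : ℚ) < 2 * i + 2 := by positivity
    have p2 : (0 : ℚ) < 2 * i + 3 := by positivity
    have p3 : (0 : ℚ) < 2 * i + 4 := by positivity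
    have b1 : (((k + i + 2).choose (2 * i + 2) : ℕ) : ℚ) = B * (k + 1 - i) / (2 * i + 2) := by
      have := ch_down (k + i + 2) (2 * i + 1)
      push_cast at this
      field_simp
      rw [← hB] at this
      linear_combination this
    have b2 : (((k + i + 2).choose (2 * i + 3) : ℕ) : ℚ)
        = B * (k + 1 - i) * (k - i) / ((2 * i + 2) * (2 * i + 3)) := by
      have := ch_down (k + i + 2) (2 * i + 2)
      rw [b1] at this
      push_cast at this
      field_simp at this ⊢
      linear_combination this
    have b3 : (((k + i + 2).choose (2 * i + 4) : ℕ) : ℚ)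
        = B * (k + 1 - i) * (k - i) * (k - i - 1) / ((2 * i + 2) * (2 * i + 3) * (2 * i + 4)) := by
      have := ch_down (k + i + 2) (2 * i + 3)
      rw [b2] at this
      push_cast at this
      field_simp at this ⊢
      linear_combination this
    have b4 : (((k + i + 3).choose (2 * i + 2) : ℕ) : ℚ) = B * (k + i + 3) / (2 * i + 2) := by
      have := ch_up (k + i + 2) (2 * i + 1)
      rw [← hB] at this
      push_cast at this
      field_simp
      linear_combination this
    have b5 : (((k + i + 3).choose (2 * i + 3) : ℕ) : ℚ)
        = B * (k + 1 - i) * (k + i + 3) / ((2 * i + 2) * (2 * i + 3)) := by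
      have := ch_up (k + i + 2) (2 * i + 2)
      rw [b1] at this
      push_cast at this
      field_simp at this ⊢
      linear_combination this
    have b6 : (((k + i + 3).choose (2 * i + 4) : ℕ) : ℚ)
        = B * (k + 1 - i) * (k - i) * (k + i + 3) / ((2 * i + 2) * (2 * i + 3) * (2 * i + 4)) := by
      have := ch_up (k + i + 2) (2 * i + 3)
      rw [b2] at this
      push_cast at this
      field_simp at this ⊢
      linear_combination this
    have b7 : (((k + i + 4).choose (2 * i + 4) : ℕ) : ℚ)
        = B * (k + 1 - i) * (k + i + 3) * (k + i + 4) / ((2 * i + 2) * (2 * i + 3) * (2 * i + 4)) := by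
      have := ch_up (k + i + 3) (2 * i + 3)
      rw [b5] at this
      push_cast at this
      field_simp at this ⊢
      linear_combination this
    have b8 : (((k + i + 4).choose (2 * i + 3) : ℕ) : ℚ)
        = B * (k + i + 3) * (k + i + 4) / ((2 * i + 2) * (2 * i + 3)) := by
      have := ch_up (k + i + 3) (2 * i + 2)
      rw [b4] at this
      push_cast at this
      field_simp at this ⊢
      linear_combination this
    have b9 : (((k + i + 5).choose (2 * i + 4) : ℕ) : ℚ)
        = B * (k + i + 3) * (k + i + 4) * (k + i + 5) / ((2 * i + 2) * (2 * i + 3) * (2 * i + 4)) := by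
      have := ch_up (k + i + 4) (2 * i + 3)
      rw [b8] at this
      push_cast at this
      field_simp at this ⊢
      linear_combination this
    unfold tt
    rw [hcb']
    have e1 : k + 2 + (i + 1 + 1) = k + i + 4 := by ring
    have e2 : k + 2 + (i + 1) = k + i + 3 := by ring
    have e3 : k + 1 + (i + 1 + 1) = k + i + 3 := by ring
    have e4 : k + 3 + (i + 1 + 1) = k + i + 5 := by ring
    have e5 : k + 1 + (i + 1) = k + i + 2 := by ring
    have e6 : k + (i + 1 + 1) = k + i + 2 := by ring
    have e7 : 2 * (i + 1 + 1) = 2 * i + 4 := by ring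
    have e8 : 2 * (i + 1) = 2 * i + 2 := by ring
    rw [e1, e2, e3, e4, e5, e6, e7, e8, b1, b3, b4, b6, b7, b9]
    push_cast
    field_simp
    ring

theorem cp_rec (k : ℕ) :
    (2 * (k : ℚ[X]) + 3) * ((2 * (k : ℚ[X]) + 5) ^ 2 * ((1 + 4 * X) * cp (k + 2))
        + ((k : ℚ[X]) + 2) ^ 2 * cp (k + 1) - ((k : ℚ[X]) + 3) ^ 2 * cp (k + 3))
      + (2 * (k : ℚ[X]) + 5) * ((2 * (k : ℚ[X]) + 3) ^ 2 * ((1 + 4 * X) * cp (k + 1))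
        + ((k : ℚ[X]) + 1) ^ 2 * cp k - ((k : ℚ[X]) + 2) ^ 2 * cp (k + 2))
      = 2 * (2 * (k : ℚ[X]) + 3) ^ 2 * (2 * (k : ℚ[X]) + 5) * ((1 + 4 * X) * cp (k + 1)) := by
  have key : C ((2 * (k : ℚ) + 3) * (2 * k + 5) ^ 2) * (cp (k + 2) + X * (C 4 * cp (k + 2)))
        + C ((2 * (k : ℚ) + 3) * (k + 2) ^ 2) * cp (k + 1)
        - C ((2 * (k : ℚ) + 3) * (k + 3) ^ 2) * cp (k + 3)
      + C ((2 * (k : ℚ) + 5) * (2 * k + 3) ^ 2) * (cp (k + 1) + X * (C 4 * cp (k + 1)))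
        + C ((2 * (k : ℚ) + 5) * (k + 1) ^ 2) * cp k
        - C ((2 * (k : ℚ) + 5) * (k + 2) ^ 2) * cp (k + 2)
      = C (2 * (2 * (k : ℚ) + 3) ^ 2 * (2 * k + 5)) * (cp (k + 1) + X * (C 4 * cp (k + 1))) := by
    ext j
    rcases j with _ | j
    · simp only [coeff_add, coeff_sub, coeff_C_mul, coeff_X_mul_zero, cp_coeff]
      simp [tt]
      ring
    · simp only [coeff_add, coeff_sub, coeff_C_mul, coeff_X_mul, cp_coeff]
      linear_combination tt_rec k j
  simp only [map_mul, map_pow, map_add, map_natCast, map_ofNat, map_one] at key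
  linear_combination key

/-- The integers `c_k`. -/
def cc (k : ℕ) : ℤ := ∑ j ∈ Finset.range (k + 1),
  ((k + j).choose (2 * j) : ℤ) * ((2 * j).choose j : ℤ) ^ 2 * (-16) ^ j

theorem cc_eval (k : ℕ) : (cp k).eval (-16) = (cc k : ℚ) := by
  unfold cp cc tt
  rw [eval_finsetSum]
  push_cast
  refine Finset.sum_congr rfl fun j _ => ?_
  simp

theorem cc_rec (k : ℕ) :
    (2 * (k : ℚ) + 3) * ((2 * k + 5) ^ 2 * ((-63) * cc (k + 2))
        + (k + 2) ^ 2 * cc (k + 1) - (k + 3) ^ 2 * cc (k + 3))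
      + (2 * k + 5) * ((2 * k + 3) ^ 2 * ((-63) * cc (k + 1))
        + (k + 1) ^ 2 * cc k - (k + 2) ^ 2 * cc (k + 2))
      = 2 * (2 * k + 3) ^ 2 * (2 * k + 5) * ((-63) * cc (k + 1)) := by
  have h := congrArg (eval (-16)) (cp_rec k)
  simp [cc_eval] at h
  linear_combination h

/-- scaled Legendre values -/
def mm : ℕ → ℚ
  | 0 => 1
  | 1 => 3
  | (k + 2) => (3 * (2 * k + 3) * mm (k + 1) + (k + 1) / 7 * mm k) / (k + 2)

theorem mm_rec (k : ℕ) : ((k : ℚ) + 2) * mm (k + 2) =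
    3 * (2 * k + 3) * mm (k + 1) + (k + 1) / 7 * mm k := by
  rw [mm]
  have : (k : ℚ) + 2 ≠ 0 := by positivity
  field_simp

theorem clausen (k : ℕ) : (cc k : ℚ) = (-7) ^ k * mm k ^ 2 := by
  suffices h : (cc k : ℚ) = (-7) ^ k * mm k ^ 2 ∧ (cc (k+1) : ℚ) = (-7) ^ (k+1) * mm (k+1) ^ 2 ∧
      (cc (k+2) : ℚ) = (-7) ^ (k+2) * mm (k+2) ^ 2 from h.1
  induction k with
  | zero =>
    have m2 := mm_rec 0
    simp only [mm] at m2
    refine ⟨?_, ?_, ?_⟩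
    · simp [cc, mm]
    · simp [cc, mm, Finset.sum_range_succ]; norm_num
    · norm_num at m2
      have : mm 2 = 95 / 7 := by simp [mm]; norm_num
      norm_num [this, cc, Finset.sum_range_succ, Nat.choose]
  | succ k ih =>
    obtain ⟨h0, h1, h2⟩ := ih
    refine ⟨h1, h2, ?_⟩
    have hr := cc_rec k
    rw [h0, h1, h2] at hr
    have r1 := mm_rec k
    have r2 := mm_rec (k + 1)
    have q1 : (k : ℚ) + 2 ≠ 0 := by positivity
    have q2 : (k : ℚ) + 3 ≠ 0 := by positivity
    have q3 : 2 * (k : ℚ) + 3 ≠ 0 := by positivity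
    rw [show k + 1 + 2 = k + 3 by ring] at *
    push_cast at r2
    have e2 : mm (k + 2) = (3 * (2 * k + 3) * mm (k + 1) + (k + 1) / 7 * mm k) / (k + 2) := by
      rw [← r1]; field_simp
    have e3 : mm (k + 3) = (3 * (2 * k + 5) * mm (k + 2) + (k + 2) / 7 * mm (k + 1)) / (k + 3) := by
      rw [show (3 * (2 * (k : ℚ) + 5) * mm (k + 2) + (k + 2) / 7 * mm (k + 1)) =
        (k + 3) * mm (k + 3) by rw [show k + 1 + 1 = k + 2 by ring] at r2; linear_combination -r2]
      field_simp
    apply mul_left_cancel₀ (mul_ne_zero q3 (pow_ne_zero 2 q2))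
    rw [e3]
    rw [e2] at hr ⊢
    generalize mm k = a at *
    generalize mm (k + 1) = b at *
    generalize (cc (k + 3) : ℚ) = c at *
    simp only [pow_succ (-7 : ℚ)] at hr ⊢
    generalize ((-7 : ℚ) ^ k) = s at *
    trans (2 * (k:ℚ) + 3) * ((2 * k + 5) ^ 2 * ((-63) * (s * -7 * -7 *
        ((3 * (2 * k + 3) * b + (k + 1) / 7 * a) / (k + 2)) ^ 2))
        + (k + 2) ^ 2 * (s * -7 * b ^ 2))
      + (2 * k + 5) * ((2 * k + 3) ^ 2 * ((-63) * (s * -7 * b ^ 2))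
        + (k + 1) ^ 2 * (s * a ^ 2) - (k + 2) ^ 2 * (s * -7 * -7 *
        ((3 * (2 * k + 3) * b + (k + 1) / 7 * a) / (k + 2)) ^ 2))
      - 2 * (2 * k + 3) ^ 2 * (2 * k + 5) * ((-63) * (s * -7 * b ^ 2))
    · linear_combination -hr
    · field_simp
      ring

end clausen


section trunc
variable {p : ℕ} [hp : Fact p.Prime]

theorem odd_inv {n : ℕ} (hn : p = 2 * n + 1) {k : ℕ} (hk : k < n) :
    Pd p 0 ((2 * (k : ℚ_[p]) + 1)⁻¹) := by
  have : ¬ p ∣ 2 * k + 1 := fun h => by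
    have := Nat.le_of_dvd (by omega) h
    omega
  exact_mod_cast Pd.inv_nat (p := p) this

theorem odd_ne (k : ℕ) : (2 * (k : ℚ_[p]) + 1) ≠ 0 := by
  have : ((2 * k + 1 : ℕ) : ℚ_[p]) ≠ 0 := Nat.cast_ne_zero.2 (by omega)
  exact_mod_cast this

theorem succ_ne (k : ℕ) : ((k : ℚ_[p]) + 1) ≠ 0 := by
  have : ((k + 1 : ℕ) : ℚ_[p]) ≠ 0 := Nat.cast_ne_zero.2 (by omega)
  exact_mod_cast this

/-- odd harmonic sums -/
noncomputable def HH (p : ℕ) [hp : Fact p.Prime] (j : ℕ) : ℚ_[p] :=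
  ∑ i ∈ Finset.range j, ((2 * (i : ℚ_[p]) + 1)⁻¹) ^ 2

theorem HH_int {n : ℕ} (hn : p = 2 * n + 1) {j : ℕ} (hj : j ≤ n) : Pd p 0 (HH p j) := by
  apply Pd.sum
  intro i hi
  exact (odd_inv hn (by have := Finset.mem_range.1 hi; omega)).pow0 2

theorem ch_down' (m r : ℕ) :
    ((m.choose (r + 1) : ℕ) : ℚ_[p]) * (r + 1) = (m.choose r : ℕ) * (m - r) := by
  exact_mod_cast congrArg (fun q : ℚ => (q : ℚ_[p])) (ch_down m r)

theorem ch_up' (m r : ℕ) :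
    (((m + 1).choose (r + 1) : ℕ) : ℚ_[p]) * (r + 1) = (m.choose r : ℕ) * (m + 1) := by
  exact_mod_cast congrArg (fun q : ℚ => (q : ℚ_[p])) (ch_up m r)

theorem cb_succ' (j : ℕ) : ((j : ℚ_[p]) + 1) * ((2 * (j + 1)).choose (j + 1) : ℚ_[p])
        = 2 * (2 * j + 1) * ((2 * j).choose j : ℚ_[p]) := by
  exact_mod_cast congrArg (fun q : ℚ => (q : ℚ_[p])) (cb_succ j)

/-- a binomial recurrence -/
theorem ch_step (m j : ℕ) : (((m + (j + 1)).choose (2 * (j + 1)) : ℕ) : ℚ_[p])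
      * (4 * (2 * j + 1) * (2 * j + 2)) = ((m + j).choose (2 * j) : ℕ)
        * ((2 * m + 1) ^ 2 - (2 * j + 1) ^ 2) := by
  have h1 := ch_down' (p := p) (m + j) (2 * j)
  have h2 := ch_up' (p := p) (m + j) (2 * j + 1)
  rw [show m + (j + 1) = m + j + 1 by ring, show 2 * (j + 1) = 2 * j + 1 + 1 by ring]
  push_cast at h1 h2 ⊢
  linear_combination 4 * (2 * (j : ℚ_[p]) + 1) * h2 + 4 * ((m : ℚ_[p]) + j + 1) * h1

theorem prod_cong {n : ℕ} (hn : p = 2 * n + 1) (j : ℕ) (hj : j ≤ n) :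
    ∃ c : ℚ_[p], Pd p 4 c ∧ (((n + j).choose (2 * j) : ℕ) : ℚ_[p]) * (-16) ^ j
      = ((2 * j).choose j : ℚ_[p]) * (1 - p ^ 2 * HH p j + c) := by
  induction j with
  | zero => exact ⟨0, Pd.zero 4, by simp [HH]⟩
  | succ j ih =>
    obtain ⟨c, hc, h⟩ := ih (by omega)
    have hi := odd_inv hn (show j < n by omega)
    set v : ℚ_[p] := (2 * (j : ℚ_[p]) + 1)⁻¹ with hv
    have hne := odd_ne (p := p) j
    have hne2 := succ_ne (p := p) j
    refine ⟨c - p ^ 2 * v ^ 2 * c + p ^ 4 * (v ^ 2 * HH p j), ?_, ?_⟩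
    · refine (hc.sub ?_).add ?_
      · exact (((Pd.ppow 2).mono (by norm_num : 0 ≤ 2)).mul_left (hi.pow0 2)).mul_left hc
      · exact (Pd.ppow 4).mul_right ((hi.pow0 2).mul_left (HH_int hn (by omega)))
    · have h3 := ch_step (p := p) n j
      have h4 := cb_succ' (p := p) j
      have hH : HH p (j + 1) = HH p j + v ^ 2 := by
        unfold HH; rw [Finset.sum_range_succ]
      have hpn : 2 * (n : ℚ_[p]) + 1 = p := by exact_mod_cast congrArg (Nat.cast (R := ℚ_[p])) hn.symm
      rw [hH]
      rw [hpn] at h3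
      apply mul_left_cancel₀ (mul_ne_zero hne hne2)
      have hvv : v * (2 * (j : ℚ_[p]) + 1) = 1 := inv_mul_cancel₀ hne
      have hp' : (p : ℚ_[p]) ^ 2 = p ^ 2 * v ^ 2 * (2 * (j : ℚ_[p]) + 1) ^ 2 := by
        rw [mul_assoc, ← mul_pow, hvv]; ring
      rw [hp'] at h3
      rw [pow_succ]
      linear_combination (-16 : ℚ_[p]) ^ j * (-2) * h3
        + 2 * (1 - p ^ 2 * v ^ 2) * (2 * (j : ℚ_[p]) + 1) ^ 2 * h
        - (2 * (j : ℚ_[p]) + 1) * (1 - p ^ 2 * (HH p j + v ^ 2) + (c - p ^ 2 * v ^ 2 * c + p ^ 4 * (v ^ 2 * HH p j))) * h4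

/-- auxiliary sums -/
noncomputable def aa (p : ℕ) [hp : Fact p.Prime] (n j : ℕ) : ℚ_[p] :=
  ∑ k ∈ Finset.range n, (((k + j).choose (2 * j) : ℕ) : ℚ_[p]) * ((2 * (k : ℚ_[p]) + 1)⁻¹) ^ 2

theorem hockey (n j : ℕ) : ∑ k ∈ Finset.range n, (k + j).choose (2 * j) = (n + j).choose (2 * j + 1) := by
  induction n with
  | zero => rw [Nat.choose_eq_zero_of_lt (by omega)]; simp
  | succ n ih =>
    rw [Finset.sum_range_succ, ih, show n + 1 + j = n + j + 1 by ring,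
      Nat.choose_succ_succ]
    ring

theorem aa_step (n j : ℕ) : aa p n (j + 1) * (4 * (2 * j + 1) * (2 * j + 2))
    = ((n + j).choose (2 * j + 1) : ℕ) - (2 * j + 1) ^ 2 * aa p n j := by
  unfold aa
  rw [← hockey, Finset.sum_mul, Finset.mul_sum]
  push_cast
  rw [← Finset.sum_sub_distrib]
  refine Finset.sum_congr rfl fun k _ => ?_
  have h3 := ch_step (p := p) k j
  have hne := odd_ne (p := p) k
  have hvv : (2 * (k : ℚ_[p]) + 1)⁻¹ * (2 * (k : ℚ_[p]) + 1) = 1 := inv_mul_cancel₀ hne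
  set v := (2 * (k : ℚ_[p]) + 1)⁻¹
  linear_combination v ^ 2 * h3 + ((k + j).choose (2 * j) : ℚ_[p]) * (v * (2 * k + 1) + 1) * hvv

theorem sum_odd_pow {n : ℕ} (hn : p = 2 * n + 1) (h3 : 3 < p) :
    (p : ℤ) ∣ ∑ k ∈ Finset.range n, (2 * (k : ℤ) + 1) ^ (p - 3) := by
  have e0 : ∑ x : ZMod p, x ^ (p - 3) = 0 := by
    apply FiniteField.sum_pow_lt_card_sub_one
    rw [ZMod.card]; omega
  have e1 : ∑ x : ZMod p, x ^ (p - 3) = ∑ i ∈ Finset.range p, (i : ZMod p) ^ (p - 3) := by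
    symm
    refine Finset.sum_bij (fun i _ => (i : ZMod p)) (fun _ _ => Finset.mem_univ _) ?_ ?_ ?_
    · intro a ha b hb h
      have := (ZMod.natCast_eq_natCast_iff' a b p).1 h
      rwa [Nat.mod_eq_of_lt (Finset.mem_range.1 ha), Nat.mod_eq_of_lt (Finset.mem_range.1 hb)] at this
    · intro b _
      exact ⟨b.val, Finset.mem_range.2 (ZMod.val_lt b), ZMod.natCast_zmod_val b⟩
    · intro a _; rfl
  have e2 : ∀ (g : ℕ → ZMod p) (m : ℕ), ∑ i ∈ Finset.range (2 * m + 1), g i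
      = ∑ k ∈ Finset.range m, g (2 * k + 1) + ∑ k ∈ Finset.range m, g (2 * k + 2) + g 0 := by
    intro g m
    induction m with
    | zero => simp
    | succ m ih =>
      rw [show 2 * (m + 1) + 1 = 2 * m + 1 + 1 + 1 by ring, Finset.sum_range_succ,
        Finset.sum_range_succ, ih, Finset.sum_range_succ, Finset.sum_range_succ]
      ring
  rw [e1] at e0
  have e3 := e2 (fun i => (i : ZMod p) ^ (p - 3)) n
  rw [← hn, e0] at e3
  have e4 : ∑ k ∈ Finset.range n, ((2 * k + 2 : ℕ) : ZMod p) ^ (p - 3)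
      = ∑ k ∈ Finset.range n, ((2 * k + 1 : ℕ) : ZMod p) ^ (p - 3) := by
    rw [← Finset.sum_range_reflect]
    refine Finset.sum_congr rfl fun k hk => ?_
    have hk := Finset.mem_range.1 hk
    have ev : Even (p - 3) := ⟨n - 1, by omega⟩
    rw [← ev.neg_pow]
    congr 1
    have : ((2 * (n - 1 - k) + 2 : ℕ) : ZMod p) + ((2 * k + 1 : ℕ) : ZMod p) = 0 := by
      rw [← Nat.cast_add, show 2 * (n - 1 - k) + 2 + (2 * k + 1) = p by omega]
      simp
    linear_combination -this
  rw [e4] at e3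
  have hz : ((0 : ℕ) : ZMod p) ^ (p - 3) = 0 := by
    rw [Nat.cast_zero, zero_pow (by omega)]
  rw [hz, add_zero, ← two_mul] at e3
  have h2 : (2 : ZMod p) ≠ 0 := by
    intro h
    have : ((2 : ℕ) : ZMod p) = 0 := by exact_mod_cast h
    rw [ZMod.natCast_eq_zero_iff] at this
    have := Nat.le_of_dvd (by norm_num) this
    omega
  have e5 := (mul_eq_zero.1 e3.symm).resolve_left h2
  rw [← ZMod.intCast_zmod_eq_zero_iff_dvd]
  push_cast at e5 ⊢
  exact e5

theorem aa_zero {n : ℕ} (hn : p = 2 * n + 1) (h3 : 3 < p) : Pd p 1 (aa p n 0) := by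
  have h1 := Pd.of_dvd (p := p) (r := 1) (by simpa using sum_odd_pow hn h3)
  have h2 : Pd p 1 (aa p n 0 - ((∑ k ∈ Finset.range n, (2 * (k : ℤ) + 1) ^ (p - 3) : ℤ) : ℚ_[p])) := by
    unfold aa
    push_cast
    rw [← Finset.sum_sub_distrib]
    apply Pd.sum
    intro k hk
    have hk := Finset.mem_range.1 hk
    have hi := odd_inv hn hk
    have hne := odd_ne (p := p) k
    have hf : Pd p 1 (((1 - (2 * (k : ℤ) + 1) ^ (p - 1) : ℤ)) : ℚ_[p]) := by
      apply Pd.of_dvd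
      rw [pow_one]
      have : IsCoprime (2 * (k : ℤ) + 1) (p : ℤ) := by
        have : Nat.Coprime p (2 * k + 1) := (Nat.Prime.coprime_iff_not_dvd hp.out).2
          fun h => by have := Nat.le_of_dvd (by omega) h; omega
        have := (Nat.isCoprime_iff_coprime.2 this).symm
        exact_mod_cast this
      exact (Int.modEq_iff_dvd.1 (Int.ModEq.pow_card_sub_one_eq_one hp.out this))
    have := (hi.pow0 2).mul_left hf
    convert this using 1
    push_cast
    rw [show p - 1 = p - 3 + 2 by omega, pow_add]
    simp
    field_simp
  have := h2.add h1
  simpa using this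

theorem aa_cong {n : ℕ} (hn : p = 2 * n + 1) (h3 : 3 < p) (j : ℕ) (hj : j ≤ n) :
    Pd p 1 (2 * (-16) ^ j * aa p n j - ((2 * j).choose j : ℚ_[p]) * HH p j) := by
  induction j with
  | zero =>
    have := (Pd.ofNat 2).mul_left (aa_zero hn h3)
    simpa [HH] using this
  | succ j ih =>
    have ih := ih (by omega)
    have hi := odd_inv hn (show j < n by omega)
    have hne := odd_ne (p := p) j
    have hne2 := succ_ne (p := p) j
    have i2 : Pd p 0 ((2 : ℚ_[p])⁻¹) := inv2 (by omega)
    have ij : Pd p 0 (((j : ℚ_[p]) + 1)⁻¹) := by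
      have : ¬ p ∣ j + 1 := fun h => by
        have := Nat.le_of_dvd (by omega) h; omega
      exact_mod_cast Pd.inv_nat (p := p) this
    have hvv : (2 * (j : ℚ_[p]) + 1)⁻¹ * (2 * (j : ℚ_[p]) + 1) = 1 := inv_mul_cancel₀ hne
    have hH : HH p (j + 1) = HH p j + ((2 * (j : ℚ_[p]) + 1)⁻¹) ^ 2 := by
      unfold HH; rw [Finset.sum_range_succ]
    set v : ℚ_[p] := (2 * (j : ℚ_[p]) + 1)⁻¹ with hv
    obtain ⟨c, hc, h⟩ := prod_cong hn j (by omega)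
    have h1 := ch_down' (p := p) (n + j) (2 * j)
    have hs := aa_step (p := p) n j
    have h4 := cb_succ' (p := p) j
    have hpn : (n : ℚ_[p]) = (p - 1) / 2 := by
      have : 2 * (n : ℚ_[p]) + 1 = p := by exact_mod_cast congrArg (Nat.cast (R := ℚ_[p])) hn.symm
      rw [← this]; ring
    -- the error term
    have hH0 := HH_int hn (show j ≤ n by omega)
    set A := ((2 * j).choose j : ℚ_[p]) with hA
    have hA0 : Pd p 0 A := Pd.natCast _
    set B := (((n + j).choose (2 * j) : ℕ) : ℚ_[p]) with hB
    set Cc := (((n + j).choose (2 * j + 1) : ℕ) : ℚ_[p]) with hCc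
    have hCv : Cc = B * (p - (2 * j + 1)) / 2 * v := by
      have : Cc * (2 * j + 1) = B * (p - (2 * j + 1)) / 2 := by
        push_cast at h1
        rw [h1, hpn]; ring
      rw [← this, mul_assoc, mul_comm (2 * (j : ℚ_[p]) + 1), hvv, mul_one]
    have h5 : Pd p 1 (2 * (-16) ^ j * Cc + A) := by
      have e : 2 * (-16) ^ j * Cc + A = p * (A * v) + (p ^ 2 * HH p j) * A * (1 - p * v)
          - c * A * (1 - p * v) := by
        rw [hCv]
        linear_combination (p - (2 * (j : ℚ_[p]) + 1)) * v * h -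
          A * (1 - p ^ 2 * HH p j + c) * hvv
      rw [e]
      have hpv : Pd p 0 (1 - p * v) := Pd.one.sub ((Pd.p1.mul_right hi).mono (by norm_num))
      refine ((Pd.p1.mul_right (hA0.mul_left hi)).add ?_).sub ?_
      · exact (((((Pd.ppow 2).mono (by norm_num : 1 ≤ 2)).mul_right hH0).mul_right hA0).mul_right hpv)
      · exact (((hc.mono (by norm_num : 1 ≤ 4)).mul_right hA0).mul_right hpv)
    have h6 := (Pd.ofNat 2).neg.mul_left (hi.mul_left (ij.mul_left (h5.sub (((Pd.natCast (2 * j + 1)).pow0 2).mul_left ih))))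
    convert h6 using 1
    rw [hH]
    apply mul_left_cancel₀ (mul_ne_zero hne hne2)
    have hjj : ((j : ℚ_[p]) + 1) * ((j : ℚ_[p]) + 1)⁻¹ = 1 := mul_inv_cancel₀ hne2
    have e7 : (2 * (j : ℚ_[p]) + 1) * ((j : ℚ_[p]) + 1) * (-2 * (v * (((j : ℚ_[p]) + 1)⁻¹ * (2 * (-16) ^ j * Cc + A - ((2 * j + 1 : ℕ) : ℚ_[p]) ^ 2 * (2 * (-16) ^ j * aa p n j - A * HH p j)))))
      = - 2 * (2 * (-16) ^ j * Cc + A - (2 * j + 1) ^ 2 * (2 * (-16) ^ j * aa p n j - A * HH p j)) := by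
      rw [hv]; push_cast; field_simp
    rw [e7, pow_succ]
    linear_combination (-4 * (-16 : ℚ_[p]) ^ j) * hs - (2 * (j : ℚ_[p]) + 1) * (HH p j + v ^ 2) * h4
      - 2 * A * (v * (2 * (j : ℚ_[p]) + 1) + 1) * hvv

theorem cc_ext {k N : ℕ} (h : k ≤ N) : (cc k : ℚ_[p]) = ∑ j ∈ Finset.range (N + 1),
    ((k + j).choose (2 * j) : ℚ_[p]) * ((2 * j).choose j : ℚ_[p]) ^ 2 * (-16) ^ j := by
  unfold cc
  push_cast
  apply Finset.sum_subset
  · intro i hi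
    rw [Finset.mem_range] at *
    omega
  · intro j _ hj
    rw [Finset.mem_range] at hj
    rw [Nat.choose_eq_zero_of_lt (by omega)]
    simp

theorem S0_cong {n : ℕ} (hn : p = 2 * n + 1) (h3 : 3 < p) :
    Pd p 3 ((SS p 0 : ℚ_[p]) - (cc n + 2 * p ^ 2 *
      ∑ k ∈ Finset.range n, (cc k : ℚ_[p]) * ((2 * (k : ℚ_[p]) + 1)⁻¹) ^ 2)) := by
  have e1 : ∑ k ∈ Finset.range n, (cc k : ℚ_[p]) * ((2 * (k : ℚ_[p]) + 1)⁻¹) ^ 2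
      = ∑ j ∈ Finset.range (n + 1), ((2 * j).choose j : ℚ_[p]) ^ 2 * ((-16) ^ j * aa p n j) := by
    have : ∀ k ∈ Finset.range n, (cc k : ℚ_[p]) * ((2 * (k : ℚ_[p]) + 1)⁻¹) ^ 2
        = ∑ j ∈ Finset.range (n + 1), ((2 * j).choose j : ℚ_[p]) ^ 2 * ((-16) ^ j *
          (((k + j).choose (2 * j) : ℕ) * ((2 * (k : ℚ_[p]) + 1)⁻¹) ^ 2)) := by
      intro k hk
      have hk := Finset.mem_range.1 hk
      rw [cc_ext (show k ≤ n by omega), Finset.sum_mul]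
      refine Finset.sum_congr rfl fun j _ => ?_
      ring
    rw [Finset.sum_congr rfl this, Finset.sum_comm]
    refine Finset.sum_congr rfl fun j _ => ?_
    unfold aa
    rw [← Finset.mul_sum, ← Finset.mul_sum]
  have e2 : (SS p 0 : ℚ_[p]) = ∑ j ∈ Finset.range (n + 1), (uu j : ℚ_[p])
      + ∑ j ∈ Finset.Ico (n + 1) p, (uu j : ℚ_[p]) := by
    rw [Finset.sum_range_add_sum_Ico _ (show n + 1 ≤ p by omega)]
    unfold SS
    push_cast
    simp
  rw [e1, e2, cc_ext le_rfl]
  have e3 : Pd p 3 (∑ j ∈ Finset.Ico (n + 1) p, (uu j : ℚ_[p])) := by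
    apply Pd.sum
    intro j hj
    rw [Finset.mem_Ico] at hj
    apply Pd.of_dvd
    unfold uu
    apply pow_dvd_pow_of_dvd
    exact_mod_cast p_dvd_choose hp.out (by omega) hj.2
  have e4 : Pd p 3 (∑ j ∈ Finset.range (n + 1), ((uu j : ℚ_[p])
      - ((n + j).choose (2 * j) : ℚ_[p]) * ((2 * j).choose j : ℚ_[p]) ^ 2 * (-16) ^ j
      - 2 * p ^ 2 * (((2 * j).choose j : ℚ_[p]) ^ 2 * ((-16) ^ j * aa p n j)))) := by
    apply Pd.sum
    intro j hj
    have hj := Finset.mem_range.1 hj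
    obtain ⟨c, hc, h⟩ := prod_cong hn j (by omega)
    have ha := aa_cong hn h3 j (by omega)
    have hA : Pd p 0 ((2 * j).choose j : ℚ_[p]) := Pd.natCast _
    have f1 : Pd p 3 (((2 * j).choose j : ℚ_[p]) ^ 3 * c) :=
      (hA.pow0 3).mul_left (hc.mono (by norm_num))
    have f2 : Pd p 3 ((p : ℚ_[p]) ^ 2 * (((2 * j).choose j : ℚ_[p]) ^ 2 * (2 * (-16) ^ j * aa p n j
      - ((2 * j).choose j : ℚ_[p]) * HH p j))) :=
      (Pd.ppow 2).mul ((hA.pow0 2).mul_left ha)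
    convert (f1.add f2).neg using 1
    unfold uu
    push_cast
    linear_combination (-((2 * j).choose j : ℚ_[p]) ^ 2) * h
  convert e4.add e3 using 1
  rw [Finset.sum_sub_distrib, Finset.sum_sub_distrib, ← Finset.mul_sum]
  ring

end trunc


section extraction
variable {K : Type*} [Field K]

/-- truncated generating polynomial of a sequence -/
noncomputable def Gp (P : ℕ → K) (n : ℕ) : Polynomial K :=
  ∑ k ∈ Finset.range (n + 1), Polynomial.C (P k) * Polynomial.X ^ k

theorem Gp_coeff (P : ℕ → K) (n k : ℕ) (h : k ≤ n) : (Gp P n).coeff k = P k := by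
  unfold Gp
  rw [Polynomial.finsetSum_coeff]
  simp only [Polynomial.coeff_C_mul_X_pow]
  rw [Finset.sum_ite_eq, if_pos (Finset.mem_range.2 (by omega))]

theorem Gp_ode (z : K) (P : ℕ → K) (n : ℕ) (h0 : P 0 = 1) (h1 : P 1 = z)
    (hrec : ∀ k, k + 2 ≤ n → ((k : K) + 2) * P (k + 2) = (2 * k + 3) * z * P (k + 1) - (k + 1) * P k) :
    Polynomial.X ^ n ∣ (1 - Polynomial.C (2 * z) * Polynomial.X + Polynomial.X ^ 2) *
      Polynomial.derivative (Gp P n) + (Polynomial.X - Polynomial.C z) * Gp P n := by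
  obtain ⟨w, hw⟩ : ∃ w, w = 2 * z := ⟨_, rfl⟩
  rw [← hw, Polynomial.X_pow_dvd_iff]
  intro d hd
  have e : (1 - Polynomial.C w * Polynomial.X + Polynomial.X ^ 2) *
      Polynomial.derivative (Gp P n) + (Polynomial.X - Polynomial.C z) * Gp P n
      = Polynomial.derivative (Gp P n) - Polynomial.C w * (Polynomial.X *
        Polynomial.derivative (Gp P n)) + Polynomial.X * (Polynomial.X *
        Polynomial.derivative (Gp P n)) + Polynomial.X * Gp P n - Polynomial.C z * Gp P n := by ring
  rw [e]
  rcases d with _ | _ | d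
  · simp [Polynomial.coeff_derivative, Gp_coeff P n 0 (by omega), Gp_coeff P n 1 (by omega), h0, h1]
  · have := hrec 0 (by omega)
    simp [Polynomial.coeff_derivative, Gp_coeff P n 0 (by omega), Gp_coeff P n 1 (by omega),
      Gp_coeff P n 2 (by omega), h0, h1] at this ⊢
    rw [hw]
    linear_combination this
  · have := hrec (d + 1) (by omega)
    simp [Polynomial.coeff_derivative, Gp_coeff P n (d+1) (by omega), Gp_coeff P n (d+2) (by omega),
      Gp_coeff P n (d+3) (by omega)] at this ⊢
    rw [show d + 1 + 2 = d + 3 by ring, show d + 1 + 1 = d + 2 by ring] at *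
    rw [hw]
    linear_combination this

theorem Gp_sq (z : K) (P : ℕ → K) (n : ℕ) (h0 : P 0 = 1) (h1 : P 1 = z)
    (hrec : ∀ k, k + 2 ≤ n → ((k : K) + 2) * P (k + 2) = (2 * k + 3) * z * P (k + 1) - (k + 1) * P k)
    (hch : ∀ i, i < n → ((i : K) + 1) ≠ 0) :
    Polynomial.X ^ (n + 1) ∣ Gp P n ^ 2 * (1 - Polynomial.C (2 * z) * Polynomial.X + Polynomial.X ^ 2)
      - 1 := by
  have hd : Polynomial.X ^ n ∣ Polynomial.derivative (Gp P n ^ 2 *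
      (1 - Polynomial.C (2 * z) * Polynomial.X + Polynomial.X ^ 2) - 1) := by
    obtain ⟨c, hc⟩ := Gp_ode z P n h0 h1 hrec
    refine ⟨2 * Gp P n * c, ?_⟩
    simp only [Polynomial.derivative_sub, Polynomial.derivative_mul, Polynomial.derivative_pow,
      Polynomial.derivative_add, Polynomial.derivative_one, Polynomial.derivative_X,
      Polynomial.derivative_C, map_mul, map_ofNat, Nat.cast_ofNat] at hc ⊢
    have : Polynomial.derivative (2 : Polynomial K) = 0 := Polynomial.derivative_ofNat 2
    rw [this]
    norm_num
    linear_combination 2 * Gp P n * hc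
  rw [Polynomial.X_pow_dvd_iff] at hd ⊢
  intro d hd2
  rcases d with _ | d
  · have := Gp_coeff P n 0 (by omega)
    rw [h0] at this
    rw [Polynomial.coeff_zero_eq_eval_zero] at *
    simp [this]
  · have := hd d (by omega)
    rw [Polynomial.coeff_derivative] at this
    exact (mul_eq_zero.1 this).resolve_right (hch d (by omega))

open PowerSeries in
theorem extract (z u : K) (P : ℕ → K) (n : ℕ) (h0 : P 0 = 1) (h1 : P 1 = z)
    (hrec : ∀ k, k + 2 ≤ n → ((k : K) + 2) * P (k + 2) = (2 * k + 3) * z * P (k + 1) - (k + 1) * P k)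
    (hch : ∀ i, i < n → ((i : K) + 1) ≠ 0) (h2 : (2 : K) ≠ 0) (hu : u ≠ 0)
    (R : PowerSeries K) (hR0 : constantCoeff R = 0) (hR1 : coeff 1 R = u)
    (hR : (d⁄dX K R) ^ 2 * (1 - C (2 * z) * X ^ 2 + X ^ 4)
      = C u ^ 2 * (1 - C (2 * z) * R ^ 2 + R ^ 4)) :
    (X : PowerSeries K) ^ (2 * n + 2) ∣ d⁄dX K R * Polynomial.aeval (R ^ 2) (Gp P n)
      - C u * Polynomial.aeval ((X : PowerSeries K) ^ 2) (Gp P n) := by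
  have key : ∀ S : PowerSeries K, X ∣ S → (X : PowerSeries K) ^ (2 * n + 2) ∣
      (Polynomial.aeval (S ^ 2) (Gp P n)) ^ 2 * (1 - C (2 * z) * S ^ 2 + S ^ 4) - 1 := by
    intro S hS
    obtain ⟨c, hc⟩ := Gp_sq z P n h0 h1 hrec hch
    have := congrArg (Polynomial.aeval (S ^ 2)) hc
    simp only [map_sub, map_add, map_mul, map_pow, map_one, Polynomial.aeval_X,
      Polynomial.aeval_C] at this
    have e : algebraMap K (PowerSeries K) = C := rfl
    simp only [map_mul, e] at this ⊢
    have e4 : S ^ 4 = (S ^ 2) ^ 2 := by ring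
    rw [e4, this]
    apply Dvd.dvd.mul_right
    rw [← pow_mul, show 2 * n + 2 = 2 * (n + 1) by ring]
    exact pow_dvd_pow_of_dvd hS _
  have hXR : X ∣ R := X_dvd_iff.2 hR0
  obtain ⟨c, hc⟩ := key R hXR
  obtain ⟨d, hd⟩ := key X dvd_rfl
  set A := Polynomial.aeval (R ^ 2) (Gp P n)
  set B := Polynomial.aeval ((X : PowerSeries K) ^ 2) (Gp P n)
  have cA : constantCoeff A = 1 := by
    have : A = Polynomial.aeval (R ^ 2) (Gp P n) := rfl
    rw [this, Polynomial.aeval_eq_sum_range]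
    simp only [map_sum]
    rw [Finset.sum_eq_single 0]
    · simp [Gp_coeff P n 0 (by omega), h0]
    · intro b _ hb
      simp [hR0, hb]
    · simp
  have cB : constantCoeff B = 1 := by
    have : B = Polynomial.aeval ((X : PowerSeries K) ^ 2) (Gp P n) := rfl
    rw [this, Polynomial.aeval_eq_sum_range]
    simp only [map_sum]
    rw [Finset.sum_eq_single 0]
    · simp [Gp_coeff P n 0 (by omega), h0]
    · intro b _ hb
      simp [hb]
    · simp
  have cR : constantCoeff (d⁄dX K R) = u := by
    rw [← coeff_zero_eq_constantCoeff_apply, coeff_derivative]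
    simp [hR1]
  have h3 : (X : PowerSeries K) ^ (2 * n + 2) ∣ (d⁄dX K R * A - C u * B) *
      ((d⁄dX K R * A + C u * B) * (1 - C (2 * z) * X ^ 2 + X ^ 4)) := by
    refine ⟨C u ^ 2 * (c - d), ?_⟩
    linear_combination A ^ 2 * hR + C u ^ 2 * hc - C u ^ 2 * hd
  have h4 : IsUnit ((d⁄dX K R * A + C u * B) * (1 - C (2 * z) * X ^ 2 + X ^ 4)) := by
    rw [isUnit_iff_constantCoeff]
    simp [cA, cB, cR]
    rw [← two_mul]
    exact mul_ne_zero h2 hu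
  exact (h4.dvd_mul_right).1 h3
end extraction


section mulr
variable {K : Type*} [Field K]
open PowerSeries

/-- numerator of multiplication by the square root of -7 -/
noncomputable def pa (r : K) : PowerSeries K := C r - 21 * X ^ 2 - 5 * C r * X ^ 4 + X ^ 6
/-- denominator of multiplication by the square root of -7 -/
noncomputable def pb (r : K) : PowerSeries K := 1 - 5 * C r * X ^ 2 - 21 * X ^ 4 + C r * X ^ 6
/-- jacobian -/
noncomputable def pj (r : K) : PowerSeries K := 1 + 14 * C r * X ^ 2 + 143 * X ^ 4
  + 132 * C r * X ^ 6 + 143 * X ^ 8 + 14 * C r * X ^ 10 + X ^ 12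
/-- inverse of the denominator -/
noncomputable def pV (r : K) : PowerSeries K := (pb r)⁻¹
/-- the power series of multiplication by `r` -/
noncomputable def Rr (r : K) : PowerSeries K := X * pa r * pV r

theorem pb_cc (r : K) : constantCoeff (pb r) = 1 := by simp [pb]
theorem pbV (r : K) : pb r * pV r = 1 := PowerSeries.mul_inv_cancel _ (by simp [pb_cc])
theorem pV_cc (r : K) : constantCoeff (pV r) = 1 := by
  have := congrArg constantCoeff (pbV r)
  rw [map_mul, pb_cc, map_one, one_mul] at this
  exact this

theorem dX_ofNat (n : ℕ) [n.AtLeastTwo] : d⁄dX K (OfNat.ofNat n : PowerSeries K) = 0 := by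
  rw [← Nat.cast_ofNat]; exact Derivation.map_natCast _ _

theorem pj_id (r : K) (hr : r ^ 2 = -7) : pj r ^ 2 * (1 - C (6 * r) * X ^ 2 + X ^ 4)
    = pb r ^ 4 - C (6 * r) * X ^ 2 * pa r ^ 2 * pb r ^ 2 + X ^ 4 * pa r ^ 4 := by
  have h : (C r : PowerSeries K) ^ 2 = -7 := by rw [← map_pow, hr, map_neg, map_ofNat]
  unfold pj pa pb
  rw [map_mul, map_ofNat]
  generalize (C r : PowerSeries K) = s at *
  generalize (X : PowerSeries K) = T
  grind

theorem dpV (r : K) : d⁄dX K (pV r) = - pV r ^ 2 * d⁄dX K (pb r) := by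
  have h := congrArg (d⁄dX K) (pbV r)
  simp only [Derivation.leibniz, smul_eq_mul, Derivation.map_one_eq_zero] at h
  linear_combination pV r * h - d⁄dX K (pV r) * pbV r

theorem dRr (r : K) (hr : r ^ 2 = -7) : d⁄dX K (Rr r) = C r * pj r * pV r ^ 2 := by
  have h : (C r : PowerSeries K) ^ 2 = -7 := by rw [← map_pow, hr, map_neg, map_ofNat]
  have h1 : d⁄dX K (Rr r) = pV r ^ 2 * (pa r * pb r + X * (d⁄dX K (pa r) * pb r - pa r * d⁄dX K (pb r))) := by
    unfold Rr
    simp only [Derivation.leibniz, smul_eq_mul, derivative_X, dpV]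
    linear_combination (-(X * pV r * d⁄dX K (pa r)) - pa r * pV r) * pbV r
  have h2 : pa r * pb r + X * (d⁄dX K (pa r) * pb r - pa r * d⁄dX K (pb r)) = C r * pj r := by
    have e5 : d⁄dX K (5 : PowerSeries K) = 0 := dX_ofNat 5
    have e21 : d⁄dX K (21 : PowerSeries K) = 0 := dX_ofNat 21
    unfold pa pb pj
    simp only [map_add, map_sub, Derivation.leibniz, smul_eq_mul, derivative_X, derivative_C,
      Derivation.leibniz_pow, e5, e21, Derivation.map_one_eq_zero, nsmul_eq_mul]
    generalize (C r : PowerSeries K) = s at *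
    generalize (X : PowerSeries K) = T
    push_cast
    norm_num
    grind
  rw [h1, h2]; ring

theorem Rr_ode (r : K) (hr : r ^ 2 = -7) : (d⁄dX K (Rr r)) ^ 2 * (1 - C (2 * (3 * r)) * X ^ 2 + X ^ 4)
      = C r ^ 2 * (1 - C (2 * (3 * r)) * Rr r ^ 2 + Rr r ^ 4) := by
  rw [dRr r hr, show 2 * (3 * r) = 6 * r by ring]
  have h1 := pj_id r hr
  have h2 := pbV r
  have h3 : pb r ^ 2 * pV r ^ 2 = 1 := by linear_combination (pb r * pV r + 1) * h2
  have h4 : pb r ^ 4 * pV r ^ 4 = 1 := by linear_combination (pb r ^2 * pV r ^2 + 1) * h3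
  unfold Rr
  linear_combination C r ^ 2 * pV r ^ 4 * h1 + C r ^ 2 * h4 - C r ^ 2 * C (6 * r) * X ^ 2 * pa r ^ 2 * pV r ^ 2 * h3

theorem Rr_cc (r : K) : constantCoeff (Rr r) = 0 := by simp [Rr]
theorem Rr_c1 (r : K) : coeff 1 (Rr r) = r := by
  unfold Rr
  rw [mul_assoc, show 1 = 0 + 1 from rfl, coeff_succ_X_mul]
  simp [pV_cc]
  simp [pa]
end mulr


section inertcase
variable {K : Type*} [Field K]
open PowerSeries

theorem extract_coeff (z u : K) (P : ℕ → K) (n : ℕ) (h0 : P 0 = 1) (h1 : P 1 = z)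
    (hrec : ∀ k, k + 2 ≤ n → ((k : K) + 2) * P (k + 2) = (2 * k + 3) * z * P (k + 1) - (k + 1) * P k)
    (hch : ∀ i, i < n → ((i : K) + 1) ≠ 0) (h2 : (2 : K) ≠ 0) (hu : u ≠ 0)
    (R : PowerSeries K) (hR0 : constantCoeff R = 0) (hR1 : coeff 1 R = u)
    (hR : (d⁄dX K R) ^ 2 * (1 - C (2 * z) * X ^ 2 + X ^ 4)
      = C u ^ 2 * (1 - C (2 * z) * R ^ 2 + R ^ 4)) (i : ℕ) (hi : i ≤ n) :
    ∑ k ∈ Finset.range (n + 1), P k * coeff (2 * i) (R ^ (2 * k) * d⁄dX K R) = u * P i := by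
  have h := extract z u P n h0 h1 hrec hch h2 hu R hR0 hR1 hR
  rw [X_pow_dvd_iff] at h
  have h := h (2 * i) (by omega)
  rw [map_sub, sub_eq_zero] at h
  have e : algebraMap K (PowerSeries K) = C := rfl
  have e1 : d⁄dX K R * Polynomial.aeval (R ^ 2) (Gp P n) =
      ∑ k ∈ Finset.range (n + 1), C (P k) * (R ^ (2 * k) * d⁄dX K R) := by
    unfold Gp
    rw [map_sum, Finset.mul_sum]
    refine Finset.sum_congr rfl fun k _ => ?_
    simp only [map_mul, map_pow, Polynomial.aeval_X, Polynomial.aeval_C, e, pow_mul]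
    ring
  have e2 : C u * Polynomial.aeval ((X : PowerSeries K) ^ 2) (Gp P n) =
      ∑ k ∈ Finset.range (n + 1), C (u * P k) * X ^ (2 * k) := by
    unfold Gp
    rw [map_sum, Finset.mul_sum]
    refine Finset.sum_congr rfl fun k _ => ?_
    simp only [map_mul, map_pow, Polynomial.aeval_X, Polynomial.aeval_C, e, pow_mul]
    ring
  rw [e1, e2, map_sum, map_sum] at h
  simp only [coeff_C_mul, coeff_X_pow] at h
  rw [h, Finset.sum_eq_single i]
  · simp
  · intro b _ hb
    rw [if_neg (by omega)]; simp
  · intro h; exact absurd (Finset.mem_range.2 (by omega)) h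

theorem coeff_pow_deriv (R : PowerSeries K) (k m : ℕ) :
    (2 * (k : K) + 1) * coeff m (R ^ (2 * k) * d⁄dX K R) = coeff (m + 1) (R ^ (2 * k + 1)) * (m + 1) := by
  rw [← coeff_derivative, Derivation.leibniz_pow, ← coeff_C_mul]
  congr 1
  rw [map_add, map_mul, map_ofNat, map_natCast, map_one]
  simp

theorem coeff_lead (R : PowerSeries K) (u : K) (hR0 : constantCoeff R = 0) (hR1 : coeff 1 R = u) (m : ℕ) :
    coeff m (R ^ m) = u ^ m := by
  obtain ⟨S, rfl⟩ := X_dvd_iff.2 hR0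
  rw [show (1 : ℕ) = 0 + 1 from rfl, coeff_succ_X_mul] at hR1
  rw [mul_pow]
  nth_rewrite 1 [show m = 0 + m by simp]
  rw [coeff_X_pow_mul]
  simp at hR1
  simp [hR1]

theorem inert_zero (p n : ℕ) [CharP K p] (hp : p.Prime) (hn : p = 2 * n + 1) (h7 : p ≠ 7) (r : K) (hr : r ^ 2 = -7)
    (hrp : r ^ p = - r) (P : ℕ → K) (h0 : P 0 = 1) (h1 : P 1 = 3 * r)
    (hrec : ∀ k, k + 2 ≤ n → ((k : K) + 2) * P (k + 2) = (2 * k + 3) * (3 * r) * P (k + 1) - (k + 1) * P k) :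
    P n = 0 := by
  have nz : ∀ m : ℕ, 0 < m → m < p → (m : K) ≠ 0 := by
    intro m hm hmp h
    rw [CharP.cast_eq_zero_iff K p] at h
    exact absurd (Nat.le_of_dvd hm h) (by omega)
  have h2p := hp.two_le
  have h2 : (2 : K) ≠ 0 := by
    have := nz 2 (by omega) (by omega)
    exact_mod_cast this
  have hr0 : r ≠ 0 := by
    rintro rfl
    have : ((7 : ℕ) : K) = 0 := by push_cast; linear_combination hr
    rw [CharP.cast_eq_zero_iff K p] at this
    exact h7 ((Nat.prime_dvd_prime_iff_eq hp (by norm_num)).1 this)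
  have hpK : ((2 * n : ℕ) : K) + 1 = 0 := by
    have : (p : K) = 0 := CharP.cast_eq_zero K p
    rw [hn] at this
    exact_mod_cast this
  have := extract_coeff (3 * r) r P n h0 h1 hrec
    (fun i hi => by have := nz (i + 1) (by omega) (by omega); exact_mod_cast this) h2 hr0 (Rr r) (Rr_cc r) (Rr_c1 r)
    (Rr_ode r hr) n le_rfl
  rw [Finset.sum_range_succ, Finset.sum_eq_zero] at this
  · rw [zero_add] at this
    have e : coeff (2 * n) (Rr r ^ (2 * n) * d⁄dX K (Rr r)) = r ^ p := by
      obtain ⟨S, hS⟩ := X_dvd_iff.2 (Rr_cc r)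
      have c1 := Rr_c1 r
      have c2 := Rr_c1 r
      rw [hS, show (1 : ℕ) = 0 + 1 from rfl, coeff_succ_X_mul] at c1
      rw [hS, mul_pow, mul_assoc, ← hS]
      nth_rewrite 1 [show 2 * n = 0 + 2 * n by simp]
      rw [coeff_X_pow_mul]
      have c3 : coeff 0 (d⁄dX K (Rr r)) = r := by rw [coeff_derivative]; simp [c2]
      simp at c1 c3
      simp [c1, c3, hn, pow_succ]
    rw [e, hrp] at this
    have : 2 * r * P n = 0 := by linear_combination -this
    exact (mul_eq_zero.1 this).resolve_left (mul_ne_zero h2 hr0)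
  · intro k hk
    rw [Finset.mem_range] at hk
    have := coeff_pow_deriv (Rr r) k (2 * n)
    rw [hpK, mul_zero] at this
    have h3 := nz (2 * k + 1) (by omega) (by omega)
    push_cast at h3
    rw [(mul_eq_zero.1 this).resolve_left h3, mul_zero]
end inertcase

section inertfinal
variable {p : ℕ} [hp : Fact p.Prime]

theorem mm_int (h7 : p ≠ 7) (k : ℕ) (hk : k < p) : Pd p 0 ((mm k : ℚ) : ℚ_[p]) := by
  induction k using Nat.strong_induction_on with
  | _ k ih =>
    rcases k with _ | _ | k
    · simpa [mm] using (Pd.one (p := p))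
    · have : mm 1 = 3 := by simp [mm]
      rw [this]; exact_mod_cast (Pd.ofNat (p := p) 3)
    · have h := mm_rec k
      have hk2 : ((k : ℚ) + 2) ≠ 0 := by positivity
      have e : mm (k + 2) = ((k + 2 : ℕ) : ℚ)⁻¹ * ((3 * (2 * k + 3) : ℕ) * mm (k+1) + (k + 1 : ℕ) * (7:ℚ)⁻¹ * mm k) := by
        push_cast
        field_simp
        linear_combination 7 * h
      rw [e]
      push_cast
      have i1 : Pd p 0 (((k : ℚ_[p]) + 2)⁻¹) := by
        have := Pd.inv_nat (p := p) (n := k + 2) (fun h => absurd (Nat.le_of_dvd (by omega) h) (by omega))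
        exact_mod_cast this
      have i7 : Pd p 0 ((7 : ℚ_[p])⁻¹) := inv7 h7
      have a1 := ih (k+1) (by omega) (by omega)
      have a0 := ih k (by omega) (by omega)
      refine i1.mul_left (Pd.add (Pd.mul_left ?_ a1) (Pd.mul_left (Pd.mul_left ?_ i7) a0))
      · have := Pd.natCast (p := p) (3 * (2 * k + 3)); exact_mod_cast this
      · have := Pd.natCast (p := p) (k + 1); exact_mod_cast this

theorem leg7 (hp2 : p ≠ 2) (h : p % 7 = 3 ∨ p % 7 = 5 ∨ p % 7 = 6) : legendreSym p (-7) = -1 := by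
  have hodd : Odd p := hp.out.odd_of_ne_two hp2
  rw [jacobiSym.legendreSym.to_jacobiSym, jacobiSym.mod_right _ hodd]
  have h2 : p % 2 = 1 := Nat.odd_iff.1 hodd
  have e : 4 * (-7 : ℤ).natAbs = 28 := by norm_num
  rw [e]
  have : p % 28 = 3 ∨ p % 28 = 5 ∨ p % 28 = 13 ∨ p % 28 = 17 ∨ p % 28 = 19 ∨ p % 28 = 27 := by omega
  rcases this with h | h | h | h | h | h <;> rw [h] <;> norm_num

theorem leg7' (hp2 : p ≠ 2) (h : p % 7 = 1 ∨ p % 7 = 2 ∨ p % 7 = 4) : legendreSym p (-7) = 1 := by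
  have hodd : Odd p := hp.out.odd_of_ne_two hp2
  rw [jacobiSym.legendreSym.to_jacobiSym, jacobiSym.mod_right _ hodd]
  have h2 : p % 2 = 1 := Nat.odd_iff.1 hodd
  have e : 4 * (-7 : ℤ).natAbs = 28 := by norm_num
  rw [e]
  have : p % 28 = 1 ∨ p % 28 = 9 ∨ p % 28 = 11 ∨ p % 28 = 15 ∨ p % 28 = 23 ∨ p % 28 = 25 := by omega
  rcases this with h | h | h | h | h | h <;> rw [h] <;> norm_num

theorem zp_ofNat (n : ℕ) [n.AtLeastTwo] : ((OfNat.ofNat n : ℤ_[p]) : ℚ_[p]) = OfNat.ofNat n :=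
  map_ofNat (PadicInt.Coe.ringHom (p := p)) n

theorem inert_mm (hp2 : p ≠ 2) (hp7 : p ≠ 7) (h : p % 7 = 3 ∨ p % 7 = 5 ∨ p % 7 = 6) (n : ℕ)
    (hn : p = 2 * n + 1) : Pd p 1 ((mm n : ℚ) : ℚ_[p]) := by
  have hM : ∀ k, ∃ c : ℤ_[p], k < p → ((mm k : ℚ) : ℚ_[p]) = c := by
    intro k
    by_cases hk : k < p
    · obtain ⟨c, hc⟩ := mm_int hp7 k hk
      exact ⟨c, fun _ => by simpa using hc⟩
    · exact ⟨0, fun h => absurd h hk⟩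
  choose M hM using hM
  have hrecM : ∀ k, k + 2 < p → 7 * ((k : ℤ_[p]) + 2) * M (k + 2) = 21 * (2 * k + 3) * M (k + 1) + (k + 1) * M k := by
    intro k hk
    have h := mm_rec k
    have h2 := congrArg (Rat.cast (K := ℚ_[p])) h
    push_cast at h2
    rw [hM k (by omega), hM (k+1) (by omega), hM (k+2) hk] at h2
    have h7 : (7 : ℚ_[p]) ≠ 0 := by norm_num
    field_simp at h2
    apply PadicInt.ext
    push_cast
    rw [zp_ofNat, zp_ofNat, zp_ofNat, zp_ofNat]
    linear_combination h2
  let F := AlgebraicClosure (ZMod p)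
  have : CharP F p := inferInstance
  let φ : ℤ_[p] →+* F := (algebraMap (ZMod p) F).comp PadicInt.toZMod
  obtain ⟨r, hr⟩ := IsAlgClosed.exists_pow_nat_eq (-7 : F) (n := 2) (by norm_num)
  have hleg := leg7 hp2 h
  have h7p : ((-7 : ℤ) : ZMod p) ^ n = -1 := by
    have := legendreSym.eq_pow p (-7)
    rw [hleg, show p / 2 = n by omega] at this
    rw [← this]; simp
  have hrp : r ^ p = - r := by
    have e : r ^ p = r * (r ^ 2) ^ n := by rw [← pow_mul, ← pow_succ', ← hn]
    have := congrArg (algebraMap (ZMod p) F) h7p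
    rw [map_pow, map_neg, map_one, map_intCast] at this
    push_cast at this
    rw [e, hr, this]; ring
  have hp2' := hp.out.two_le
  have c0 : M 0 = 1 := by
    apply PadicInt.ext
    rw [← hM 0 (by omega)]; simp [mm]
  have c1 : M 1 = 3 := by
    apply PadicInt.ext
    rw [← hM 1 (by omega), zp_ofNat]; simp [mm]
  have key := inert_zero (K := F) p n hp.out hn hp7 r hr hrp (fun k => r ^ k * φ (M k)) (by simp [c0])
    (by simp only [c1, map_ofNat]; ring) (by
      intro k hk
      have := congrArg φ (hrecM k (by omega))
      simp only [map_mul, map_add, map_natCast, map_ofNat, map_one] at this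
      have e : r ^ (k + 2) = r ^ k * (-7) := by rw [pow_add, hr]
      rw [e, pow_succ]
      linear_combination -r ^ k * this - 3 * (2 * k + 3) * r ^ k * φ (M (k+1)) * hr)
  have hr0 : r ≠ 0 := by
    rintro rfl
    have : ((7 : ℕ) : F) = 0 := by push_cast; linear_combination hr
    rw [CharP.cast_eq_zero_iff F p] at this
    exact hp7 ((Nat.prime_dvd_prime_iff_eq hp.out (by norm_num)).1 this)
  have key2 : φ (M n) = 0 := (mul_eq_zero.1 key).resolve_left (pow_ne_zero _ hr0)
  have key3 : PadicInt.toZMod (M n) = 0 :=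
    (algebraMap (ZMod p) F).injective (by simpa [φ] using key2)
  rw [← RingHom.mem_ker, PadicInt.ker_toZMod, PadicInt.maximalIdeal_eq_span_p,
    Ideal.mem_span_singleton] at key3
  obtain ⟨c, hc⟩ := key3
  refine ⟨c, ?_⟩
  rw [hM n (by omega), hc]
  push_cast; ring

theorem inert_S0 (hp2 : p ≠ 2) (hp3 : p ≠ 3) (hp7 : p ≠ 7) (h : p % 7 = 3 ∨ p % 7 = 5 ∨ p % 7 = 6) :
    Pd p 2 (SS p 0 : ℚ_[p]) := by
  obtain ⟨n, hn⟩ := hp.out.odd_of_ne_two hp2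
  have hp2' := hp.out.two_le
  have hm := inert_mm hp2 hp7 h n hn
  have hc : Pd p 2 (cc n : ℚ_[p]) := by
    have e : (cc n : ℚ_[p]) = (-7) ^ n * ((mm n : ℚ) : ℚ_[p]) ^ 2 := by
      have := congrArg (Rat.cast (K := ℚ_[p])) (clausen n)
      push_cast at this
      exact this
    rw [e]
    refine Pd.mul_left (Pd.pow0 ?_ n) (hm.pow 2)
    exact (Pd.ofNat (p := p) 7).neg
  have hS := (S0_cong hn (by omega)).mono (show 2 ≤ 3 by norm_num)
  have hsum : Pd p 2 (2 * (p : ℚ_[p]) ^ 2 * ∑ k ∈ Finset.range n, (cc k : ℚ_[p]) * ((2 * (k : ℚ_[p]) + 1)⁻¹) ^ 2) := by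
    refine Pd.mul_right (Pd.mul_left (Pd.ofNat 2) (Pd.ppow 2)) (Pd.sum _ _ fun k hk => ?_)
    exact (Pd.intCast _).mul_left ((odd_inv hn (Finset.mem_range.1 hk)).pow0 2)
  have := hS.add (hc.add hsum)
  convert this using 1
  ring
end inertfinal


section cm
variable {K : Type*} [Field K]
open PowerSeries

/-- addition formula, square identity -/
theorem ell_add_sq {S : Type*} [CommRing S] (z A B Ya Yb : S) (ha : Ya ^ 2 = 1 - 2 * z * A ^ 2 + A ^ 4)
    (hb : Yb ^ 2 = 1 - 2 * z * B ^ 2 + B ^ 4) :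
    ((Ya * Yb - 2 * z * A * B) * (1 + A ^ 2 * B ^ 2) + 2 * A * B * (A ^ 2 + B ^ 2)) ^ 2
    = (1 - A ^ 2 * B ^ 2) ^ 4 - 2 * z * (A * Yb + B * Ya) ^ 2 * (1 - A ^ 2 * B ^ 2) ^ 2
      + (A * Yb + B * Ya) ^ 4 := by
  grind

/-- addition formula, derivative identity -/
theorem ell_add_der {S : Type*} [CommRing S] (z A B Ya Yb uw vw : S) (ha : Ya ^ 2 = 1 - 2 * z * A ^ 2 + A ^ 4)
    (hb : Yb ^ 2 = 1 - 2 * z * B ^ 2 + B ^ 4) :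
    (uw * Ya * Yb + A * (vw * (-2 * z * B + 2 * B ^ 3)) + vw * Yb * Ya + B * (uw * (-2 * z * A + 2 * A ^ 3))) *
      (1 - A ^ 2 * B ^ 2) + (A * Yb + B * Ya) * (2 * A * B ^ 2 * (uw * Ya) + 2 * A ^ 2 * B * (vw * Yb))
    = (uw + vw) * ((Ya * Yb - 2 * z * A * B) * (1 + A ^ 2 * B ^ 2) + 2 * A * B * (A ^ 2 + B ^ 2)) := by
  grind

/-- `R` is the multiplication-by-`u` series on the curve `Y^2 = 1 - 2 z X^2 + X^4`. -/
structure MulS (z : K) (w : PowerSeries K) (u : K) (R Y : PowerSeries K) : Prop where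
  r0 : constantCoeff R = 0
  y0 : constantCoeff Y = 1
  sq : Y ^ 2 = 1 - 2 * C z * R ^ 2 + R ^ 4
  dr : d⁄dX K R = C u * w * Y

variable {z : K} {w : PowerSeries K}

theorem MulS.yne {u : K} {R Y : PowerSeries K} (h : MulS z w u R Y) : Y ≠ 0 := by
  rintro rfl
  simpa using h.y0

theorem dX_two : d⁄dX K (2 : PowerSeries K) = 0 := dX_ofNat 2

theorem MulS.dy [CharZero K] {u : K} {R Y : PowerSeries K} (h : MulS z w u R Y) :
    d⁄dX K Y = C u * w * (-2 * C z * R + 2 * R ^ 3) := by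
  have e := congrArg (d⁄dX K) h.sq
  simp only [map_add, map_sub, Derivation.leibniz, smul_eq_mul, derivative_C,
      Derivation.leibniz_pow, dX_two, Derivation.map_one_eq_zero, nsmul_eq_mul, h.dr] at e
  push_cast at e
  norm_num at e
  have h2 : (2 : PowerSeries K) ≠ 0 := by
    intro h
    have := congrArg constantCoeff h
    rw [map_ofNat, map_zero] at this
    exact two_ne_zero this
  have : 2 * Y * (d⁄dX K Y - C u * w * (-2 * C z * R + 2 * R ^ 3)) = 0 := by
    linear_combination e
  rcases mul_eq_zero.1 this with h1 | h1
  · rcases mul_eq_zero.1 h1 with h1 | h1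
    · exact absurd h1 h2
    · exact absurd h1 h.yne
  · exact sub_eq_zero.1 h1

theorem MulS.neg {u : K} {R Y : PowerSeries K} (h : MulS z w u R Y) : MulS z w (-u) (-R) Y where
  r0 := by simp [h.r0]
  y0 := h.y0
  sq := by rw [h.sq]; ring
  dr := by rw [map_neg, h.dr, map_neg]; ring

theorem MulS.zero : MulS z w 0 0 1 where
  r0 := by simp
  y0 := by simp
  sq := by ring
  dr := by simp

/-- addition formula, first coordinate -/
noncomputable def addR (A Ya B Yb : PowerSeries K) : PowerSeries K :=
  (A * Yb + B * Ya) * (1 - A ^ 2 * B ^ 2)⁻¹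
/-- addition formula, second coordinate -/
noncomputable def addY (z : K) (A Ya B Yb : PowerSeries K) : PowerSeries K :=
  ((Ya * Yb - 2 * C z * A * B) * (1 + A ^ 2 * B ^ 2) + 2 * A * B * (A ^ 2 + B ^ 2)) *
    ((1 - A ^ 2 * B ^ 2)⁻¹) ^ 2

theorem den_inv {A B : PowerSeries K} (hA : constantCoeff A = 0) :
    (1 - A ^ 2 * B ^ 2) * (1 - A ^ 2 * B ^ 2)⁻¹ = 1 :=
  PowerSeries.mul_inv_cancel _ (by simp [hA])

theorem MulS.add [CharZero K] {u v : K} {A Ya B Yb : PowerSeries K} (ha : MulS z w u A Ya)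
    (hb : MulS z w v B Yb) : MulS z w (u + v) (addR A Ya B Yb) (addY z A Ya B Yb) := by
  have hV := den_inv (B := B) ha.r0
  have sq := ell_add_sq (C z) A B Ya Yb ha.sq hb.sq
  have der := ell_add_der (C z) A B Ya Yb (C u * w) (C v * w) ha.sq hb.sq
  unfold addR addY
  have dV : d⁄dX K ((1 - A ^ 2 * B ^ 2)⁻¹) = ((1 - A ^ 2 * B ^ 2)⁻¹) ^ 2 *
      (2 * A * B ^ 2 * (C u * w * Ya) + 2 * A ^ 2 * B * (C v * w * Yb)) := by
    generalize (1 - A ^ 2 * B ^ 2)⁻¹ = V at hV ⊢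
    have h := congrArg (d⁄dX K) hV
    simp only [Derivation.leibniz, smul_eq_mul, Derivation.map_one_eq_zero, map_sub,
      Derivation.leibniz_pow, nsmul_eq_mul, ha.dr, hb.dr] at h
    push_cast at h
    norm_num at h
    linear_combination V * h - d⁄dX K V * hV
  have cV : constantCoeff ((1 - A ^ 2 * B ^ 2)⁻¹) = 1 := by
    have := congrArg constantCoeff hV
    simpa [ha.r0] using this
  generalize (1 - A ^ 2 * B ^ 2)⁻¹ = V at *
  refine ⟨by simp [ha.r0, hb.r0], by simp [ha.r0, hb.r0, ha.y0, hb.y0, cV], ?_, ?_⟩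
  · generalize 1 - A ^ 2 * B ^ 2 = D at *
    generalize ((Ya * Yb - 2 * C z * A * B) * (1 + A ^ 2 * B ^ 2) + 2 * A * B * (A ^ 2 + B ^ 2)) = M at *
    generalize A * Yb + B * Ya = N at *
    have h2 : D ^ 2 * V ^ 2 = 1 := by linear_combination (D * V + 1) * hV
    have h4 : D ^ 4 * V ^ 4 = 1 := by linear_combination (D ^ 2 * V ^ 2 + 1) * h2
    linear_combination V ^ 4 * sq + h4 - 2 * C z * N ^ 2 * V ^ 2 * h2
  · simp only [Derivation.leibniz, smul_eq_mul, map_add, ha.dr, hb.dr, dV, ha.dy, hb.dy]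
    generalize hD : 1 - A ^ 2 * B ^ 2 = D at *
    linear_combination V ^ 2 * der - V * (C u * w * Ya * Yb + A * (C v * w * (-2 * C z * B + 2 * B ^ 3)) + C v * w * Yb * Ya + B * (C u * w * (-2 * C z * A + 2 * A ^ 3))) * hV

theorem X_dvd_lift [CharZero K] (E : PowerSeries K) (m : ℕ) (h0 : constantCoeff E = 0)
    (h : (X : PowerSeries K) ^ m ∣ d⁄dX K E) : (X : PowerSeries K) ^ (m + 1) ∣ E := by
  rw [X_pow_dvd_iff] at *
  intro d hd
  rcases d with _ | d
  · simpa using h0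
  · have := h d (by omega)
    rw [coeff_derivative] at this
    exact (mul_eq_zero.1 this).resolve_right (by exact_mod_cast Nat.succ_ne_zero d)

theorem MulS.unique [CharZero K] {u : K} {R Y R' Y' : PowerSeries K} (h : MulS z w u R Y)
    (h' : MulS z w u R' Y') : R = R' ∧ Y = Y' := by
  have key : ∀ m : ℕ, (X : PowerSeries K) ^ m ∣ R - R' ∧ (X : PowerSeries K) ^ m ∣ Y - Y' := by
    intro m
    induction m with
    | zero => simp
    | succ m ih =>
      obtain ⟨⟨a, ha⟩, ⟨b, hb⟩⟩ := ih
      constructor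
      · apply X_dvd_lift _ _ (by simp [h.r0, h'.r0])
        refine ⟨C u * w * b, ?_⟩
        rw [map_sub, h.dr, h'.dr]
        linear_combination C u * w * hb
      · apply X_dvd_lift _ _ (by simp [h.y0, h'.y0])
        refine ⟨C u * w * (-2 * C z + 2 * (R ^ 2 + R * R' + R' ^ 2)) * a, ?_⟩
        rw [map_sub, h.dy, h'.dy]
        linear_combination C u * w * (-2 * C z + 2 * (R ^ 2 + R * R' + R' ^ 2)) * ha
  constructor
  · rw [← sub_eq_zero]
    ext d
    exact X_pow_dvd_iff.1 (key (d + 1)).1 d (by omega)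
  · rw [← sub_eq_zero]
    ext d
    exact X_pow_dvd_iff.1 (key (d + 1)).2 d (by omega)

/-- a solution of the squared equation is plus or minus the multiplication series -/
theorem MulS.pm [CharZero K] {u : K} (hu : u ≠ 0) {R Y V : PowerSeries K} (h : MulS z w u R Y)
    {y : PowerSeries K} (hyw : y * w = 1) (hw0 : constantCoeff w = 1)
    (v0 : constantCoeff V = 0) (v1 : coeff 1 V ^ 2 = u ^ 2)
    (hV : (d⁄dX K V) ^ 2 * y ^ 2 = C u ^ 2 * (1 - 2 * C z * V ^ 2 + V ^ 4)) : V = R ∨ V = -R := by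
  have y0 : constantCoeff y = 1 := by
    have := congrArg constantCoeff hyw
    simpa [hw0] using this
  have key : ∀ S : PowerSeries K, constantCoeff S = 0 → coeff 1 S = u →
      (d⁄dX K S) ^ 2 * y ^ 2 = C u ^ 2 * (1 - 2 * C z * S ^ 2 + S ^ 4) → S = R := by
    intro S s0 s1 hS
    have hi : (C u : PowerSeries K) * C u⁻¹ = 1 := by rw [← map_mul, mul_inv_cancel₀ hu, map_one]
    have : MulS z w u S (C u⁻¹ * y * d⁄dX K S) := by
      refine ⟨s0, ?_, ?_, ?_⟩
      · have : constantCoeff (d⁄dX K S) = u := by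
          rw [← coeff_zero_eq_constantCoeff_apply, coeff_derivative]; simp [s1]
        simp [this, y0, hu]
      · linear_combination C u⁻¹ ^ 2 * hS + (1 - 2 * C z * S ^ 2 + S ^ 4) * (C u * C u⁻¹ + 1) * hi
      · linear_combination (-d⁄dX K S) * hyw - d⁄dX K S * y * w * hi
    exact (this.unique h).1
  rcases sq_eq_sq_iff_eq_or_eq_neg.1 v1 with h1 | h1
  · left; exact key V v0 h1 hV
  · right
    have := key (-V) (by simp [v0]) (by simp [h1]) (by rw [map_neg]; linear_combination hV)
    rw [← this]; ring
end cm


section cmgen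
variable {K : Type*} [Field K] [CharZero K]
open PowerSeries

/-- Legendre-type coefficients -/
noncomputable def Pk (r : K) (k : ℕ) : K := r ^ k * ((mm k : ℚ) : K)

theorem Pk_zero (r : K) : Pk r 0 = 1 := by simp [Pk, mm]
theorem Pk_one (r : K) : Pk r 1 = 3 * r := by simp [Pk, mm]; ring

theorem Pk_rec (r : K) (hr : r ^ 2 = -7) (k : ℕ) :
    ((k : K) + 2) * Pk r (k + 2) = (2 * k + 3) * (3 * r) * Pk r (k + 1) - (k + 1) * Pk r k := by
  have h := congrArg (Rat.cast (K := K)) (mm_rec k)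
  push_cast at h
  have e : r ^ (k + 2) = r ^ k * (-7) := by rw [pow_add, hr]
  unfold Pk
  rw [e, pow_succ]
  linear_combination -7 * r ^ k * h - 3 * (2 * k + 3) * r ^ k * ((mm (k + 1) : ℚ) : K) * hr

/-- inverse square root series -/
noncomputable def ww (r : K) : PowerSeries K :=
  PowerSeries.mk fun j => if j % 2 = 0 then Pk r (j / 2) else 0

/-- the quartic -/
noncomputable def ff (r : K) : PowerSeries K := 1 - 2 * C (3 * r) * X ^ 2 + X ^ 4

theorem ww_cc (r : K) : constantCoeff (ww r) = 1 := by
  rw [← coeff_zero_eq_constantCoeff_apply, ww, coeff_mk]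
  simp [Pk_zero]

theorem ww_Gp (r : K) (n : ℕ) : (X : PowerSeries K) ^ (2 * n + 2) ∣
    ww r - Polynomial.aeval ((X : PowerSeries K) ^ 2) (Gp (Pk r) n) := by
  have e : algebraMap K (PowerSeries K) = C := rfl
  have e2 : Polynomial.aeval ((X : PowerSeries K) ^ 2) (Gp (Pk r) n) =
      ∑ k ∈ Finset.range (n + 1), C (Pk r k) * X ^ (2 * k) := by
    unfold Gp
    rw [map_sum]
    refine Finset.sum_congr rfl fun k _ => ?_
    simp only [map_mul, map_pow, Polynomial.aeval_X, Polynomial.aeval_C, e, pow_mul]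
  rw [e2, X_pow_dvd_iff]
  intro m hm
  rw [map_sub, map_sum, ww, coeff_mk]
  simp only [coeff_C_mul, coeff_X_pow]
  split_ifs with h
  · rw [Finset.sum_eq_single (m / 2)]
    · rw [if_pos (by omega)]; ring
    · intro b _ hb; rw [if_neg (by omega)]; ring
    · intro h; exact absurd (Finset.mem_range.2 (by omega)) h
  · rw [Finset.sum_eq_zero]
    · ring
    · intro b _; rw [if_neg (by omega)]; ring

theorem ww_sq (r : K) (hr : r ^ 2 = -7) : ww r ^ 2 * ff r = 1 := by
  rw [← sub_eq_zero]
  ext m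
  have h1 := ww_Gp r m
  obtain ⟨c, hc⟩ := Gp_sq (3 * r) (Pk r) m (Pk_zero r) (Pk_one r) (fun k _ => Pk_rec r hr k)
    (fun i _ => by exact_mod_cast Nat.succ_ne_zero i)
  have h2 := congrArg (Polynomial.aeval ((X : PowerSeries K) ^ 2)) hc
  simp only [map_sub, map_add, map_mul, map_pow, map_one, Polynomial.aeval_X,
      Polynomial.aeval_C] at h2
  have e : algebraMap K (PowerSeries K) = C := rfl
  obtain ⟨d, hd⟩ := h1
  simp only [e] at h2
  have hdv : (X : PowerSeries K) ^ (2 * m + 2) ∣ ww r ^ 2 * ff r - 1 := by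
    refine ⟨d * (ww r + Polynomial.aeval ((X : PowerSeries K) ^ 2) (Gp (Pk r) m)) * ff r +
      Polynomial.aeval ((X : PowerSeries K) ^ 2) c, ?_⟩
    have e4 : ff r = 1 - C 2 * (C 3 * C r) * X ^ 2 + (X ^ 2) ^ 2 := by
      unfold ff; rw [map_mul, map_ofNat, map_ofNat]; ring
    rw [← e4] at h2
    generalize Polynomial.aeval ((X : PowerSeries K) ^ 2) (Gp (Pk r) m) = G at *
    linear_combination (ww r + G) * ff r * hd + h2
  rw [X_pow_dvd_iff] at hdv
  exact hdv m (by omega)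

/-- square root series -/
noncomputable def yy (r : K) : PowerSeries K := ff r * ww r

theorem yy_ww (r : K) (hr : r ^ 2 = -7) : yy r * ww r = 1 := by
  unfold yy; linear_combination ww_sq r hr
theorem yy_sq (r : K) (hr : r ^ 2 = -7) : yy r ^ 2 = ff r := by
  unfold yy; linear_combination ff r * ww_sq r hr
theorem yy_cc (r : K) : constantCoeff (yy r) = 1 := by
  simp [yy, ww_cc, ff]

theorem mul_one_S (r : K) (hr : r ^ 2 = -7) : MulS (3 * r) (ww r) 1 X (yy r) where
  r0 := by simp
  y0 := yy_cc r
  sq := by rw [yy_sq r hr]; rfl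
  dr := by rw [derivative_X, map_one, one_mul, mul_comm, yy_ww r hr]

theorem mul_r_S (r : K) (hr : r ^ 2 = -7) : MulS (3 * r) (ww r) r (Rr r) (yy r * pj r * pV r ^ 2) where
  r0 := Rr_cc r
  y0 := by simp [yy_cc, pV_cc]; simp [pj]
  sq := by
    have h1 := pj_id r hr
    have h2 := pbV r
    have h3 : pb r ^ 2 * pV r ^ 2 = 1 := by linear_combination (pb r * pV r + 1) * h2
    have h4 : pb r ^ 4 * pV r ^ 4 = 1 := by linear_combination (pb r ^2 * pV r ^2 + 1) * h3
    have e : C (6 * r) = (2 : PowerSeries K) * C (3 * r) := by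
      rw [← map_ofNat (C : K →+* PowerSeries K) 2, ← map_mul]; congr 1; ring
    have h5 := yy_sq r hr
    rw [e] at h1
    unfold ff at h5
    unfold Rr
    linear_combination pj r ^ 2 * pV r ^ 4 * h5 + pV r ^ 4 * h1 + h4 - 2 * C (3 * r) * X ^ 2 * pa r ^ 2 * pV r ^ 2 * h3
  dr := by
    rw [dRr r hr]
    linear_combination (- C r * pj r * pV r ^ 2) * yy_ww r hr
end cmgen


set_option linter.unusedSectionVars false
section cmfield
variable {K : Type*} [Field K] {L : Type*} [Field L] [Algebra K L]
open PowerSeries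

/-- the coordinate at infinity -/
noncomputable def xi (ι : K⟦X⟧ →ₐ[K] L) : L := (ι X ^ 2)⁻¹

variable {ι : K⟦X⟧ →ₐ[K] L}

theorem ev_reflect (hι : Function.Injective ι) (φ : Polynomial K) (N : ℕ) (h : φ.natDegree ≤ N) :
    Polynomial.aeval (xi ι) φ * (ι X ^ 2) ^ N =
      ι (Polynomial.aeval ((X : K⟦X⟧) ^ 2) (Polynomial.reflect N φ)) := by
  have hX : ι X ≠ 0 := by
    rw [Ne, map_eq_zero_iff _ hι]; exact X_ne_zero
  have hX2 : (ι X ^ 2) ≠ 0 := pow_ne_zero _ hX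
  let _ : Invertible (ι X ^ 2) := invertibleOfNonzero hX2
  have := Polynomial.eval₂_reflect_mul_pow (algebraMap K L) (ι X ^ 2) N (Polynomial.reflect N φ)
    (le_trans Polynomial.natDegree_reflect_le (by simp [h]))
  rw [Polynomial.reflect_reflect, invOf_eq_inv] at this
  rw [Polynomial.aeval_def, xi, this, ← Polynomial.aeval_algHom_apply, map_pow, Polynomial.aeval_def]

theorem aeval_X2_cc (g : Polynomial K) :
    constantCoeff (Polynomial.aeval ((X : K⟦X⟧) ^ 2) g) = g.coeff 0 := by
  rw [Polynomial.aeval_eq_sum_range, map_sum, Finset.sum_eq_single 0]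
  · simp
  · intro b _ hb; simp [hb]
  · simp

theorem ev_ne (hι : Function.Injective ι) {φ : Polynomial K} (h : φ ≠ 0) :
    Polynomial.aeval (xi ι) φ ≠ 0 := by
  intro h0
  have := ev_reflect hι φ φ.natDegree le_rfl
  rw [h0, zero_mul, eq_comm, map_eq_zero_iff _ hι] at this
  have := congrArg constantCoeff this
  rw [aeval_X2_cc, Polynomial.coeff_reflect] at this
  simp [h] at this

theorem ev_inj (hι : Function.Injective ι) {φ ψ : Polynomial K}
    (h : Polynomial.aeval (xi ι) φ = Polynomial.aeval (xi ι) ψ) : φ = ψ := by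
  by_contra hne
  apply ev_ne hι (sub_ne_zero.2 hne)
  rw [map_sub, h, sub_self]

open IntermediateField

theorem X2_mem : ι X ^ 2 ∈ K⟮xi ι⟯ := by
  have : xi ι ∈ K⟮xi ι⟯ := mem_adjoin_simple_self K _
  have := inv_mem this
  rwa [xi, inv_inv] at this

theorem poly_mem (g : Polynomial K) : ι (Polynomial.aeval ((X : K⟦X⟧) ^ 2) g) ∈ K⟮xi ι⟯ := by
  rw [← Polynomial.aeval_algHom_apply, map_pow]
  have h := X2_mem (ι := ι)
  rw [Polynomial.aeval_eq_sum_range]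
  exact sum_mem fun i _ => IntermediateField.smul_mem _ (pow_mem h i)

/-- multiplication by `u` exists and its square is rational -/
def GoodS (r : K) (ι : K⟦X⟧ →ₐ[K] L) (u : K) : Prop :=
  ∃ R Y, MulS (3 * r) (ww r) u R Y ∧ ι (R ^ 2) ∈ K⟮xi ι⟯ ∧ ι (R * Y * X * yy r) ∈ K⟮xi ι⟯

theorem GoodS.neg {r u : K} (h : GoodS r ι u) : GoodS r ι (-u) := by
  obtain ⟨R, Y, h1, h2, h3⟩ := h
  refine ⟨-R, Y, h1.neg, by rwa [neg_sq], ?_⟩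
  have := neg_mem h3
  rw [← map_neg] at this
  convert this using 2
  ring

theorem mem_add_aux (S : IntermediateField K L) (m a b ya yb t y v : L) (hm : m ∈ S) (ha1 : a ^ 2 ∈ S)
    (hb1 : b ^ 2 ∈ S) (hx2 : t ^ 2 ∈ S) (ha2 : a * ya * t * y ∈ S) (hb2 : b * yb * t * y ∈ S)
    (hsa : ya ^ 2 = 1 - m * a ^ 2 + a ^ 4) (hsb : yb ^ 2 = 1 - m * b ^ 2 + b ^ 4)
    (hy : y ^ 2 = 1 - m * t ^ 2 + t ^ 4) (hV : (1 - a ^ 2 * b ^ 2) * v = 1) (ht : t ≠ 0) (hy0 : y ≠ 0) :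
    ((a * yb + b * ya) * v) ^ 2 ∈ S ∧ ((a * yb + b * ya) * v) * (((ya * yb - m * a * b) * (1 + a ^ 2 * b ^ 2)
      + 2 * a * b * (a ^ 2 + b ^ 2)) * v ^ 2) * t * y ∈ S := by
  have h2 : (2 : L) ∈ S := ofNat_mem S 2
  have h1 : (1 : L) ∈ S := one_mem S
  have q4 : ∀ c : L, c ^ 2 ∈ S → 1 - m * c ^ 2 + c ^ 4 ∈ S := by
    intro c hc
    rw [show 1 - m * c ^ 2 + c ^ 4 = 1 - m * c ^ 2 + c ^ 2 * c ^ 2 by ring]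
    exact add_mem (sub_mem h1 (mul_mem hm hc)) (mul_mem hc hc)
  have hya : ya ^ 2 ∈ S := hsa ▸ q4 a ha1
  have hyb : yb ^ 2 ∈ S := hsb ▸ q4 b hb1
  have hyy : y ^ 2 ∈ S := hy ▸ q4 t hx2
  have hv : v ∈ S := by
    rw [eq_inv_of_mul_eq_one_right hV]
    exact inv_mem (sub_mem h1 (mul_mem ha1 hb1))
  have hpp : a * ya * (b * yb) ∈ S := by
    have : a * ya * (b * yb) = (a * ya * t * y) * (b * yb * t * y) * (t ^ 2 * y ^ 2)⁻¹ := by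
      field_simp
    rw [this]
    exact mul_mem (mul_mem ha2 hb2) (inv_mem (mul_mem hx2 hyy))
  constructor
  · rw [show ((a * yb + b * ya) * v) ^ 2 = (a ^ 2 * yb ^ 2 + b ^ 2 * ya ^ 2 + 2 * (a * ya * (b * yb))) * v ^ 2 by ring]
    exact mul_mem (add_mem (add_mem (mul_mem ha1 hyb) (mul_mem hb1 hya)) (mul_mem h2 hpp)) (pow_mem hv 2)
  · have : ((a * yb + b * ya) * v) * (((ya * yb - m * a * b) * (1 + a ^ 2 * b ^ 2)
      + 2 * a * b * (a ^ 2 + b ^ 2)) * v ^ 2) * t * y =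
      (((a * ya * t * y) * yb ^ 2 + (b * yb * t * y) * ya ^ 2 - m * (a ^ 2 * (b * yb * t * y) + b ^ 2 * (a * ya * t * y)))
        * (1 + a ^ 2 * b ^ 2)
      + 2 * (a ^ 2 * (b * yb * t * y) + b ^ 2 * (a * ya * t * y)) * (a ^ 2 + b ^ 2)) * v ^ 3 := by ring
    rw [this]
    have hc := add_mem (mul_mem ha1 hb2) (mul_mem hb1 ha2)
    exact mul_mem (add_mem (mul_mem (sub_mem (add_mem (mul_mem ha2 hyb) (mul_mem hb2 hya)) (mul_mem hm hc))
      (add_mem h1 (mul_mem ha1 hb1))) (mul_mem (mul_mem h2 hc) (add_mem ha1 hb1))) (pow_mem hv 3)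

theorem GoodS.zero {r : K} : GoodS r ι 0 := ⟨0, 1, MulS.zero, by simp, by simp⟩

variable [CharZero K]

theorem ff_cast (r : K) (c : L) : 1 - 2 * algebraMap K L (3 * r) * c ^ 2 + c ^ 4 =
    1 - algebraMap K L (6 * r) * c ^ 2 + c ^ 4 := by
  rw [map_mul, map_mul, map_ofNat, map_ofNat]; ring

theorem iota_ne (hι : Function.Injective ι) {c : K⟦X⟧} (h : c ≠ 0) : ι c ≠ 0 := by
  rwa [Ne, map_eq_zero_iff _ hι]

theorem yy_ne (r : K) : yy r ≠ 0 := by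
  intro h
  have := yy_cc r
  rw [h] at this; simp at this

theorem iota_sq {r u : K} {R Y : K⟦X⟧} (h : MulS (3 * r) (ww r) u R Y) :
    (ι Y) ^ 2 = 1 - algebraMap K L (6 * r) * (ι R) ^ 2 + (ι R) ^ 4 := by
  have eC : ∀ c : K, ι (C c) = algebraMap K L c := fun c => ι.commutes c
  have := congrArg ι h.sq
  rw [← ff_cast]
  simp only [map_mul, map_add, map_sub, map_pow, map_one, map_ofNat] at this ⊢
  rw [this, ← eC]

theorem GoodS.add {r u v : K} (hι : Function.Injective ι) (hr : r ^ 2 = -7) (h : GoodS r ι u) (h' : GoodS r ι v) :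
    GoodS r ι (u + v) := by
  obtain ⟨A, Ya, ha, ha1, ha2⟩ := h
  obtain ⟨B, Yb, hb, hb1, hb2⟩ := h'
  have eC : ∀ c : K, ι (C c) = algebraMap K L c := fun c => ι.commutes c
  have hV := congrArg ι (den_inv (B := B) ha.r0)
  have hX := iota_ne hι (X_ne_zero (R := K))
  simp only [map_mul, map_sub, map_pow, map_one] at ha1 hb1 ha2 hb2 hV
  have := mem_add_aux K⟮xi ι⟯ (algebraMap K L (6 * r)) (ι A) (ι B) (ι Ya) (ι Yb) (ι X) (ι (yy r))
    (ι (1 - A ^ 2 * B ^ 2)⁻¹) (IntermediateField.algebraMap_mem _ _) ha1 hb1 X2_mem ha2 hb2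
    (iota_sq ha) (iota_sq hb) (iota_sq (mul_one_S r hr)) hV hX (iota_ne hι (yy_ne r))
  refine ⟨_, _, ha.add hb, ?_, ?_⟩
  · convert this.1 using 1
    simp [addR]
  · convert this.2 using 1
    unfold addR addY
    simp only [map_mul, map_add, map_sub, map_pow, map_one, map_ofNat, eC]
    ring
end cmfield


set_option linter.unusedSectionVars false
section cmdeg
variable {K : Type*} [Field K] {L : Type*} [Field L] [Algebra K L] [CharZero K]
open PowerSeries IntermediateField
variable {ι : K⟦X⟧ →ₐ[K] L}

theorem aeval_X2_lin (c : K) : algebraMap K K⟦X⟧ c = C c := rfl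

theorem poly_mem' {g : K⟦X⟧} (h : ∃ q : Polynomial K, Polynomial.aeval ((X : K⟦X⟧) ^ 2) q = g) :
    ι g ∈ K⟮xi ι⟯ := by
  obtain ⟨q, rfl⟩ := h
  exact poly_mem q

theorem pa_poly (r : K) : ∃ q : Polynomial K, Polynomial.aeval ((X : K⟦X⟧) ^ 2) q = pa r :=
  ⟨Polynomial.C r - 21 * Polynomial.X - 5 * Polynomial.C r * Polynomial.X ^ 2 + Polynomial.X ^ 3, by
    simp only [map_sub, map_add, map_mul, map_pow, Polynomial.aeval_X, Polynomial.aeval_C, map_ofNat,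
      aeval_X2_lin, pa]
    ring⟩

theorem pb_poly (r : K) : ∃ q : Polynomial K, Polynomial.aeval ((X : K⟦X⟧) ^ 2) q = pb r :=
  ⟨1 - 5 * Polynomial.C r * Polynomial.X - 21 * Polynomial.X ^ 2 + Polynomial.C r * Polynomial.X ^ 3, by
    simp only [map_sub, map_add, map_mul, map_pow, Polynomial.aeval_X, Polynomial.aeval_C, map_ofNat,
      aeval_X2_lin, pb, map_one]
    ring⟩

theorem pj_poly (r : K) : ∃ q : Polynomial K, Polynomial.aeval ((X : K⟦X⟧) ^ 2) q = pj r :=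
  ⟨1 + 14 * Polynomial.C r * Polynomial.X + 143 * Polynomial.X ^ 2 + 132 * Polynomial.C r * Polynomial.X ^ 3
    + 143 * Polynomial.X ^ 4 + 14 * Polynomial.C r * Polynomial.X ^ 5 + Polynomial.X ^ 6, by
    simp only [map_add, map_mul, map_pow, Polynomial.aeval_X, Polynomial.aeval_C, map_ofNat,
      aeval_X2_lin, pj, map_one]
    ring⟩

theorem ff_poly (r : K) : ∃ q : Polynomial K, Polynomial.aeval ((X : K⟦X⟧) ^ 2) q = ff r :=
  ⟨1 - 2 * Polynomial.C (3 * r) * Polynomial.X + Polynomial.X ^ 2, by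
    simp only [map_add, map_sub, map_mul, map_pow, Polynomial.aeval_X, Polynomial.aeval_C, map_ofNat,
      aeval_X2_lin, ff, map_one]
    ring⟩

theorem X2_mem' : ι (X ^ 2) ∈ K⟮xi ι⟯ := by rw [map_pow]; exact X2_mem

theorem pV_mem (r : K) : ι (pV r) ∈ K⟮xi ι⟯ := by
  have h := congrArg ι (pbV r)
  rw [map_mul, map_one] at h
  rw [eq_inv_of_mul_eq_one_right h]
  exact inv_mem (poly_mem' (pb_poly r))

theorem GoodS.one (r : K) (hr : r ^ 2 = -7) : GoodS r ι 1 := by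
  refine ⟨_, _, mul_one_S r hr, X2_mem', ?_⟩
  rw [show X * yy r * X * yy r = X ^ 2 * ff r by rw [← yy_sq r hr]; ring, map_mul]
  exact mul_mem X2_mem' (poly_mem' (ff_poly r))

theorem GoodS.root (r : K) (hr : r ^ 2 = -7) : GoodS r ι r := by
  refine ⟨_, _, mul_r_S r hr, ?_, ?_⟩
  · rw [show Rr r ^ 2 = X ^ 2 * (pa r ^ 2 * pV r ^ 2) by unfold Rr; ring, map_mul, map_mul, map_pow ι (pa r),
      map_pow ι (pV r)]
    exact mul_mem X2_mem' (mul_mem (pow_mem (poly_mem' (pa_poly r)) 2) (pow_mem (pV_mem r) 2))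
  · rw [show Rr r * (yy r * pj r * pV r ^ 2) * X * yy r = X ^ 2 * (ff r * (pa r * (pj r * (pV r * pV r ^ 2)))) by
      rw [← yy_sq r hr]; unfold Rr; ring]
    rw [map_mul, map_mul, map_mul, map_mul, map_mul, map_pow ι (pV r)]
    exact mul_mem X2_mem' (mul_mem (poly_mem' (ff_poly r)) (mul_mem (poly_mem' (pa_poly r))
      (mul_mem (poly_mem' (pj_poly r)) (mul_mem (pV_mem r) (pow_mem (pV_mem r) 2)))))

theorem GoodS.nsmul {r u : K} (hι : Function.Injective ι) (hr : r ^ 2 = -7) (h : GoodS r ι u) (m : ℕ) :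
    GoodS r ι (m * u) := by
  induction m with
  | zero => simpa using GoodS.zero
  | succ m ih =>
    have := GoodS.add hι hr ih h
    convert this using 1
    push_cast; ring

theorem GoodS.zsmul {r u : K} (hι : Function.Injective ι) (hr : r ^ 2 = -7) (h : GoodS r ι u) (m : ℤ) :
    GoodS r ι (m * u) := by
  obtain ⟨n, rfl | rfl⟩ := m.eq_nat_or_neg
  · exact_mod_cast GoodS.nsmul hι hr h n
  · have := (GoodS.nsmul hι hr h n).neg
    convert this using 1
    push_cast; ring

theorem good_all {r : K} (hι : Function.Injective ι) (hr : r ^ 2 = -7) (m l : ℤ) :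
    GoodS r ι (m + l * r) := by
  have := GoodS.add hι hr (GoodS.zsmul hι hr (GoodS.one r hr) m) (GoodS.zsmul hι hr (GoodS.root r hr) l)
  rwa [mul_one] at this

/-- reduced fraction for the square of multiplication by `u` -/
def RepS (r : K) (ι : K⟦X⟧ →ₐ[K] L) (u : K) (φ ψ : Polynomial K) : Prop :=
  φ ≠ 0 ∧ IsCoprime φ ψ ∧ ∃ R Y, MulS (3 * r) (ww r) u R Y ∧
    ι (R ^ 2) * Polynomial.aeval (xi ι) φ = Polynomial.aeval (xi ι) ψ

theorem frac_exists (hι : Function.Injective ι) {c : L} (h : c ∈ K⟮xi ι⟯) : ∃ φ ψ : Polynomial K,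
    φ ≠ 0 ∧ IsCoprime φ ψ ∧ c * Polynomial.aeval (xi ι) φ = Polynomial.aeval (xi ι) ψ := by
  classical
  rw [mem_adjoin_simple_iff] at h
  obtain ⟨s, q, hc⟩ := h
  by_cases hq : q = 0
  · refine ⟨1, 0, one_ne_zero, isCoprime_one_left, ?_⟩
    rw [hc, hq]; simp
  obtain ⟨d, hd⟩ : ∃ d, d = EuclideanDomain.gcd q s := ⟨_, rfl⟩
  obtain ⟨q', hq'⟩ := EuclideanDomain.gcd_dvd_left q s
  obtain ⟨s', hs'⟩ := EuclideanDomain.gcd_dvd_right q s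
  have hd0 : d ≠ 0 := by rw [hd, Ne, EuclideanDomain.gcd_eq_zero_iff]; tauto
  have hg := EuclideanDomain.gcd_eq_gcd_ab q s
  rw [← hd] at hq' hs' hg
  have hcop : IsCoprime q' s' := by
    refine ⟨EuclideanDomain.gcdA q s, EuclideanDomain.gcdB q s, ?_⟩
    apply mul_left_cancel₀ hd0
    generalize EuclideanDomain.gcdA q s = A at *
    generalize EuclideanDomain.gcdB q s = B at *
    linear_combination -hg - A * hq' - B * hs'
  have hq'0 : q' ≠ 0 := by rintro rfl; exact hq (by rw [hq', mul_zero])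
  refine ⟨q', s', hq'0, hcop, ?_⟩
  have h1 := ev_ne hι hq
  rw [hc, div_mul_eq_mul_div, div_eq_iff h1]
  rw [hq', hs', map_mul, map_mul]; ring

theorem GoodS.rep {r u : K} (hι : Function.Injective ι) (h : GoodS r ι u) : ∃ φ ψ, RepS r ι u φ ψ := by
  obtain ⟨R, Y, h1, h2, h3⟩ := h
  obtain ⟨φ, ψ, h4, h5, h6⟩ := frac_exists hι h2
  exact ⟨φ, ψ, h4, h5, R, Y, h1, h6⟩

theorem frac_deg (hι : Function.Injective ι) {R : K⟦X⟧} (hR : constantCoeff R = 0) {φ ψ : Polynomial K}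
    (h0 : φ ≠ 0) (h : ι R * Polynomial.aeval (xi ι) φ = Polynomial.aeval (xi ι) ψ) : ψ.degree < φ.degree := by
  have h1 := ev_reflect hι φ (max φ.natDegree ψ.natDegree) (le_max_left _ _)
  have h2 := ev_reflect hι ψ (max φ.natDegree ψ.natDegree) (le_max_right _ _)
  rw [← h, mul_assoc, h1, ← map_mul] at h2
  have h3 := congrArg constantCoeff (hι h2)
  rw [map_mul, hR, zero_mul, aeval_X2_cc, Polynomial.coeff_reflect] at h3
  rw [Polynomial.revAt_le (by simp), Nat.sub_zero] at h3
  by_cases hψ : ψ = 0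
  · rw [hψ, Polynomial.degree_zero]; exact bot_lt_iff_ne_bot.2 (by simpa using h0)
  apply (Polynomial.degree_lt_degree)
  by_contra hlt
  rw [max_eq_right (not_lt.1 hlt)] at h3
  exact hψ (Polynomial.leadingCoeff_eq_zero.1 h3.symm)

theorem frac_dvd (hι : Function.Injective ι) {c : L} {φ ψ φ' ψ' : Polynomial K}
    (h : IsCoprime φ ψ) (h1 : c * Polynomial.aeval (xi ι) φ = Polynomial.aeval (xi ι) ψ)
    (h2 : c * Polynomial.aeval (xi ι) φ' = Polynomial.aeval (xi ι) ψ') : φ ∣ φ' := by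
  have : ψ * φ' = ψ' * φ := by
    apply ev_inj hι
    rw [map_mul, map_mul, ← h1, ← h2]; ring
  exact h.dvd_of_dvd_mul_left ⟨ψ', by rw [this]; ring⟩

open Classical in
/-- degree of multiplication by `u` -/
noncomputable def dg (r : K) (ι : K⟦X⟧ →ₐ[K] L) (u : K) : ℕ :=
  if h : ∃ φ : Polynomial K, ∃ ψ, RepS r ι u φ ψ then h.choose.natDegree else 0

theorem RepS.dvd {r u : K} (hι : Function.Injective ι) {φ ψ φ' ψ' : Polynomial K} {R Y : K⟦X⟧}
    (h : RepS r ι u φ ψ) (hS : MulS (3 * r) (ww r) u R Y)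
    (h2 : ι (R ^ 2) * Polynomial.aeval (xi ι) φ' = Polynomial.aeval (xi ι) ψ') : φ ∣ φ' := by
  obtain ⟨h0, hc, R', Y', hS', h1⟩ := h
  rw [(hS'.unique hS).1] at h1
  exact frac_dvd hι hc h1 h2

theorem RepS.dg {r u : K} (hι : Function.Injective ι) {φ ψ : Polynomial K} (h : RepS r ι u φ ψ) :
    dg r ι u = φ.natDegree := by
  have hex : ∃ φ : Polynomial K, ∃ ψ, RepS r ι u φ ψ := ⟨φ, ψ, h⟩
  unfold _root_.dg
  rw [dif_pos hex]
  obtain ⟨ψ', h'⟩ := hex.choose_spec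
  generalize hex.choose = φ' at *
  obtain ⟨h0, hc, R, Y, hS, h1⟩ := id h
  obtain ⟨h0', hc', R', Y', hS', h1'⟩ := id h'
  exact le_antisymm (Polynomial.natDegree_le_of_dvd (h'.dvd hι hS h1) h0)
    (Polynomial.natDegree_le_of_dvd (h.dvd hι hS' h1') h0')

theorem RepS.deg_lt {r u : K} (hι : Function.Injective ι) {φ ψ : Polynomial K} (h : RepS r ι u φ ψ) :
    ψ.degree < φ.degree := by
  obtain ⟨h0, hc, R, Y, hS, h1⟩ := h
  exact frac_deg hι (by simp [hS.r0]) h0 h1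

theorem gauss_dvd {A : Type*} [CommRing A] {f q f' q' P Q1 Q2 : A} (h1 : IsCoprime f q) (h2 : IsCoprime f' q')
    (e1 : q * q' * P = Q1 * (f * f')) (e2 : (q * f' + q' * f) * P = Q2 * (f * f')) : f * f' ∣ P := by
  obtain ⟨s, t, h1⟩ := h1
  obtain ⟨s', t', h2⟩ := h2
  have g1 : P = f * f' * (s * s' * P + t * s' * Q2 + t * t' * Q1) + (s * t' - t * s') * (f * q') * P := by
    linear_combination t * s' * e2 + t * t' * e1 - P * h1 - P * (s * f + t * q) * h2
  have g2 : (f * q') * P = f * f' * (f * q' * (s * s' * P + t * s' * Q2 + t * t' * Q1)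
      + (s * t' - t * s') * (f * q' * Q2 - Q1 * (f * f'))) := by
    linear_combination (f * q') * g1 + (s * t' - t * s') * (f * q' * e2 - f * f' * e1)
  exact ⟨(s * s' * P + t * s' * Q2 + t * t' * Q1) + (s * t' - t * s') * (f * q' * (s * s' * P + t * s' * Q2 + t * t' * Q1)
      + (s * t' - t * s') * (f * q' * Q2 - Q1 * (f * f'))), by
    linear_combination g1 + (s * t' - t * s') * g2⟩

theorem par_le {r u v : K} (hι : Function.Injective ι) (hr : r ^ 2 = -7) (hu : GoodS r ι u) (hv : GoodS r ι v) :
    dg r ι (u + v) + dg r ι (u - v) ≤ 2 * dg r ι u + 2 * dg r ι v := by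
  obtain ⟨φ1, ψ1, hs⟩ := (GoodS.add hι hr hu hv).rep hι
  obtain ⟨φ2, ψ2, hd⟩ := (GoodS.add hι hr hu hv.neg).rep hι
  rw [← sub_eq_add_neg] at hd
  obtain ⟨φu, ψu, hu⟩ := hu.rep hι
  obtain ⟨φv, ψv, hv⟩ := hv.rep hι
  have du := hu.deg_lt hι
  have dv := hv.deg_lt hι
  rw [hs.dg hι, hd.dg hι, hu.dg hι, hv.dg hι]
  obtain ⟨s0, sc, S, SY, sS, s1⟩ := hs
  obtain ⟨d0, dc, D, DY, dS, d1⟩ := hd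
  obtain ⟨u0, uc, A, Ya, uS, u1⟩ := hu
  obtain ⟨v0, vc, B, Yb, vS, v1⟩ := hv
  have eS := (sS.unique (uS.add vS)).1
  have eD := (dS.unique ((sub_eq_add_neg u v) ▸ (uS.add vS.neg))).1
  have hV := congrArg ι (den_inv (B := B) uS.r0)
  have qa := iota_sq (ι := ι) uS
  have qb := iota_sq (ι := ι) vS
  unfold addR at eS eD
  rw [eS] at s1
  rw [eD, neg_sq] at d1
  simp only [map_mul, map_sub, map_add, map_neg, map_pow, map_one] at hV s1 d1 u1 v1
  have e1 := ev_ne hι s0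
  have e2 := ev_ne hι d0
  have e3 := ev_ne hι u0
  have e4 := ev_ne hι v0
  obtain ⟨P, hP⟩ : ∃ P, P = (φu * φv - ψu * ψv) ^ 2 := ⟨_, rfl⟩
  obtain ⟨q, hq⟩ : ∃ q : Polynomial K → Polynomial K → Polynomial K,
    q = fun a b => a ^ 2 - Polynomial.C (6 * r) * a * b + b ^ 2 := ⟨_, rfl⟩
  have hq' : ∀ a b, Polynomial.aeval (xi ι) (q a b) = (Polynomial.aeval (xi ι) a) ^ 2 - algebraMap K L (6 * r) *
      (Polynomial.aeval (xi ι) a) * (Polynomial.aeval (xi ι) b) + (Polynomial.aeval (xi ι) b) ^ 2 := by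
    intro a b; rw [hq]; simp
  have hP0 : P ≠ 0 := by
    intro h
    have := congrArg (Polynomial.aeval (xi ι)) (hP.symm.trans h)
    simp only [map_mul, map_sub, map_pow, map_zero, ← u1, ← v1] at this
    have : Polynomial.aeval (xi ι) φu * Polynomial.aeval (xi ι) φv * (1 - ι A ^ 2 * ι B ^ 2) = 0 := by
      linear_combination pow_eq_zero_iff (two_ne_zero) |>.1 this
    rw [mul_eq_zero, or_iff_right (mul_ne_zero e3 e4)] at this
    rw [this, zero_mul] at hV
    exact zero_ne_one hV
  have hdv : φ1 * φ2 ∣ P := by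
    apply gauss_dvd (Q1 := (ψu * φv - ψv * φu) ^ 2) (Q2 := 2 * (ψu * φu * q φv ψv + ψv * φv * q φu ψu)) sc dc
    · apply ev_inj hι
      rw [hP]
      simp only [map_mul, map_sub, map_add, map_pow, map_ofNat, hq', ← s1, ← d1, ← u1, ← v1]
      generalize Polynomial.aeval (xi ι) φ1 = F1 at *
      generalize Polynomial.aeval (xi ι) φ2 = F2 at *
      generalize Polynomial.aeval (xi ι) φu = Fu at *
      generalize Polynomial.aeval (xi ι) φv = Fv at *
      generalize ι (1 - A ^ 2 * B ^ 2)⁻¹ = V at *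
      generalize ι A = a at *
      generalize ι B = b at *
      generalize ι Ya = ya at *
      generalize ι Yb = yb at *
      have : (a * yb + b * ya) * (a * yb - b * ya) = (a ^ 2 - b ^ 2) * (1 - a ^ 2 * b ^ 2) := by
        linear_combination a ^ 2 * qb - b ^ 2 * qa
      trans F1 * F2 * Fu ^ 2 * Fv ^ 2 * ((a * yb + b * ya) * (a * yb - b * ya)) ^ 2 * ((1 - a ^ 2 * b ^ 2) * V) ^ 2 * V ^ 2
      · ring
      · rw [hV, this]
        trans F1 * F2 * Fu ^ 2 * Fv ^ 2 * ((a ^ 2 - b ^ 2)) ^ 2 * ((1 - a ^ 2 * b ^ 2) * V) ^ 2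
        · ring
        · rw [hV]; ring
    · apply ev_inj hι
      rw [hP]
      simp only [map_mul, map_sub, map_add, map_pow, map_ofNat, hq', ← s1, ← d1, ← u1, ← v1]
      generalize Polynomial.aeval (xi ι) φ1 = F1 at *
      generalize Polynomial.aeval (xi ι) φ2 = F2 at *
      generalize Polynomial.aeval (xi ι) φu = Fu at *
      generalize Polynomial.aeval (xi ι) φv = Fv at *
      generalize ι (1 - A ^ 2 * B ^ 2)⁻¹ = V at *
      generalize ι A = a at *
      generalize ι B = b at *
      generalize ι Ya = ya at *
      generalize ι Yb = yb at *
      trans F1 * F2 * Fu ^ 2 * Fv ^ 2 * (2 * (a ^ 2 * yb ^ 2 + b ^ 2 * ya ^ 2)) * ((1 - a ^ 2 * b ^ 2) * V) ^ 2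
      · ring
      · rw [hV, qa, qb, map_mul, map_ofNat]; ring
  have hle := Polynomial.natDegree_le_of_dvd hdv hP0
  rw [Polynomial.natDegree_mul s0 d0] at hle
  refine hle.trans ?_
  have k1 := Polynomial.natDegree_le_natDegree du.le
  have k2 := Polynomial.natDegree_le_natDegree dv.le
  have k3 : (φu * φv - ψu * ψv).natDegree ≤ φu.natDegree + φv.natDegree := by
    refine (Polynomial.natDegree_sub_le _ _).trans (max_le ?_ ?_)
    · exact Polynomial.natDegree_mul_le
    · exact Polynomial.natDegree_mul_le.trans (add_le_add k1 k2)
  rw [hP, Polynomial.natDegree_pow]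
  omega
end cmdeg


set_option linter.unusedSectionVars false
section cmdeg2
variable {K : Type*} [Field K] {L : Type*} [Field L] [Algebra K L] [CharZero K]
open PowerSeries IntermediateField
variable {ι : K⟦X⟧ →ₐ[K] L}

theorem cop_sq {φ ψ : Polynomial K} (h : IsCoprime φ ψ) {c : K} (h1 : c ≠ 2) (h2 : c ≠ -2) :
    IsCoprime ((φ ^ 2 - ψ ^ 2) ^ 2) (4 * (ψ * φ * (φ ^ 2 - Polynomial.C c * φ * ψ + ψ ^ 2))) := by
  apply IsCoprime.pow_left
  rw [show φ ^ 2 - ψ ^ 2 = (φ - ψ) * (φ + ψ) by ring]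
  have hm1 : IsCoprime (φ - ψ) φ := by
    rw [show φ - ψ = -ψ + 1 * φ by ring]; exact h.symm.neg_left.add_mul_right_left 1
  have hm2 : IsCoprime (φ - ψ) ψ := by
    rw [show φ - ψ = φ + (-1) * ψ by ring]; exact h.add_mul_right_left (-1)
  have hp1 : IsCoprime (φ + ψ) φ := by
    rw [show φ + ψ = ψ + 1 * φ by ring]; exact h.symm.add_mul_right_left 1
  have hp2 : IsCoprime (φ + ψ) ψ := by
    rw [show φ + ψ = φ + 1 * ψ by ring]; exact h.add_mul_right_left 1
  have cu : ∀ (a : K) (q : Polynomial K), a ≠ 0 → IsCoprime q (Polynomial.C a) := by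
    intro a q ha
    exact ⟨0, Polynomial.C a⁻¹, by rw [← Polynomial.C_mul, inv_mul_cancel₀ ha]; simp⟩
  have c4 : ∀ q : Polynomial K, IsCoprime q 4 := by
    intro q
    have := cu 4 q (by norm_num)
    rwa [map_ofNat] at this
  have hc2 : Polynomial.C (2 : K) = 2 := map_ofNat _ 2
  apply IsCoprime.mul_left
  · refine (c4 _).mul_right ((hm2.mul_right hm1).mul_right ?_)
    have := ((cu (2 - c) (φ - ψ) (sub_ne_zero.2 h1.symm)).mul_right (hm1.mul_right hm2)).add_mul_left_right (φ - ψ)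
    rw [map_sub, hc2] at this
    rwa [show φ ^ 2 - Polynomial.C c * φ * ψ + ψ ^ 2 = (2 - Polynomial.C c) * (φ * ψ) + (φ - ψ) * (φ - ψ) by ring]
  · refine (c4 _).mul_right ((hp2.mul_right hp1).mul_right ?_)
    have := ((cu (-2 - c) (φ + ψ) (sub_ne_zero.2 h2.symm)).mul_right (hp1.mul_right hp2)).add_mul_left_right (φ + ψ)
    rw [map_sub, map_neg, hc2] at this
    rwa [show φ ^ 2 - Polynomial.C c * φ * ψ + ψ ^ 2 = (-2 - Polynomial.C c) * (φ * ψ) + (φ + ψ) * (φ + ψ) by ring]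

theorem double_ge {r u : K} (hι : Function.Injective ι) (hr : r ^ 2 = -7) (hu : GoodS r ι u) :
    4 * dg r ι u ≤ dg r ι (u + u) := by
  obtain ⟨φ2, ψ2, hs⟩ := (GoodS.add hι hr hu hu).rep hι
  obtain ⟨φ, ψ, hu⟩ := hu.rep hι
  have du := hu.deg_lt hι
  rw [hs.dg hι, hu.dg hι]
  obtain ⟨s0, sc, S, SY, sS, s1⟩ := hs
  obtain ⟨u0, uc, A, Ya, uS, u1⟩ := hu
  have eS := (sS.unique (uS.add uS)).1
  have hV := congrArg ι (den_inv (B := A) uS.r0)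
  have qa := iota_sq (ι := ι) uS
  unfold addR at eS
  rw [eS] at s1
  simp only [map_mul, map_sub, map_add, map_pow, map_one] at hV s1 u1
  have hn : ∀ e : K, e ^ 2 = 4 → 6 * r ≠ e := by
    intro e he h
    have : (-252 : K) = 4 := by rw [← he, ← h]; linear_combination (-36) * hr
    norm_num at this
  have hcop := cop_sq uc (c := 6 * r) (hn 2 (by norm_num)) (hn (-2) (by norm_num))
  have key : ψ2 * (φ ^ 2 - ψ ^ 2) ^ 2 = φ2 * (4 * (ψ * φ * (φ ^ 2 - Polynomial.C (6 * r) * φ * ψ + ψ ^ 2))) := by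
    apply ev_inj hι
    simp only [map_mul, map_sub, map_add, map_pow, map_ofNat, ← s1, ← u1, Polynomial.aeval_C]
    rw [map_mul, map_ofNat] at qa
    generalize Polynomial.aeval (xi ι) φ2 = F1 at *
    generalize Polynomial.aeval (xi ι) φ = F at *
    generalize ι (1 - A ^ 2 * A ^ 2)⁻¹ = V at *
    generalize ι A = a at *
    generalize ι Ya = ya at *
    trans F1 * F ^ 4 * 4 * a ^ 2 * ya ^ 2 * ((1 - a ^ 2 * a ^ 2) * V) ^ 2
    · ring
    · rw [hV, qa]; ring
  have hdv : (φ ^ 2 - ψ ^ 2) ^ 2 ∣ φ2 :=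
    hcop.dvd_of_dvd_mul_right ⟨ψ2, by rw [← key]; ring⟩
  have := Polynomial.natDegree_le_of_dvd hdv s0
  refine le_trans (le_of_eq ?_) this
  have hlt : (ψ ^ 2).degree < (φ ^ 2).degree := by
    rw [Polynomial.degree_pow, Polynomial.degree_pow]
    rw [Polynomial.degree_eq_natDegree u0] at du ⊢
    by_cases hψ : ψ = 0
    · simp only [hψ, Polynomial.degree_zero]
      rw [two_nsmul, two_nsmul, WithBot.bot_add]
      exact WithBot.bot_lt_coe _
    · rw [Polynomial.degree_eq_natDegree hψ] at du ⊢
      rw [Nat.cast_lt] at du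
      simp only [nsmul_eq_mul]
      exact_mod_cast (by omega : 2 * ψ.natDegree < 2 * φ.natDegree)
  rw [Polynomial.natDegree_pow, Polynomial.natDegree_eq_of_degree_eq (Polynomial.degree_sub_eq_left_of_degree_lt hlt),
    Polynomial.natDegree_pow]
  ring

theorem dg_zero {r : K} (hι : Function.Injective ι) : dg r ι 0 = 0 := by
  have : RepS r ι 0 1 0 := ⟨one_ne_zero, isCoprime_one_left, 0, 1, MulS.zero, by simp⟩
  rw [this.dg hι]; simp

theorem par_eq {r u v : K} (hι : Function.Injective ι) (hr : r ^ 2 = -7) (hu : GoodS r ι u) (hv : GoodS r ι v) :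
    dg r ι (u + v) + dg r ι (u - v) = 2 * dg r ι u + 2 * dg r ι v := by
  have h1 := par_le hι hr hu hv
  have hd : GoodS r ι (u - v) := by rw [sub_eq_add_neg]; exact GoodS.add hι hr hu hv.neg
  have h2 := par_le hι hr (GoodS.add hι hr hu hv) hd
  have h3 := double_ge hι hr hu
  have h4 := double_ge hι hr hv
  rw [show u + v + (u - v) = u + u by ring, show u + v - (u - v) = v + v by ring] at h2
  omega

theorem dg_le {r u : K} (hι : Function.Injective ι) (hu : GoodS r ι u) {R Y : K⟦X⟧} (hS : MulS (3 * r) (ww r) u R Y)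
    {a b : Polynomial K} {N : ℕ} (ha : a ≠ 0) (hN : a.natDegree ≤ N) (hN' : b.natDegree ≤ N)
    (h : R ^ 2 * Polynomial.aeval ((X : K⟦X⟧) ^ 2) a = Polynomial.aeval ((X : K⟦X⟧) ^ 2) b) :
    dg r ι u ≤ N := by
  obtain ⟨φ, ψ, h1⟩ := hu.rep hι
  rw [h1.dg hι]
  have hX : (ι X ^ 2) ^ N ≠ 0 := pow_ne_zero _ (pow_ne_zero _ (iota_ne hι X_ne_zero))
  have e1 := ev_reflect hι (Polynomial.reflect N a) N (Polynomial.natDegree_reflect_le.trans (by simp [hN]))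
  have e2 := ev_reflect hι (Polynomial.reflect N b) N (Polynomial.natDegree_reflect_le.trans (by simp [hN']))
  rw [Polynomial.reflect_reflect] at e1 e2
  have := h1.dvd hι hS (φ' := Polynomial.reflect N a) (ψ' := Polynomial.reflect N b) (by
    apply mul_right_cancel₀ hX
    rw [mul_assoc, e1, e2, ← map_mul, h])
  exact (Polynomial.natDegree_le_of_dvd this (by simpa using ha)).trans
    (Polynomial.natDegree_reflect_le.trans (by simp [hN]))
end cmdeg2


set_option linter.unusedSectionVars false
section cmdeg3
variable {K : Type*} [Field K] {L : Type*} [Field L] [Algebra K L] [CharZero K]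
open PowerSeries IntermediateField
variable {ι : K⟦X⟧ →ₐ[K] L}

theorem xi_mul (hι : Function.Injective ι) : ι X ^ 2 * xi ι = 1 := by
  unfold xi
  exact mul_inv_cancel₀ (pow_ne_zero _ (iota_ne hι X_ne_zero))

theorem dg_one {r : K} (hι : Function.Injective ι) (hr : r ^ 2 = -7) : dg r ι 1 = 1 := by
  have : RepS r ι 1 Polynomial.X 1 := ⟨Polynomial.X_ne_zero, isCoprime_one_right, _, _, mul_one_S r hr, by
    rw [map_pow, Polynomial.aeval_X, map_one, xi_mul hι]⟩
  rw [this.dg hι]; simp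

theorem dg_root {r : K} (hι : Function.Injective ι) (hr : r ^ 2 = -7) : dg r ι r = 7 := by
  obtain ⟨a, ha⟩ : ∃ a : Polynomial K, a = Polynomial.C r - 21 * Polynomial.X
    - 5 * Polynomial.C r * Polynomial.X ^ 2 + Polynomial.X ^ 3 := ⟨_, rfl⟩
  obtain ⟨b, hb⟩ : ∃ b : Polynomial K, b = 1 - 5 * Polynomial.C r * Polynomial.X - 21 * Polynomial.X ^ 2
    + Polynomial.C r * Polynomial.X ^ 3 := ⟨_, rfl⟩
  have hC : (Polynomial.C r) ^ 2 = -7 := by rw [← map_pow, hr, map_neg, map_ofNat]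
  have da : a.natDegree = 3 := by rw [ha, ← map_ofNat Polynomial.C 21, ← map_ofNat Polynomial.C 5]; compute_degree!
  have a0 : a ≠ 0 := by rintro h; rw [h] at da; simp at da
  have c1 : IsCoprime Polynomial.X b := by
    refine ⟨5 * Polynomial.C r + 21 * Polynomial.X - Polynomial.C r * Polynomial.X ^ 2, 1, ?_⟩
    rw [hb]; ring
  have c2 : IsCoprime a b := by
    have h2048 : (Polynomial.C (2048 : K)⁻¹) * 2048 = 1 := by
      rw [← map_ofNat Polynomial.C 2048, ← map_mul, inv_mul_cancel₀ (by norm_num), map_one]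
    refine ⟨Polynomial.C (2048 : K)⁻¹ * (-193 * Polynomial.C r - 742 * Polynomial.X + 35 * Polynomial.C r * Polynomial.X ^ 2),
      Polynomial.C (2048 : K)⁻¹ * (697 + 174 * Polynomial.C r * Polynomial.X - 35 * Polynomial.X ^ 2), ?_⟩
    rw [← h2048, mul_assoc (Polynomial.C _), mul_assoc (Polynomial.C _), ← mul_add]
    congr 1
    rw [ha, hb]
    generalize (Polynomial.C r) = s at *
    generalize (Polynomial.X : Polynomial K) = T at *
    grind
  have hrep : RepS r ι r (Polynomial.X * a ^ 2) (b ^ 2) := by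
    refine ⟨mul_ne_zero Polynomial.X_ne_zero (pow_ne_zero _ a0), (c1.mul_left c2.pow_left).pow_right, _, _,
      mul_r_S r hr, ?_⟩
    have hx := xi_mul hι
    have hV := congrArg ι (pbV r)
    unfold Rr
    rw [ha, hb]
    have eC : ∀ c : K, ι (C c) = algebraMap K L c := fun c => ι.commutes c
    simp only [map_mul, map_pow, map_sub, map_add, map_one, map_ofNat, Polynomial.aeval_X, Polynomial.aeval_C,
      pa, pb, eC] at hV ⊢
    generalize ι (pV r) = V at *
    have ht := iota_ne hι (X_ne_zero (R := K))
    generalize ι X = t at *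
    generalize algebraMap K L r = s at *
    have : xi ι = (t ^ 2)⁻¹ := eq_inv_of_mul_eq_one_right hx
    rw [this]
    have h1 : (s - 21 * (t ^ 2)⁻¹ - 5 * s * (t ^ 2)⁻¹ ^ 2 + (t ^ 2)⁻¹ ^ 3) * V = (t ^ 2)⁻¹ ^ 3 := by
      have : (s - 21 * (t ^ 2)⁻¹ - 5 * s * (t ^ 2)⁻¹ ^ 2 + (t ^ 2)⁻¹ ^ 3) =
        (t ^ 2)⁻¹ ^ 3 * (1 - 5 * s * t ^ 2 - 21 * t ^ 4 + s * t ^ 6) := by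
        field_simp; ring
      rw [this, mul_assoc, hV, mul_one]
    trans ((s - 21 * (t ^ 2)⁻¹ - 5 * s * (t ^ 2)⁻¹ ^ 2 + (t ^ 2)⁻¹ ^ 3) * V) ^ 2 *
      (s - 21 * t ^ 2 - 5 * s * t ^ 4 + t ^ 6) ^ 2 * (t ^ 2 * (t ^ 2)⁻¹)
    · ring
    · rw [h1]; field_simp; ring
  rw [hrep.dg hι, Polynomial.natDegree_mul Polynomial.X_ne_zero (pow_ne_zero _ a0), Polynomial.natDegree_pow, da]
  simp

theorem sum_series {r e : K} (hr : r ^ 2 = -7) (he2 : e ^ 2 = 1) {R Y : K⟦X⟧} (hS : MulS (3 * r) (ww r) (1 + e * r) R Y)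
    (hS' : R = addR X (yy r) (C e * Rr r) (yy r * pj r * pV r ^ 2))
    {s Z f c A : K⟦X⟧} (hs : s = C (e * r)) (hZ : Z = C e * X ^ 2) (hf : f = 1 - 6 * s * Z + Z ^ 2)
    (hc : c = 1 - (5 + 2 * s) * Z + (5 + 2 * s) * Z ^ 2 - Z ^ 3)
    (hA : A = (1 + s) + (-5 + 11 * s) * Z + (-5 + 11 * s) * Z ^ 2 + (1 + s) * Z ^ 3) :
    R ^ 2 * (f * c ^ 2) = X ^ 2 * A ^ 2 := by
  obtain ⟨g, hg⟩ : ∃ g : K⟦X⟧, g = 1 + (5 - 2 * s) * Z + (5 - 2 * s) * Z ^ 2 + Z ^ 3 := ⟨_, rfl⟩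
  have hE : (C e : K⟦X⟧) ^ 2 = 1 := by rw [← map_pow, he2, map_one]
  have hs2 : s ^ 2 = -7 := by rw [hs, ← map_pow, mul_pow, he2, hr, one_mul, map_neg, map_ofNat]
  have hr' : C r = C e * s := by rw [hs, ← map_mul, ← mul_assoc, ← sq, he2, one_mul]
  have hX2 : X ^ 2 = C e * Z := by rw [hZ]; linear_combination (-X ^ 2) * hE
  have i1 : pj r + C e * pa r * pb r = g * A := by
    rw [hg, hA]; unfold pj pa pb
    rw [show (X : K⟦X⟧) ^ 4 = (X ^ 2) ^ 2 by ring, show (X : K⟦X⟧) ^ 6 = (X ^ 2) ^ 3 by ring,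
      show (X : K⟦X⟧) ^ 8 = (X ^ 2) ^ 4 by ring, show (X : K⟦X⟧) ^ 10 = (X ^ 2) ^ 5 by ring,
      show (X : K⟦X⟧) ^ 12 = (X ^ 2) ^ 6 by ring, hX2, hr']
    clear hZ hX2 hr' hs
    generalize C e = E at *
    grind
  have i2 : pb r ^ 2 - X ^ 4 * pa r ^ 2 = g * (f * c) := by
    rw [hg, hf, hc]; unfold pa pb
    rw [show (X : K⟦X⟧) ^ 4 = (X ^ 2) ^ 2 by ring, show (X : K⟦X⟧) ^ 6 = (X ^ 2) ^ 3 by ring, hX2, hr']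
    clear hZ hX2 hr' hs i1 hS hS' hr he2 hf hc hA hg
    generalize C e = E at *
    grind
  have hfy : yy r ^ 2 = f := by
    rw [yy_sq r hr, hf, ff]
    rw [show (X : K⟦X⟧) ^ 4 = (X ^ 2) ^ 2 by ring, hX2, map_mul, map_ofNat, hr']
    linear_combination (-6 * s * Z + Z ^ 2) * hE
  have hf0 : f ≠ 0 := by rw [← hfy]; exact pow_ne_zero _ (yy_ne r)
  have hg0 : g ≠ 0 := by
    intro h
    have := congrArg constantCoeff h
    simp [hg, hZ] at this
  have hD := den_inv (A := (X : K⟦X⟧)) (B := C e * Rr r) (by simp)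
  have hbV := pbV r
  unfold addR at hS'
  have h1 : R * (f * c) = X * yy r * A := by
    apply mul_left_cancel₀ hg0
    rw [show g * (R * (f * c)) = R * (g * (f * c)) by ring, ← i2,
      show g * (X * yy r * A) = X * yy r * (g * A) by ring, ← i1, hS']
    have e1 : pb r ^ 2 - X ^ 4 * pa r ^ 2 = pb r ^ 2 * (1 - X ^ 2 * (C e * Rr r) ^ 2) := by
      unfold Rr
      linear_combination (X ^ 4 * pa r ^ 2 * pb r ^ 2 * pV r ^ 2) * hE + X ^ 4 * pa r ^ 2 * (pb r * pV r + 1) * hbV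
    rw [e1]
    generalize (1 - X ^ 2 * (C e * Rr r) ^ 2)⁻¹ = W at *
    trans pb r ^ 2 * (X * (yy r * pj r * pV r ^ 2) + C e * Rr r * yy r)
    · linear_combination pb r ^ 2 * (X * (yy r * pj r * pV r ^ 2) + C e * Rr r * yy r) * hD
    · unfold Rr
      linear_combination (X * yy r * pj r * (pb r * pV r + 1) + C e * X * pa r * yy r * pb r) * hbV
  apply mul_left_cancel₀ hf0
  linear_combination (R * (f * c) + X * yy r * A) * h1 + X ^ 2 * A ^ 2 * hfy

theorem dg_sum_aux {r e : K} (hι : Function.Injective ι) (hr : r ^ 2 = -7) (he : e = 1 ∨ e = -1) :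
    dg r ι (1 + e * r) ≤ 8 := by
  have he2 : e ^ 2 = 1 := by rcases he with rfl | rfl <;> norm_num
  have hgood : GoodS r ι (1 + e * r) := by
    rcases he with rfl | rfl
    · rw [one_mul]; exact GoodS.add hι hr (GoodS.one r hr) (GoodS.root r hr)
    · rw [neg_one_mul]; exact GoodS.add hι hr (GoodS.one r hr) (GoodS.root r hr).neg
  have hS : MulS (3 * r) (ww r) (1 + e * r) (addR X (yy r) (C e * Rr r) (yy r * pj r * pV r ^ 2))
      (addY (3 * r) X (yy r) (C e * Rr r) (yy r * pj r * pV r ^ 2)) := by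
    apply (mul_one_S r hr).add
    rcases he with rfl | rfl
    · rw [map_one, one_mul, one_mul]; exact mul_r_S r hr
    · rw [map_neg, map_one, neg_one_mul, neg_one_mul]; exact (mul_r_S r hr).neg
  obtain ⟨s, hs⟩ : ∃ s : Polynomial K, s = Polynomial.C (e * r) := ⟨_, rfl⟩
  obtain ⟨Z, hZ⟩ : ∃ Z : Polynomial K, Z = Polynomial.C e * Polynomial.X := ⟨_, rfl⟩
  have key := sum_series hr he2 hS rfl rfl rfl rfl rfl rfl
  have n2 : (2 : Polynomial K) = Polynomial.C 2 := (map_ofNat _ 2).symm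
  have n5 : (5 : Polynomial K) = Polynomial.C 5 := (map_ofNat _ 5).symm
  have n6 : (6 : Polynomial K) = Polynomial.C 6 := (map_ofNat _ 6).symm
  have n11 : (11 : Polynomial K) = Polynomial.C 11 := (map_ofNat _ 11).symm
  refine dg_le hι hgood hS (a := (1 - 6 * s * Z + Z ^ 2) * (1 - (5 + 2 * s) * Z + (5 + 2 * s) * Z ^ 2 - Z ^ 3) ^ 2)
    (b := Polynomial.X * ((1 + s) + (-5 + 11 * s) * Z + (-5 + 11 * s) * Z ^ 2 + (1 + s) * Z ^ 3) ^ 2) ?_ ?_ ?_ ?_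
  · intro h
    have := congrArg (Polynomial.eval 0) h
    simp [hZ] at this
  · rw [hs, hZ, n2, n5, n6]; compute_degree
  · rw [hs, hZ, n5, n11]; compute_degree; norm_num
  · rw [hs, hZ]
    simp only [map_mul, map_add, map_sub, map_neg, map_pow, map_one, map_ofNat, Polynomial.aeval_X, Polynomial.aeval_C,
      aeval_X2_lin] at key ⊢
    exact key

theorem dg_form {r : K} (hι : Function.Injective ι) (hr : r ^ 2 = -7) (m l : ℤ) :
    (dg r ι (m + l * r) : ℤ) = m ^ 2 + 7 * l ^ 2 := by
  have g1 := GoodS.one (ι := ι) r hr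
  have gr := GoodS.root (ι := ι) r hr
  obtain ⟨F, hF⟩ : ∃ F : ℤ → ℤ → ℤ, F = fun m l : ℤ => (dg r ι ((m : K) + (l : K) * r) : ℤ) - (m ^ 2 + 7 * l ^ 2) := ⟨_, rfl⟩
  have f00 : F 0 0 = 0 := by simp [hF, dg_zero hι]
  have f10 : F 1 0 = 0 := by simp [hF, dg_one hι hr]
  have f01 : F 0 1 = 0 := by simp [hF, dg_root hι hr]
  have par : ∀ a b c d, F (a + c) (b + d) + F (a - c) (b - d) = 2 * F a b + 2 * F c d := by
    intro a b c d
    have := par_eq hι hr (good_all hι hr a b) (good_all hι hr c d)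
    rw [show (a + b * r + (c + d * r) : K) = ((a + c : ℤ) : K) + ((b + d : ℤ) : K) * r by push_cast; ring,
      show (a + b * r - (c + d * r) : K) = ((a - c : ℤ) : K) + ((b - d : ℤ) : K) * r by push_cast; ring] at this
    rw [hF]
    zify at this
    push_cast
    linear_combination this
  have f11 : F 1 1 = 0 := by
    have h1 := dg_sum_aux (r := r) (e := 1) hι hr (Or.inl rfl)
    have h2 := dg_sum_aux (r := r) (e := -1) hι hr (Or.inr rfl)
    have h3 := par 1 0 0 1
    rw [f10, f01] at h3
    have e1 : F 1 1 ≤ 0 := by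
      rw [hF]; simp only [Int.cast_one]; zify at h1; linarith
    have e2 : F 1 (-1) ≤ 0 := by
      rw [hF]; simp only [Int.cast_one, Int.cast_neg]; zify at h2; linarith
    norm_num at h3
    linarith
  -- first vary the first coordinate
  have hrow : ∀ l : ℤ, F 0 l = 0 → F 1 l = 0 → ∀ m : ℕ, F m l = 0 ∧ F (m + 1) l = 0 := by
    intro l h0 h1 m
    induction m with
    | zero => exact ⟨by simpa using h0, by simpa using h1⟩
    | succ m ih =>
      refine ⟨by exact_mod_cast ih.2, ?_⟩
      have := par (m + 1) l 1 0
      rw [ih.2, f10] at this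
      norm_num at this
      rw [ih.1] at this
      push_cast
      linarith
  have hcol : ∀ l : ℕ, (F 0 l = 0 ∧ F 1 l = 0) ∧ (F 0 (l + 1) = 0 ∧ F 1 (l + 1) = 0) := by
    intro l
    induction l with
    | zero => exact ⟨⟨by simpa using f00, by simpa using f10⟩, ⟨by simpa using f01, by simpa using f11⟩⟩
    | succ l ih =>
      refine ⟨by exact_mod_cast ih.2, ?_, ?_⟩
      · have := par 0 (l + 1) 0 1
        rw [ih.2.1, f01] at this
        norm_num at this
        rw [ih.1.1] at this
        push_cast
        linarith
      · have := par 1 (l + 1) 0 1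
        rw [ih.2.2, f01] at this
        norm_num at this
        rw [ih.1.2] at this
        push_cast
        linarith
  have hpos : ∀ m l : ℕ, F m l = 0 := fun m l => (hrow l (hcol l).1.1 (hcol l).1.2 m).1
  have hneg : ∀ m l : ℤ, F (-m) (-l) = F m l := by
    intro m l
    have := par 0 0 m l
    rw [f00] at this
    norm_num at this
    linarith
  have hmix : ∀ m l : ℕ, F m (-l) = 0 := by
    intro m l
    have := par m 0 0 l
    have a1 := hpos m 0
    have a2 := hpos 0 l
    have a3 := hpos m l
    simp only [Nat.cast_zero] at a1 a2
    rw [a1, a2] at this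
    norm_num at this
    linarith
  have : F m l = 0 := by
    obtain ⟨a, rfl | rfl⟩ := m.eq_nat_or_neg
    · obtain ⟨b, rfl | rfl⟩ := l.eq_nat_or_neg
      · exact hpos a b
      · exact hmix a b
    · obtain ⟨b, rfl | rfl⟩ := l.eq_nat_or_neg
      · have := hneg a (-b)
        rw [neg_neg] at this
        rw [this]; exact hmix a b
      · rw [hneg]; exact hpos a b
  rw [hF] at this
  linarith
end cmdeg3


set_option linter.unusedSectionVars false
section cmfrac
variable {K : Type*} [Field K] {L : Type*} [Field L] [Algebra K L] [CharZero K]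
open PowerSeries IntermediateField
variable {ι : K⟦X⟧ →ₐ[K] L}

theorem pa_ne (r : K) : pa r ≠ 0 := by
  intro h
  have := congrArg (coeff 6) h
  unfold pa at this
  rw [← map_ofNat (C : K →+* K⟦X⟧) 21, ← map_ofNat (C : K →+* K⟦X⟧) 5, ← map_mul] at this
  simp only [map_add, map_sub, coeff_C_mul, coeff_X_pow, coeff_C, map_zero] at this
  norm_num at this

theorem pmul_mem {r u v : K} (hι : Function.Injective ι) (hr : r ^ 2 = -7) (hu : GoodS r ι u) (hv : GoodS r ι v)
    {R Y S W : K⟦X⟧} (hR : MulS (3 * r) (ww r) (u + v) R Y) (hS : MulS (3 * r) (ww r) (u - v) S W) :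
    ι (R * S) ∈ K⟮xi ι⟯ := by
  obtain ⟨A, Ya, uS, ha, -⟩ := hu
  obtain ⟨B, Yb, vS, hb, -⟩ := hv
  have eS := (hR.unique (uS.add vS)).1
  have eD := (hS.unique ((sub_eq_add_neg u v) ▸ (uS.add vS.neg))).1
  have hV := den_inv (B := B) uS.r0
  unfold addR at eS eD
  rw [neg_sq] at eD
  have key : R * S = (A ^ 2 - B ^ 2) * (1 - A ^ 2 * B ^ 2)⁻¹ := by
    rw [eS, eD]
    have h1 := uS.sq
    have h2 := vS.sq
    generalize (1 - A ^ 2 * B ^ 2)⁻¹ = V at *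
    linear_combination V ^ 2 * A ^ 2 * h2 - V ^ 2 * B ^ 2 * h1 + V * (A ^ 2 - B ^ 2) * hV
  rw [key, map_mul, map_sub]
  refine mul_mem (sub_mem ha hb) ?_
  have := congrArg ι hV
  rw [map_mul, map_one] at this
  rw [eq_inv_of_mul_eq_one_right this, map_sub, map_one, map_mul]
  exact inv_mem (sub_mem (one_mem _) (mul_mem ha hb))

theorem odd_mem {r : K} (hι : Function.Injective ι) (hr : r ^ 2 = -7) {x y : ℤ} (h : Odd (x ^ 2 + 7 * y ^ 2)) :
    ∃ R Y, MulS (3 * r) (ww r) (x + y * r) R Y ∧ ι (R * X) ∈ K⟮xi ι⟯ := by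
  obtain ⟨R, Y, hR, -⟩ := good_all (ι := ι) hι hr x y
  refine ⟨R, Y, hR, ?_⟩
  rcases Int.even_or_odd x with ⟨m, hx⟩ | ⟨m, hx⟩
  · have hy : Odd y := by
      by_contra hy
      rw [Int.not_odd_iff_even] at hy
      have h2 : Even (x ^ 2 + 7 * y ^ 2) :=
        (Even.pow_of_ne_zero ⟨m, hx⟩ two_ne_zero).add ((hy.pow_of_ne_zero two_ne_zero).mul_left 7)
      exact Int.not_even_iff_odd.2 h h2
    obtain ⟨l, hl⟩ := hy
    have h1 := pmul_mem hι hr (good_all (r := r) (ι := ι) hι hr m (l + 1)) (good_all (r := r) (ι := ι) hι hr m l)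
      (R := R) (Y := Y) (S := Rr r) (by convert hR using 1; rw [hx, hl]; push_cast; ring)
      (by convert mul_r_S r hr using 1; push_cast; ring)
    have h2 : ι (R * X) = ι (R * Rr r) * (ι (pa r))⁻¹ * (ι (pV r))⁻¹ := by
      have a1 := iota_ne hι (pa_ne r)
      have a2 : ι (pV r) ≠ 0 := iota_ne hι (right_ne_zero_of_mul_eq_one (pbV r))
      unfold Rr
      rw [map_mul, map_mul, map_mul, map_mul]
      field_simp
    rw [h2]
    exact mul_mem (mul_mem h1 (inv_mem (poly_mem' (pa_poly r)))) (inv_mem (pV_mem r))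
  · have hy : Even y := by
      by_contra hy
      rw [Int.not_even_iff_odd] at hy
      have h2 : Even (x ^ 2 + 7 * y ^ 2) :=
        (Odd.pow ⟨m, hx⟩).add_odd ((by decide : Odd (7 : ℤ)).mul (hy.pow))
      exact Int.not_even_iff_odd.2 h h2
    obtain ⟨l, hl⟩ := hy
    exact pmul_mem hι hr (good_all (r := r) (ι := ι) hι hr (m + 1) l) (good_all (r := r) (ι := ι) hι hr m l)
      (R := R) (Y := Y) (S := X) (by convert hR using 1; rw [hx, hl]; push_cast; ring)
      (by convert mul_one_S r hr using 1; push_cast; ring)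

theorem mulS_c1 {r u : K} {R Y : K⟦X⟧} (h : MulS (3 * r) (ww r) u R Y) : coeff 1 R = u := by
  have := congrArg constantCoeff h.dr
  rw [← coeff_zero_eq_constantCoeff_apply, coeff_derivative] at this
  simpa [ww_cc, h.y0] using this

theorem split_frac {D N φ ψ : Polynomial K} {n : ℕ} (hφ : φ ≠ 0) (hc : IsCoprime φ ψ) (hDN : IsCoprime D N)
    (hN : N ≠ 0) (hdeg : φ.natDegree = 2 * n + 1) (key : φ * N ^ 2 * Polynomial.X = ψ * D ^ 2) :
    ∃ D1, D = Polynomial.X * D1 ∧ D1.natDegree = n := by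
  have h1 : N ^ 2 ∣ ψ := hDN.symm.pow.dvd_of_dvd_mul_right ⟨φ * Polynomial.X, by rw [← key]; ring⟩
  obtain ⟨k, hk⟩ := h1
  have h2 : φ * Polynomial.X = k * D ^ 2 := by
    apply mul_left_cancel₀ (pow_ne_zero 2 hN)
    rw [hk] at key
    linear_combination key
  have h3 : IsCoprime k φ := by
    rw [hk] at hc; exact hc.of_mul_right_right.symm
  have h4 : k ∣ Polynomial.X := h3.dvd_of_dvd_mul_left ⟨D ^ 2, h2⟩
  obtain ⟨l, hl⟩ := h4
  rcases Polynomial.irreducible_X.isUnit_or_isUnit hl with hu | hu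
  · have h5 : Polynomial.X ∣ D ^ 2 := hu.dvd_mul_left.1 (by rw [← h2]; exact dvd_mul_left _ _)
    obtain ⟨D1, hD1⟩ := Polynomial.prime_X.dvd_of_dvd_pow h5
    refine ⟨D1, hD1, ?_⟩
    have h6 : φ = k * Polynomial.X * D1 ^ 2 := by
      apply mul_right_cancel₀ Polynomial.X_ne_zero
      rw [h2, hD1]; ring
    have hD0 : D1 ≠ 0 := by rintro rfl; apply hφ; rw [h6]; ring
    rw [h6, Polynomial.natDegree_mul (mul_ne_zero hu.ne_zero Polynomial.X_ne_zero) (pow_ne_zero _ hD0),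
      Polynomial.natDegree_mul hu.ne_zero Polynomial.X_ne_zero, Polynomial.natDegree_pow,
      Polynomial.natDegree_eq_zero_of_isUnit hu, Polynomial.natDegree_X] at hdeg
    omega
  · exfalso
    have h6 : φ * l = D ^ 2 := by
      have hk0 : k ≠ 0 := by rintro rfl; rw [zero_mul] at hl; exact Polynomial.X_ne_zero hl
      apply mul_left_cancel₀ hk0
      rw [← h2, hl]; ring
    have := congrArg Polynomial.natDegree h6
    rw [Polynomial.natDegree_mul hφ hu.ne_zero, Polynomial.natDegree_pow,
      Polynomial.natDegree_eq_zero_of_isUnit hu, hdeg] at this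
    omega

theorem cm_frac {r : K} (hι : Function.Injective ι) (hr : r ^ 2 = -7) {x y : ℤ} {n : ℕ}
    (h : x ^ 2 + 7 * y ^ 2 = 2 * n + 1) (hα : (x + y * r : K) ≠ 0) :
    ∃ R Y, MulS (3 * r) (ww r) (x + y * r) R Y ∧ ∃ D N : Polynomial K, IsCoprime D N ∧ D.natDegree = n ∧ D ≠ 0 ∧
      N.natDegree ≤ n ∧ N.coeff 0 ≠ 0 ∧ R * Polynomial.aeval ((X : K⟦X⟧) ^ 2) (Polynomial.reflect n D) =
        X * Polynomial.aeval ((X : K⟦X⟧) ^ 2) (Polynomial.reflect n N) := by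
  obtain ⟨R, Y, hR, hm⟩ := odd_mem (ι := ι) (r := r) hι hr (x := x) (y := y) ⟨n, by rw [h]⟩
  obtain ⟨D, N, hD0, hDN, e1⟩ := frac_exists hι hm
  obtain ⟨φ, ψ, hrep⟩ := (good_all (ι := ι) hι hr x y).rep hι
  have hdg := dg_form (ι := ι) hι hr x y
  rw [hrep.dg hι, h] at hdg
  obtain ⟨hφ, hc, R', Y', hR', e2⟩ := hrep
  rw [(hR'.unique hR).1] at e2
  have hRne : R ≠ 0 := by
    rintro rfl
    have := mulS_c1 hR
    rw [map_zero] at this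
    exact hα this.symm
  have hN : N ≠ 0 := by
    rintro rfl
    rw [map_zero] at e1
    exact mul_ne_zero (iota_ne hι (mul_ne_zero hRne X_ne_zero)) (ev_ne hι hD0) e1
  have hdl := frac_deg hι (by simp) hD0 e1
  have hx := xi_mul hι
  obtain ⟨D1, hD, hdD⟩ := split_frac (n := n) hφ hc hDN hN (by exact_mod_cast hdg) (by
    apply ev_inj hι
    simp only [map_mul, map_pow, ← e1, ← e2, Polynomial.aeval_X]
    linear_combination Polynomial.aeval (xi ι) φ * ι R ^ 2 * Polynomial.aeval (xi ι) D ^ 2 * hx)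
  have hD10 : D1 ≠ 0 := by rintro rfl; apply hD0; rw [hD]; ring
  rw [hD] at hDN
  have hNn : N.natDegree ≤ n := by
    have := Polynomial.natDegree_lt_natDegree hN hdl
    rw [hD, Polynomial.natDegree_mul Polynomial.X_ne_zero hD10, Polynomial.natDegree_X, hdD] at this
    omega
  refine ⟨R, Y, hR, D1, N, hDN.of_mul_left_right, hdD, hD10, hNn, ?_, ?_⟩
  · intro h0
    obtain ⟨a, b, hab⟩ := hDN.of_mul_left_left
    have := congrArg (Polynomial.eval 0) hab
    simp [← Polynomial.coeff_zero_eq_eval_zero, h0] at this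
  · apply hι
    rw [map_mul, map_mul, ← ev_reflect hι D1 n hdD.le, ← ev_reflect hι N n hNn, ← e1, hD]
    simp only [map_mul, Polynomial.aeval_X]
    linear_combination (-ι R * Polynomial.aeval (xi ι) D1 * (ι X ^ 2) ^ n) * hx
end cmfrac


set_option linter.unusedSectionVars false
section cmdual
variable {K : Type*} [Field K] [CharZero K]
open PowerSeries

/-- the Wronskian-type polynomial -/
noncomputable def Jw {A : Type*} [CommRing A] (a c : Polynomial A) : Polynomial A :=
  a * c + 2 * (Polynomial.X * Polynomial.derivative a * c - a * (Polynomial.X * Polynomial.derivative c))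

theorem d_aeval (q : Polynomial K) : d⁄dX K (Polynomial.aeval ((X : K⟦X⟧) ^ 2) q) =
    Polynomial.aeval ((X : K⟦X⟧) ^ 2) (Polynomial.derivative q) * (2 * X) := by
  rw [Derivation.map_aeval, smul_eq_mul, Derivation.leibniz_pow]
  simp

theorem aeval_X2_inj : Function.Injective (Polynomial.aeval (R := K) ((X : K⟦X⟧) ^ 2)) := by
  rw [injective_iff_map_eq_zero]
  intro q hq
  ext i
  have e : Polynomial.aeval ((X : K⟦X⟧) ^ 2) q = ∑ k ∈ Finset.range (q.natDegree + 1), C (q.coeff k) * X ^ (2 * k) := by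
    rw [Polynomial.aeval_eq_sum_range]
    refine Finset.sum_congr rfl fun k _ => ?_
    rw [← pow_mul, smul_eq_C_mul]
  have := congrArg (coeff (2 * i)) (e.symm.trans hq)
  rw [map_sum, Finset.sum_eq_single i] at this
  · simpa [coeff_X_pow] using this
  · intro b _ hb
    rw [coeff_C_mul, coeff_X_pow, if_neg (by omega), mul_zero]
  · intro hi
    rw [Polynomial.coeff_eq_zero_of_natDegree_lt (by simpa using hi)]; simp

theorem dR_J {R : K⟦X⟧} {a c : Polynomial K} (h : R * Polynomial.aeval ((X : K⟦X⟧) ^ 2) c =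
    X * Polynomial.aeval ((X : K⟦X⟧) ^ 2) a) :
    d⁄dX K R * Polynomial.aeval ((X : K⟦X⟧) ^ 2) c ^ 2 = Polynomial.aeval ((X : K⟦X⟧) ^ 2) (Jw a c) := by
  have hd := congrArg (d⁄dX K) h
  simp only [Derivation.leibniz, smul_eq_mul, d_aeval, derivative_X] at hd
  simp only [Jw, map_add, map_sub, map_mul, Polynomial.aeval_X, map_ofNat]
  linear_combination Polynomial.aeval ((X : K⟦X⟧) ^ 2) c * hd
    - Polynomial.aeval ((X : K⟦X⟧) ^ 2) (Polynomial.derivative c) * 2 * X * h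

theorem reflect_theta (q : Polynomial K) (n : ℕ) (h : q.natDegree ≤ n) :
    Polynomial.X * Polynomial.derivative (Polynomial.reflect n q) =
      Polynomial.reflect n (Polynomial.C (n : K) * q - Polynomial.X * Polynomial.derivative q) := by
  have cx : ∀ (p : Polynomial K) i, (Polynomial.X * Polynomial.derivative p).coeff i = i * p.coeff i := by
    intro p i
    rcases i with _ | i
    · simp
    · rw [Polynomial.coeff_X_mul, Polynomial.coeff_derivative]; push_cast; ring
  ext i
  rw [Polynomial.coeff_reflect, cx, Polynomial.coeff_sub, cx, Polynomial.coeff_C_mul, Polynomial.coeff_reflect]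
  by_cases hi : i ≤ n
  · rw [Polynomial.revAt_le hi, Nat.cast_sub hi]; ring
  · rw [Polynomial.revAt_eq_self_of_lt (by omega), Polynomial.coeff_eq_zero_of_natDegree_lt (by omega)]; ring

theorem theta_deg (q : Polynomial K) (n : ℕ) (h : q.natDegree ≤ n) :
    (Polynomial.X * Polynomial.derivative q).natDegree ≤ n := by
  rw [Polynomial.natDegree_le_iff_coeff_eq_zero] at *
  intro N hN
  rcases N with _ | N
  · omega
  · rw [Polynomial.coeff_X_mul, Polynomial.coeff_derivative, h _ hN, zero_mul]

theorem Jw_reflect (a c : Polynomial K) (n : ℕ) (ha : a.natDegree ≤ n) (hc : c.natDegree ≤ n) :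
    Jw (Polynomial.reflect n c) (Polynomial.reflect n a) = Polynomial.reflect (n + n) (Jw a c) := by
  have hda := theta_deg a n ha
  have hdc := theta_deg c n hc
  unfold Jw
  rw [reflect_theta c n hc, reflect_theta a n ha, show (2 : Polynomial K) = Polynomial.C 2 from (map_ofNat _ 2).symm]
  simp only [Polynomial.reflect_add, Polynomial.reflect_C_mul, Polynomial.reflect_sub]
  rw [Polynomial.reflect_mul _ _ ha hc,
    Polynomial.reflect_mul _ _ hda hc, Polynomial.reflect_mul _ _ ha hdc]
  ring

theorem Jw_deg (a c : Polynomial K) (n : ℕ) (ha : a.natDegree ≤ n) (hc : c.natDegree ≤ n) :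
    (Jw a c).natDegree ≤ n + n := by
  have hda := theta_deg a n ha
  have hdc := theta_deg c n hc
  unfold Jw
  rw [show (2 : Polynomial K) = Polynomial.C 2 from (map_ofNat _ 2).symm]
  refine Polynomial.natDegree_add_le_of_degree_le (Polynomial.natDegree_mul_le_of_le ha hc) ?_
  refine (Polynomial.natDegree_C_mul_le _ _).trans ?_
  exact (Polynomial.natDegree_sub_le _ _).trans (max_le (Polynomial.natDegree_mul_le_of_le hda hc)
    (Polynomial.natDegree_mul_le_of_le ha hdc))

/-- the quartic as a polynomial in the square -/
noncomputable def fP {A : Type*} [CommRing A] (z : A) : Polynomial A :=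
  1 - Polynomial.C (2 * z) * Polynomial.X + Polynomial.X ^ 2

theorem fP_reflect (z : K) : Polynomial.reflect 2 (fP z) = fP z := by
  unfold fP
  have h0 : Polynomial.reflect 2 (1 : Polynomial K) = Polynomial.X ^ 2 := by
    have := Polynomial.reflect_monomial (R := K) 2 0
    simpa using this
  have h1 : Polynomial.reflect 2 (Polynomial.X : Polynomial K) = Polynomial.X := by
    have := Polynomial.reflect_monomial (R := K) 2 1
    rw [Polynomial.revAt_le (by omega)] at this
    simpa using this
  have h2 : Polynomial.reflect 2 (Polynomial.X ^ 2 : Polynomial K) = 1 := by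
    rw [Polynomial.reflect_monomial (R := K) 2 2, Polynomial.revAt_le (by omega)]
    simp
  rw [Polynomial.reflect_add, Polynomial.reflect_sub, Polynomial.reflect_C_mul, h0, h1, h2]
  ring

theorem fP_deg (z : K) : (fP z).natDegree ≤ 2 := by
  unfold fP; compute_degree

/-- the quartic in homogeneous form -/
noncomputable def qH {A : Type*} [CommRing A] (z : A) (a c : Polynomial A) : Polynomial A :=
  c ^ 2 * c ^ 2 * 1 - Polynomial.C (2 * z) * (a ^ 2 * c ^ 2 * Polynomial.X) + a ^ 2 * a ^ 2 * Polynomial.X ^ 2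

theorem qH_reflect (z : K) (a c : Polynomial K) (n : ℕ) (ha : a.natDegree ≤ n) (hc : c.natDegree ≤ n) :
    Polynomial.reflect ((n + n) + (n + n) + 2) (qH z a c) = qH z (Polynomial.reflect n c) (Polynomial.reflect n a) := by
  have h0 : Polynomial.reflect 2 (1 : Polynomial K) = Polynomial.X ^ 2 := by
    have := Polynomial.reflect_monomial (R := K) 2 0
    simpa using this
  have h1 : Polynomial.reflect 2 (Polynomial.X : Polynomial K) = Polynomial.X := by
    have := Polynomial.reflect_monomial (R := K) 2 1
    rw [Polynomial.revAt_le (by omega)] at this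
    simpa using this
  have h2 : Polynomial.reflect 2 (Polynomial.X ^ 2 : Polynomial K) = 1 := by
    rw [Polynomial.reflect_monomial (R := K) 2 2, Polynomial.revAt_le (by omega)]
    simp
  have sa : (a ^ 2).natDegree ≤ n + n := by rw [sq]; exact Polynomial.natDegree_mul_le_of_le ha ha
  have sc : (c ^ 2).natDegree ≤ n + n := by rw [sq]; exact Polynomial.natDegree_mul_le_of_le hc hc
  have ra : Polynomial.reflect (n + n) (a ^ 2) = Polynomial.reflect n a ^ 2 := by
    rw [sq, Polynomial.reflect_mul _ _ ha ha]; ring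
  have rc : Polynomial.reflect (n + n) (c ^ 2) = Polynomial.reflect n c ^ 2 := by
    rw [sq, Polynomial.reflect_mul _ _ hc hc]; ring
  unfold qH
  rw [Polynomial.reflect_add, Polynomial.reflect_sub, Polynomial.reflect_C_mul,
    Polynomial.reflect_mul _ _ (Polynomial.natDegree_mul_le_of_le sc sc) (by simp),
    Polynomial.reflect_mul _ _ (Polynomial.natDegree_mul_le_of_le sa sc) (by simp),
    Polynomial.reflect_mul _ _ (Polynomial.natDegree_mul_le_of_le sa sa) (by simp),
    Polynomial.reflect_mul _ _ sc sc, Polynomial.reflect_mul _ _ sa sc, Polynomial.reflect_mul _ _ sa sa,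
    ra, rc, h0, h1, h2]
  ring

theorem J_ode {r u : K} (hr : r ^ 2 = -7) {R Y : K⟦X⟧} (hS : MulS (3 * r) (ww r) u R Y) {a c : Polynomial K}
    (h : R * Polynomial.aeval ((X : K⟦X⟧) ^ 2) c = X * Polynomial.aeval ((X : K⟦X⟧) ^ 2) a) :
    Jw a c ^ 2 * fP (3 * r) = Polynomial.C u ^ 2 * qH (3 * r) a c := by
  apply aeval_X2_inj
  have e2 : (C (2 * (3 * r)) : K⟦X⟧) = 2 * C (3 * r) := by rw [map_mul, map_ofNat]
  have hf : Polynomial.aeval ((X : K⟦X⟧) ^ 2) (fP (3 * r)) = ff r := by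
    simp only [fP, map_add, map_sub, map_mul Polynomial.C, map_mul, map_one, map_pow, Polynomial.aeval_C,
      Polynomial.aeval_X, aeval_X2_lin, ff, map_ofNat]
    ring
  have hq : Polynomial.aeval ((X : K⟦X⟧) ^ 2) (qH (3 * r) a c) =
      (1 - 2 * C (3 * r) * R ^ 2 + R ^ 4) * Polynomial.aeval ((X : K⟦X⟧) ^ 2) c ^ 4 := by
    simp only [qH, map_add, map_sub, map_mul, map_one, map_pow, Polynomial.aeval_C,
      Polynomial.aeval_X, aeval_X2_lin, ff, map_ofNat]
    generalize Polynomial.aeval ((X : K⟦X⟧) ^ 2) c = cc at *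
    generalize Polynomial.aeval ((X : K⟦X⟧) ^ 2) a = aa at *
    linear_combination (6 * C r * cc ^ 2 * (X * aa + R * cc) - (X ^ 2 * aa ^ 2 + R ^ 2 * cc ^ 2) * (X * aa + R * cc)) * h
  rw [map_mul, map_mul, map_pow, map_pow, ← dR_J h, hf, hq, Polynomial.aeval_C, aeval_X2_lin, hS.dr, ← hS.sq]
  linear_combination C u ^ 2 * Y ^ 2 * Polynomial.aeval ((X : K⟦X⟧) ^ 2) c ^ 4 * ww_sq r hr

theorem J_ode_conv {r u : K} (hr : r ^ 2 = -7) {R : K⟦X⟧} {a c : Polynomial K} (hc : c ≠ 0)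
    (h : R * Polynomial.aeval ((X : K⟦X⟧) ^ 2) c = X * Polynomial.aeval ((X : K⟦X⟧) ^ 2) a)
    (hJ : Jw a c ^ 2 * fP (3 * r) = Polynomial.C u ^ 2 * qH (3 * r) a c) :
    (d⁄dX K R) ^ 2 * yy r ^ 2 = C u ^ 2 * (1 - 2 * C (3 * r) * R ^ 2 + R ^ 4) := by
  have hJ := congrArg (Polynomial.aeval ((X : K⟦X⟧) ^ 2)) hJ
  have hf : Polynomial.aeval ((X : K⟦X⟧) ^ 2) (fP (3 * r)) = ff r := by
    simp only [fP, map_add, map_sub, map_mul Polynomial.C, map_mul, map_one, map_pow, Polynomial.aeval_C,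
      Polynomial.aeval_X, aeval_X2_lin, ff, map_ofNat]
    ring
  have hq : Polynomial.aeval ((X : K⟦X⟧) ^ 2) (qH (3 * r) a c) =
      (1 - 2 * C (3 * r) * R ^ 2 + R ^ 4) * Polynomial.aeval ((X : K⟦X⟧) ^ 2) c ^ 4 := by
    simp only [qH, map_add, map_sub, map_mul, map_one, map_pow, Polynomial.aeval_C,
      Polynomial.aeval_X, aeval_X2_lin, ff, map_ofNat]
    generalize Polynomial.aeval ((X : K⟦X⟧) ^ 2) c = cc at *
    generalize Polynomial.aeval ((X : K⟦X⟧) ^ 2) a = aa at *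
    linear_combination (6 * C r * cc ^ 2 * (X * aa + R * cc) - (X ^ 2 * aa ^ 2 + R ^ 2 * cc ^ 2) * (X * aa + R * cc)) * h
  rw [map_mul, map_mul, map_pow, map_pow, ← dR_J h, hf, hq, Polynomial.aeval_C, aeval_X2_lin] at hJ
  have hc' : Polynomial.aeval ((X : K⟦X⟧) ^ 2) c ≠ 0 := by
    rw [Ne, map_eq_zero_iff _ aeval_X2_inj]; exact hc
  apply mul_right_cancel₀ (pow_ne_zero 4 hc')
  rw [yy_sq r hr]
  linear_combination hJ

theorem self_dual {r : K} (hr : r ^ 2 = -7) {x y : ℤ} {n : ℕ}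
    (h : x ^ 2 + 7 * y ^ 2 = 2 * n + 1) (hα : (x + y * r : K) ≠ 0) :
    ∃ R Y, MulS (3 * r) (ww r) (x + y * r) R Y ∧ ∃ (c : Polynomial K) (η : K), (η ^ 2 = 1 ∨ η ^ 2 = -1) ∧
      c.natDegree ≤ n ∧ c.coeff 0 ≠ 0 ∧ R * Polynomial.aeval ((X : K⟦X⟧) ^ 2) c =
        X * Polynomial.aeval ((X : K⟦X⟧) ^ 2) (Polynomial.C η * Polynomial.reflect n c) := by
  obtain ⟨R, Y, hS, D, N, hDN, hD, hD0, hN, hN0, hR⟩ := cm_frac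
    (ι := IsScalarTower.toAlgHom K K⟦X⟧ (FractionRing K⟦X⟧)) (IsFractionRing.injective _ _) hr h hα
  refine ⟨R, Y, hS, ?_⟩
  have hNne : N ≠ 0 := by rintro rfl; simp at hN0
  have hrD : (Polynomial.reflect n D).natDegree ≤ n := Polynomial.natDegree_reflect_le.trans (by simp [hD])
  have hrN : (Polynomial.reflect n N).natDegree ≤ n := Polynomial.natDegree_reflect_le.trans (by simp [hN])
  have hJ := J_ode hr hS hR
  have hJ2 := congrArg (Polynomial.reflect ((n + n) + (n + n) + 2)) hJ
  rw [← map_pow, Polynomial.reflect_C_mul, qH_reflect _ _ _ n hrN hrD, sq (Jw _ _),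
    Polynomial.reflect_mul _ _ (Polynomial.natDegree_mul_le_of_le (Jw_deg _ _ n hrN hrD) (Jw_deg _ _ n hrN hrD)) (fP_deg _),
    Polynomial.reflect_mul _ _ (Jw_deg _ _ n hrN hrD) (Jw_deg _ _ n hrN hrD), ← Jw_reflect _ _ n hrN hrD, fP_reflect,
    Polynomial.reflect_reflect, Polynomial.reflect_reflect, map_pow, ← sq] at hJ2
  have hNc : constantCoeff (Polynomial.aeval ((X : K⟦X⟧) ^ 2) N) ≠ 0 := by rwa [aeval_X2_cc]
  obtain ⟨V, hV⟩ : ∃ V : K⟦X⟧, V = X * Polynomial.aeval ((X : K⟦X⟧) ^ 2) D * (Polynomial.aeval ((X : K⟦X⟧) ^ 2) N)⁻¹ :=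
    ⟨_, rfl⟩
  have hVN : V * Polynomial.aeval ((X : K⟦X⟧) ^ 2) N = X * Polynomial.aeval ((X : K⟦X⟧) ^ 2) D := by
    rw [hV, mul_assoc, PowerSeries.inv_mul_cancel _ hNc, mul_one]
  have hode := J_ode_conv hr hNne hVN hJ2
  have v0 : constantCoeff V = 0 := by rw [hV]; simp
  have v1 : coeff 1 V ^ 2 = (x + y * r : K) ^ 2 := by
    have h1 := congrArg constantCoeff hode
    have h2 : constantCoeff (d⁄dX K V) = coeff 1 V := by
      rw [← coeff_zero_eq_constantCoeff_apply, coeff_derivative]; simp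
    simp only [map_mul, map_pow, h2, yy_cc, map_sub, map_add, map_one, v0, constantCoeff_C] at h1
    simpa using h1
  have hpm := hS.pm hα (yy_ww r hr) (ww_cc r) v0 v1 hode
  obtain ⟨e, he, hVe⟩ : ∃ e : K, (e = 1 ∨ e = -1) ∧ V = C e * R := by
    rcases hpm with h | h
    · exact ⟨1, Or.inl rfl, by rw [h]; simp⟩
    · exact ⟨-1, Or.inr rfl, by rw [h]; simp⟩
  have key : Polynomial.C e * (N * Polynomial.reflect n N) = D * Polynomial.reflect n D := by
    apply aeval_X2_inj
    apply mul_left_cancel₀ (X_ne_zero (R := K))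
    rw [map_mul, map_mul, map_mul, Polynomial.aeval_C, aeval_X2_lin]
    rw [hVe] at hVN
    linear_combination Polynomial.aeval ((X : K⟦X⟧) ^ 2) (Polynomial.reflect n D) * hVN - C e *
      Polynomial.aeval ((X : K⟦X⟧) ^ 2) N * hR
  have he0 : e ≠ 0 := by rcases he with rfl | rfl <;> norm_num
  have hdv : D ∣ Polynomial.reflect n N := by
    have : D ∣ Polynomial.C e * (N * Polynomial.reflect n N) := ⟨_, key⟩
    have hu : IsUnit (Polynomial.C e) := Polynomial.isUnit_C.2 he0.isUnit
    exact hDN.dvd_of_dvd_mul_left (hu.dvd_mul_left.1 this)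
  obtain ⟨k, hk⟩ := hdv
  have hrNne : Polynomial.reflect n N ≠ 0 := by simpa using hNne
  have hk0 : k ≠ 0 := by rintro rfl; rw [mul_zero] at hk; exact hrNne hk
  have hkd : k.natDegree = 0 := by
    have := congrArg Polynomial.natDegree hk
    rw [Polynomial.natDegree_mul hD0 hk0] at this
    omega
  rw [Polynomial.natDegree_eq_zero] at hkd
  obtain ⟨η, rfl⟩ := hkd
  have hrD2 : Polynomial.reflect n (Polynomial.reflect n D) = D := Polynomial.reflect_reflect
  have hNe : N = Polynomial.C η * Polynomial.reflect n D := by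
    have : Polynomial.reflect n (Polynomial.reflect n N) = N := Polynomial.reflect_reflect
    rw [← this, hk, mul_comm, Polynomial.reflect_C_mul]
  refine ⟨Polynomial.reflect n D, η, ?_, hrD, ?_, ?_⟩
  · rw [hNe, Polynomial.reflect_C_mul, hrD2] at key
    have h1 : Polynomial.C (e * η ^ 2) * (D * Polynomial.reflect n D) = 1 * (D * Polynomial.reflect n D) := by
      rw [one_mul]; nth_rw 2 [← key]; rw [map_mul, map_pow]; ring
    have h2 := mul_right_cancel₀ (mul_ne_zero hD0 (by simpa using hD0)) h1
    rw [← map_one Polynomial.C] at h2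
    have h3 := Polynomial.C_injective h2
    rcases he with rfl | rfl
    · left; linear_combination h3
    · right; linear_combination -h3
  · rw [Polynomial.coeff_reflect, Polynomial.revAt_le (by omega), Nat.sub_zero, ← hD]
    simpa using hD0
  · rw [hR, hrD2, hk, mul_comm D]
end cmdual


set_option linter.unusedSectionVars false
section cmint
variable {p : ℕ} [hp : Fact p.Prime]

theorem Jw_map {A B : Type*} [CommRing A] [CommRing B] (f : A →+* B) (a c : Polynomial A) :
    (Jw a c).map f = Jw (a.map f) (c.map f) := by
  simp [Jw, Polynomial.derivative_map]

theorem fP_map {A B : Type*} [CommRing A] [CommRing B] (f : A →+* B) (z : A) :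
    (fP z).map f = fP (f z) := by
  simp [fP, map_ofNat f]

theorem qH_map {A B : Type*} [CommRing A] [CommRing B] (f : A →+* B) (z : A) (a c : Polynomial A) :
    (qH z a c).map f = qH (f z) (a.map f) (c.map f) := by
  simp [qH, map_ofNat f]

theorem fP_ne {A : Type*} [CommRing A] [Nontrivial A] (z : A) : fP z ≠ 0 := by
  intro h
  have := congrArg (fun q => Polynomial.coeff q 0) h
  simp [fP] at this

theorem prim_exists (c : Polynomial ℚ_[p]) (hc : c ≠ 0) : ∃ (s : ℚ_[p]) (C0 : Polynomial ℤ_[p]), s ≠ 0 ∧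
    C0.map (algebraMap ℤ_[p] ℚ_[p]) = Polynomial.C s * c ∧ C0.map (PadicInt.toZMod (p := p)) ≠ 0 := by
  obtain ⟨i, hi, hm⟩ := Finset.exists_max_image c.support (fun i => ‖c.coeff i‖)
    (Polynomial.support_nonempty.2 hc)
  have hi0 : c.coeff i ≠ 0 := Polynomial.mem_support_iff.1 hi
  have hl : Polynomial.C (c.coeff i)⁻¹ * c ∈ Polynomial.lifts (algebraMap ℤ_[p] ℚ_[p]) := by
    rw [Polynomial.lifts_iff_coeff_lifts]
    intro k
    have : ‖(c.coeff i)⁻¹ * c.coeff k‖ ≤ 1 := by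
      rw [norm_mul, norm_inv, inv_mul_le_iff₀ (norm_pos_iff.2 hi0), mul_one]
      by_cases hk : c.coeff k = 0
      · rw [hk]; simp
      · exact hm k (Polynomial.mem_support_iff.2 hk)
    exact ⟨⟨_, this⟩, by rw [Polynomial.coeff_C_mul]; rfl⟩
  obtain ⟨C0, h0⟩ := (Polynomial.mem_lifts _).1 hl
  refine ⟨_, C0, inv_ne_zero hi0, h0, ?_⟩
  intro h
  have h1 := congrArg (fun q => Polynomial.coeff q i) h0
  simp only [Polynomial.coeff_map, Polynomial.coeff_C_mul, inv_mul_cancel₀ hi0] at h1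
  have h2 : C0.coeff i = 1 := by
    apply PadicInt.ext
    exact h1
  have h3 := congrArg (fun q => Polynomial.coeff q i) h
  simp only [Polynomial.coeff_map, h2] at h3
  simp at h3

theorem coeff_theta {A : Type*} [CommRing A] (q : Polynomial A) (i : ℕ) :
    (Polynomial.X * Polynomial.derivative q).coeff i = i * q.coeff i := by
  rcases i with _ | i
  · simp
  · rw [Polynomial.coeff_X_mul, Polynomial.coeff_derivative]; push_cast; ring

theorem coeff_low {A : Type*} [CommRing A] (a c : Polynomial A) (i j : ℕ) (ha : ∀ k < i, a.coeff k = 0)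
    (hc : ∀ k < j, c.coeff k = 0) : (a * c).coeff (i + j) = a.coeff i * c.coeff j := by
  rw [Polynomial.coeff_mul, Finset.sum_eq_single (i, j)]
  · rintro ⟨k, l⟩ h1 h2
    rw [Finset.HasAntidiagonal.mem_antidiagonal] at h1
    by_cases hk : k < i
    · rw [ha k hk, zero_mul]
    · by_cases hl : l < j
      · rw [hc l hl, mul_zero]
      · exfalso; apply h2; simp only at h1; ext <;> simp <;> omega
  · intro h; simp at h

theorem Jw_zero {n : ℕ} (hn : p = 2 * n + 1) (c : Polynomial (ZMod p)) (hc : c ≠ 0) (hd : c.natDegree ≤ n)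
    (η : ZMod p) (hη : η ≠ 0) (h : Jw (Polynomial.C η * Polynomial.reflect n c) c = 0) :
    ∀ i, 0 < i → c.coeff i = 0 := by
  set a := Polynomial.C η * Polynomial.reflect n c with ha
  have ha0 : a ≠ 0 := by
    rw [ha]; apply mul_ne_zero
    · simpa using hη
    · simpa using hc
  have had : a.natDegree ≤ n := by
    refine (Polynomial.natDegree_C_mul_le _ _).trans ?_
    exact Polynomial.natDegree_reflect_le.trans (by simp [hd])
  obtain ⟨i, hi⟩ : ∃ i, i = c.natTrailingDegree := ⟨_, rfl⟩
  obtain ⟨j, hj⟩ : ∃ j, j = a.natTrailingDegree := ⟨_, rfl⟩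
  have hi' : i ≤ n := by rw [hi]; exact (Polynomial.natTrailingDegree_le_natDegree _).trans hd
  have hj' : j ≤ n := by rw [hj]; exact (Polynomial.natTrailingDegree_le_natDegree _).trans had
  have lc : ∀ k < i, c.coeff k = 0 := fun k hk => Polynomial.coeff_eq_zero_of_lt_natTrailingDegree (hi ▸ hk)
  have la : ∀ k < j, a.coeff k = 0 := fun k hk => Polynomial.coeff_eq_zero_of_lt_natTrailingDegree (hj ▸ hk)
  have ci : c.coeff i ≠ 0 := by
    rw [hi]; exact Polynomial.trailingCoeff_nonzero_iff_nonzero.2 hc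
  have aj : a.coeff j ≠ 0 := by
    rw [hj]; exact Polynomial.trailingCoeff_nonzero_iff_nonzero.2 ha0
  have h1 := congrArg (fun q => Polynomial.coeff q (j + i)) h
  simp only [Jw] at h1
  rw [show (2 : Polynomial (ZMod p)) = Polynomial.C 2 from (map_ofNat _ 2).symm, Polynomial.coeff_add,
    Polynomial.coeff_C_mul, Polynomial.coeff_sub, coeff_low a c j i la lc,
    coeff_low _ c j i (fun k hk => by rw [coeff_theta, la k hk, mul_zero]) lc,
    coeff_low a _ j i la (fun k hk => by rw [coeff_theta, lc k hk, mul_zero]), coeff_theta, coeff_theta] at h1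
  have h2 : (((2 * ((j : ℤ) - i) + 1 : ℤ)) : ZMod p) * (a.coeff j * c.coeff i) = 0 := by
    push_cast
    rw [Polynomial.coeff_zero] at h1
    linear_combination h1
  have h3 := (mul_eq_zero.1 h2).resolve_right (mul_ne_zero aj ci)
  rw [ZMod.intCast_zmod_eq_zero_iff_dvd] at h3
  obtain ⟨k, hk⟩ := h3
  have hpz : (p : ℤ) = 2 * n + 1 := by exact_mod_cast hn
  have hk1 : k = 1 := by
    have u1 : k < 2 := by
      by_contra hh
      have : (p : ℤ) * 2 ≤ p * k := by gcongr; omega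
      omega
    have u2 : -1 < k := by
      by_contra hh
      have : (p : ℤ) * k ≤ p * (-1) := by gcongr; omega
      omega
    rcases (by omega : k = 0 ∨ k = 1) with rfl | rfl
    · omega
    · rfl
  subst hk1
  have hjn : j = n := by omega
  intro m hm
  by_cases hmn : m ≤ n
  · have := la (n - m) (by omega)
    rw [ha, Polynomial.coeff_C_mul, Polynomial.coeff_reflect, Polynomial.revAt_le (by omega),
      show n - (n - m) = m by omega] at this
    exact (mul_eq_zero.1 this).resolve_left hη
  · exact Polynomial.coeff_eq_zero_of_natDegree_lt (by omega)

theorem toZMod_zero_of_dvd {a : ℤ_[p]} : PadicInt.toZMod a = 0 ↔ (p : ℤ_[p]) ∣ a := by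
  rw [← RingHom.mem_ker, PadicInt.ker_toZMod, PadicInt.maximalIdeal_eq_span_p, Ideal.mem_span_singleton]

end cmint


set_option linter.unusedSectionVars false
section cmint2
variable {p : ℕ} [hp : Fact p.Prime]
open PowerSeries

theorem alg_inj : Function.Injective (algebraMap ℤ_[p] ℚ_[p]) := by
  intro a b h
  exact PadicInt.ext h

theorem J_int {r u η : ℤ_[p]} (hr : r ^ 2 = -7) {R Y : ℚ_[p]⟦X⟧} {n : ℕ}
    (hS : MulS (3 * algebraMap ℤ_[p] ℚ_[p] r) (ww (algebraMap ℤ_[p] ℚ_[p] r)) (algebraMap ℤ_[p] ℚ_[p] u) R Y)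
    {c : Polynomial ℤ_[p]}
    (h : R * Polynomial.aeval ((X : ℚ_[p]⟦X⟧) ^ 2) (c.map (algebraMap ℤ_[p] ℚ_[p])) =
      X * Polynomial.aeval ((X : ℚ_[p]⟦X⟧) ^ 2)
        ((Polynomial.C η * Polynomial.reflect n c).map (algebraMap ℤ_[p] ℚ_[p]))) :
    Jw (Polynomial.C η * Polynomial.reflect n c) c ^ 2 * fP (3 * r) =
      Polynomial.C u ^ 2 * qH (3 * r) (Polynomial.C η * Polynomial.reflect n c) c := by
  have hr' : (algebraMap ℤ_[p] ℚ_[p] r) ^ 2 = -7 := by rw [← map_pow, hr, map_neg, map_ofNat]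
  have hJ := J_ode hr' hS h
  apply Polynomial.map_injective _ (alg_inj (p := p))
  rw [Polynomial.map_mul, Polynomial.map_pow, Jw_map, fP_map, Polynomial.map_mul (p := Polynomial.C u ^ 2), Polynomial.map_pow, qH_map,
    Polynomial.map_C, map_mul, map_ofNat]
  exact hJ

theorem cm_int {r : ℤ_[p]} (hr : r ^ 2 = -7) {x y : ℤ} {n : ℕ} (hn : p = 2 * n + 1)
    (h : x ^ 2 + 7 * y ^ 2 = p) (hα : (p : ℤ_[p]) ∣ (x + y * r)) :
    ∃ R Y, MulS (3 * algebraMap ℤ_[p] ℚ_[p] r) (ww (algebraMap ℤ_[p] ℚ_[p] r)) (algebraMap ℤ_[p] ℚ_[p] (x + y * r)) R Y ∧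
      ∃ (c : Polynomial ℤ_[p]) (η : ℤ_[p]), (η ^ 2 = 1 ∨ η ^ 2 = -1) ∧ c.natDegree ≤ n ∧ c.coeff 0 = 1 ∧
        (∀ i, 0 < i → (p : ℤ_[p]) ∣ c.coeff i) ∧
        R * Polynomial.aeval ((X : ℚ_[p]⟦X⟧) ^ 2) (c.map (algebraMap ℤ_[p] ℚ_[p])) =
          X * Polynomial.aeval ((X : ℚ_[p]⟦X⟧) ^ 2)
            ((Polynomial.C η * Polynomial.reflect n c).map (algebraMap ℤ_[p] ℚ_[p])) := by
  have hr' : (algebraMap ℤ_[p] ℚ_[p] r) ^ 2 = -7 := by rw [← map_pow, hr, map_neg, map_ofNat]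
  have hαα : ((x : ℤ_[p]) + y * r) * (x - y * r) = p := by
    have : ((x : ℤ_[p]) ^ 2 + 7 * y ^ 2) = p := by exact_mod_cast congrArg (Int.cast (R := ℤ_[p])) h
    linear_combination this - (y : ℤ_[p]) ^ 2 * hr
  have hp0 : (p : ℤ_[p]) ≠ 0 := by exact_mod_cast hp.1.ne_zero
  have hα0 : ((x : ℤ_[p]) + y * r) ≠ 0 := by intro h0; rw [h0, zero_mul] at hαα; exact hp0 hαα.symm
  have hαe : algebraMap ℤ_[p] ℚ_[p] (x + y * r) = x + y * algebraMap ℤ_[p] ℚ_[p] r := by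
    rw [map_add, map_mul, map_intCast, map_intCast]
  obtain ⟨R, Y, hS, c, η, hη, hcd, hc0, hR⟩ := self_dual (x := x) (y := y) (n := n) hr'
    (by rw [h]; exact_mod_cast hn) (by rw [← hαe]; exact fun h => hα0 (alg_inj (h.trans (map_zero _).symm)))
  rw [← hαe] at hS
  have hηn : ‖η‖ ≤ 1 := by
    have : ‖η‖ ^ 2 = 1 := by
      rw [← norm_pow]
      rcases hη with h | h <;> rw [h] <;> simp
    nlinarith [norm_nonneg η]
  obtain ⟨η, rfl⟩ : ∃ η' : ℤ_[p], algebraMap ℤ_[p] ℚ_[p] η' = η := ⟨⟨η, hηn⟩, rfl⟩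
  have hη' : η ^ 2 = 1 ∨ η ^ 2 = -1 := by
    rcases hη with h | h
    · left; apply alg_inj; rw [map_pow, h, map_one]
    · right; apply alg_inj; rw [map_pow, h, map_neg, map_one]
  have hcne : c ≠ 0 := by rintro rfl; simp at hc0
  obtain ⟨s, C0, hs, hC0, hprim⟩ := prim_exists c hcne
  have hC0d : C0.natDegree ≤ n := by
    rw [← Polynomial.natDegree_map_eq_of_injective (alg_inj (p := p)), hC0]
    exact (Polynomial.natDegree_C_mul_le _ _).trans hcd
  have hR0 : R * Polynomial.aeval ((X : ℚ_[p]⟦X⟧) ^ 2) (C0.map (algebraMap ℤ_[p] ℚ_[p])) =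
      X * Polynomial.aeval ((X : ℚ_[p]⟦X⟧) ^ 2)
        ((Polynomial.C η * Polynomial.reflect n C0).map (algebraMap ℤ_[p] ℚ_[p])) := by
    rw [Polynomial.map_mul, Polynomial.map_C, ← Polynomial.reflect_map, hC0, Polynomial.reflect_C_mul]
    simp only [map_mul] at hR ⊢
    linear_combination Polynomial.aeval ((X : ℚ_[p]⟦X⟧) ^ 2) (Polynomial.C s) * hR
  have hJ := congrArg (Polynomial.map (PadicInt.toZMod (p := p))) (J_int hr hS hR0)
  rw [Polynomial.map_mul, Polynomial.map_mul, Polynomial.map_pow, Polynomial.map_pow, Polynomial.map_C,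
    toZMod_zero_of_dvd.2 hα, Jw_map, fP_map, Polynomial.map_mul, Polynomial.map_C, ← Polynomial.reflect_map] at hJ
  simp only [map_zero, ne_eq, OfNat.ofNat_ne_zero, not_false_eq_true, zero_pow, zero_mul] at hJ
  have hJ0 := pow_eq_zero_iff (two_ne_zero) |>.1 ((mul_eq_zero.1 hJ).resolve_right (fP_ne _))
  have hη0 : PadicInt.toZMod η ≠ 0 := by
    intro h0
    have : (PadicInt.toZMod η) ^ 2 ≠ 0 := by
      rw [← map_pow]
      rcases hη' with h | h <;> rw [h] <;> simp
    rw [h0] at this; simp at this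
  have hcz := Jw_zero hn _ hprim (Polynomial.natDegree_map_le.trans hC0d) _ hη0 hJ0
  have h00 : PadicInt.toZMod (C0.coeff 0) ≠ 0 := by
    intro h0
    apply hprim
    ext i
    rcases i with _ | i
    · rw [Polynomial.coeff_map, h0]; simp
    · rw [hcz _ (by omega)]; simp
  have hu : IsUnit (C0.coeff 0) := by
    by_contra hh
    apply h00
    rw [← RingHom.mem_ker, PadicInt.ker_toZMod]
    exact (IsLocalRing.mem_maximalIdeal _).2 hh
  obtain ⟨v, hv⟩ := hu.exists_left_inv
  refine ⟨R, Y, hS, Polynomial.C v * C0, η, hη', (Polynomial.natDegree_C_mul_le _ _).trans hC0d, ?_, ?_, ?_⟩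
  · rw [Polynomial.coeff_C_mul, hv]
  · intro i hi
    rw [Polynomial.coeff_C_mul]
    apply Dvd.dvd.mul_left
    rw [← toZMod_zero_of_dvd, ← Polynomial.coeff_map, hcz i hi]
  · rw [Polynomial.reflect_C_mul]
    simp only [Polynomial.map_mul, map_mul] at hR0 ⊢
    linear_combination Polynomial.aeval ((X : ℚ_[p]⟦X⟧) ^ 2) (Polynomial.map (algebraMap ℤ_[p] ℚ_[p]) (Polynomial.C v)) * hR0

end cmint2


set_option linter.unusedSectionVars false
section cmsign
variable {p : ℕ} [hp : Fact p.Prime]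
open Polynomial

theorem reflect_one' {A : Type*} [CommRing A] (n : ℕ) : reflect n (1 : A[X]) = X ^ n := by
  have := reflect_monomial (R := A) n 0
  simpa using this

theorem theta_X_pow {A : Type*} [CommRing A] (n : ℕ) :
    X * derivative (X ^ n : A[X]) = (n : A[X]) * X ^ n := by
  rcases n with _ | n
  · simp
  · rw [derivative_X_pow]; simp; ring

theorem one_add_p {c : ℤ_[p][X]} (h0 : c.coeff 0 = 1) (h : ∀ i, 0 < i → (p : ℤ_[p]) ∣ c.coeff i) :
    ∃ e : ℤ_[p][X], c = 1 + C (p : ℤ_[p]) * e := by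
  have : C (p : ℤ_[p]) ∣ c - 1 := by
    rw [C_dvd_iff_dvd_coeff]
    intro i
    rcases i with _ | i
    · simp [h0]
    · rw [coeff_sub, coeff_one, if_neg (by omega), sub_zero]; exact h _ (by omega)
  obtain ⟨e, he⟩ := this
  exact ⟨e, by linear_combination he⟩

theorem J_div {n : ℕ} (hn : p = 2 * n + 1) (η : ℤ_[p]) (e : ℤ_[p][X]) :
    ∃ j : ℤ_[p][X], Jw (C η * reflect n (1 + C (p : ℤ_[p]) * e)) (1 + C (p : ℤ_[p]) * e) =
      C η * C (p : ℤ_[p]) * j := by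
  have hn' : (p : ℤ_[p][X]) = 2 * n + 1 := by exact_mod_cast congrArg (Nat.cast (R := ℤ_[p][X])) hn
  have hC : C (p : ℤ_[p]) = (p : ℤ_[p][X]) := by simp
  have h1 := theta_X_pow (A := ℤ_[p]) n
  set e' := reflect n e
  refine ⟨X ^ n + (X ^ n * e + e' + (p : ℤ_[p][X]) * e * e') + 2 * ((n : ℤ_[p][X]) * X ^ n * e + X * derivative e' * (1 + (p : ℤ_[p][X]) * e)
    - (X ^ n + (p : ℤ_[p][X]) * e') * (X * derivative e)), ?_⟩
  rw [reflect_add, reflect_one', reflect_C_mul, hC]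
  unfold Jw
  simp only [derivative_mul, derivative_add, derivative_C, derivative_natCast, derivative_one]
  change C η * (X ^ n + (p : ℤ_[p][X]) * e') * (1 + (p : ℤ_[p][X]) * e) + 2 * (X * (0 * (X ^ n + (p : ℤ_[p][X]) * e') + C η * (derivative (X ^ n)
    + (0 * e' + (p : ℤ_[p][X]) * derivative e'))) * (1 + (p : ℤ_[p][X]) * e) - _) = _
  linear_combination (2 * C η * (1 + (p : ℤ_[p][X]) * e)) * h1 - C η * X ^ n * hn'

theorem cop_contra {z s : ZMod p} (hp2 : p ≠ 2) (hz : z ≠ 0) (j : (ZMod p)[X])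
    (h : C s * j ^ 2 * fP z = fP (-z) ^ p) : False := by
  have hz4 : C (4 * z)⁻¹ * C (4 * z) = (1 : (ZMod p)[X]) := by
    rw [← C_mul, inv_mul_cancel₀, C_1]
    refine mul_ne_zero ?_ hz
    have : (2 : ZMod p) ≠ 0 := by
      intro h2
      have : ((2 : ℕ) : ZMod p) = 0 := by exact_mod_cast h2
      rw [ZMod.natCast_eq_zero_iff] at this
      exact hp2 ((Nat.prime_dvd_prime_iff_eq hp.1 Nat.prime_two).1 this)
    have h4 : (4 : ZMod p) = 2 * 2 := by norm_num
    rw [h4]; exact mul_ne_zero this this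
  have hcop : IsCoprime (fP z) (fP (-z)) := by
    refine ⟨1 + C (4 * z)⁻¹ * (X - C (2 * z)), - (C (4 * z)⁻¹ * (X - C (2 * z))), ?_⟩
    unfold fP
    have e1 : C (4 * z) = 2 * C (2 * z) := by rw [show 4 * z = 2 * (2 * z) by ring, C_mul (a := 2) (b := 2 * z), show (C 2 : (ZMod p)[X]) = 2 from map_ofNat _ 2]
    have e2 : C (2 * -z) = - C (2 * z) := by simp
    rw [e1] at hz4
    rw [e2]
    linear_combination (-(X - C (2 * z)) * X) * hz4
  have h1 : fP z ∣ fP (-z) ^ p := ⟨C s * j ^ 2, by rw [← h]; ring⟩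
  have h2 : IsUnit (fP z) := (hcop.pow_right (n := p)).isUnit_of_dvd' dvd_rfl h1
  have h3 : (fP z).natDegree = 2 := by unfold fP; compute_degree!
  have := natDegree_eq_zero_of_isUnit h2
  omega

theorem qH_mono {n : ℕ} (hn : p = 2 * n + 1) (z η : ZMod p) (hη : η ^ 2 = -1) :
    qH z (C η * X ^ n) 1 = fP (-z) ^ p := by
  rw [← ZMod.expand_card]
  unfold qH fP
  have hη' : C η ^ 2 = (-1 : (ZMod p)[X]) := by rw [← C_pow, hη]; simp
  have hX : (X : (ZMod p)[X]) ^ p = (X ^ n) ^ 2 * X := by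
    have : (X : (ZMod p)[X]) ^ p = X ^ (2 * n + 1) := congrArg (fun k => (X : (ZMod p)[X]) ^ k) hn
    rw [this]; ring
  simp only [map_add, map_sub, map_mul, map_pow, expand_X, expand_C, map_one, hX, map_neg]
  linear_combination (- C 2 * C z * X * (X ^ n) ^ 2 + (C η ^ 2 - 1) * (X ^ n) ^ 4 * X ^ 2) * hη'

theorem eta_one {r : ℤ_[p]} (hr : r ^ 2 = -7) (hp2 : p ≠ 2) (hp3 : p ≠ 3) (hp7 : p ≠ 7) {u u' η : ℤ_[p]} {n : ℕ}
    (hn : p = 2 * n + 1) (hu : u * u' = p) {c : ℤ_[p][X]} (hη : η ^ 2 = 1 ∨ η ^ 2 = -1) (h0 : c.coeff 0 = 1)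
    (hc : ∀ i, 0 < i → (p : ℤ_[p]) ∣ c.coeff i)
    (hJ : Jw (C η * reflect n c) c ^ 2 * fP (3 * r) = C u ^ 2 * qH (3 * r) (C η * reflect n c) c) : η ^ 2 = 1 := by
  rcases hη with h | hη
  · exact h
  exfalso
  obtain ⟨e, rfl⟩ := one_add_p h0 hc
  obtain ⟨j, hj⟩ := J_div hn η e
  rw [hj] at hJ
  have hp0 : C (p : ℤ_[p]) ≠ 0 := by
    rw [Ne, C_eq_zero]; exact_mod_cast hp.1.ne_zero
  have hu' : C u * C u' = C (p : ℤ_[p]) := by rw [← C_mul, hu]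
  have h1 : C (-u' ^ 2) * j ^ 2 * fP (3 * r) =
      qH (3 * r) (C η * reflect n (1 + C (p : ℤ_[p]) * e)) (1 + C (p : ℤ_[p]) * e) := by
    apply mul_left_cancel₀ (pow_ne_zero 2 hp0)
    have hη' : C η ^ 2 = (-1 : ℤ_[p][X]) := by rw [← C_pow, hη]; simp
    rw [C_neg, C_pow]
    nth_rw 2 [← hu']
    linear_combination C u' ^ 2 * hJ - C u' ^ 2 * C (p : ℤ_[p]) ^ 2 * j ^ 2 * fP (3 * r) * hη'
  have h2 := congrArg (Polynomial.map (PadicInt.toZMod (p := p))) h1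
  have hpz : PadicInt.toZMod (p : ℤ_[p]) = 0 := by simp
  rw [qH_map, Polynomial.map_mul, Polynomial.map_mul, Polynomial.map_mul, fP_map, reflect_add, reflect_one',
    reflect_C_mul, Polynomial.map_add, Polynomial.map_add, Polynomial.map_mul, Polynomial.map_mul, Polynomial.map_C,
    Polynomial.map_C, Polynomial.map_C, hpz, C_0, zero_mul, zero_mul, add_zero, add_zero, Polynomial.map_one,
    Polynomial.map_pow, Polynomial.map_pow, Polynomial.map_X] at h2
  have hηz : (PadicInt.toZMod η) ^ 2 = -1 := by rw [← map_pow, hη]; simp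
  rw [qH_mono hn _ _ hηz] at h2
  refine cop_contra hp2 ?_ _ h2
  have hr7 : (PadicInt.toZMod r) ^ 2 = -7 := by rw [← map_pow, hr, map_neg, map_ofNat]
  rw [map_mul, map_ofNat]
  have nz : ∀ q : ℕ, q.Prime → p ≠ q → (q : ZMod p) ≠ 0 := by
    intro q hq hne h
    rw [ZMod.natCast_eq_zero_iff] at h
    exact hne ((Nat.prime_dvd_prime_iff_eq hp.1 hq).1 h)
  refine mul_ne_zero (by exact_mod_cast nz 3 Nat.prime_three hp3) ?_
  intro h
  rw [h] at hr7
  exact nz 7 (by norm_num) hp7 (by push_cast; linear_combination hr7)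

end cmsign


set_option linter.unusedSectionVars false
section cmser
variable {p : ℕ} [hp : Fact p.Prime]
open PowerSeries

theorem map_aeval_X2 {A B : Type*} [CommRing A] [CommRing B] (f : A →+* B) (q : Polynomial A) :
    PowerSeries.map f (Polynomial.aeval ((X : A⟦X⟧) ^ 2) q) = Polynomial.aeval ((X : B⟦X⟧) ^ 2) (q.map f) := by
  rw [Polynomial.aeval_def, Polynomial.aeval_def, Polynomial.hom_eval₂, Polynomial.eval₂_map]
  congr 1
  · ext a n
    simp [PowerSeries.algebraMap_apply]
  · simp

theorem aeval_X2_sum {A : Type*} [CommRing A] (q : Polynomial A) (n : ℕ) (h : q.natDegree ≤ n) :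
    Polynomial.aeval ((X : A⟦X⟧) ^ 2) q = ∑ k ∈ Finset.range (n + 1), C (q.coeff k) * X ^ (2 * k) := by
  rw [Polynomial.aeval_eq_sum_range' (n := n + 1) (by omega)]
  refine Finset.sum_congr rfl fun k _ => ?_
  rw [← pow_mul, smul_eq_C_mul]

theorem coeff_aeval_X2 {A : Type*} [CommRing A] (q : Polynomial A) (m : ℕ) :
    coeff (2 * m) (Polynomial.aeval ((X : A⟦X⟧) ^ 2) q) = q.coeff m := by
  rw [aeval_X2_sum q _ le_rfl, map_sum, Finset.sum_eq_single m]
  · simp [coeff_X_pow]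
  · intro b _ hb
    rw [coeff_C_mul, coeff_X_pow, if_neg (by omega), mul_zero]
  · intro hi
    rw [Polynomial.coeff_eq_zero_of_natDegree_lt (by simpa using hi)]; simp

theorem int_series {n : ℕ} (hn : p = 2 * n + 1) (R : ℚ_[p]⟦X⟧) (c : Polynomial ℤ_[p]) (η : ℤ_[p])
    (h0 : c.coeff 0 = 1) (hc : ∀ i, 0 < i → (p : ℤ_[p]) ∣ c.coeff i)
    (h : R * Polynomial.aeval ((X : ℚ_[p]⟦X⟧) ^ 2) (c.map (algebraMap ℤ_[p] ℚ_[p])) =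
      X * Polynomial.aeval ((X : ℚ_[p]⟦X⟧) ^ 2)
        ((Polynomial.C η * Polynomial.reflect n c).map (algebraMap ℤ_[p] ℚ_[p]))) :
    ∃ R' A B : ℤ_[p]⟦X⟧, PowerSeries.map (algebraMap ℤ_[p] ℚ_[p]) R' = R ∧
      R' * Polynomial.aeval ((X : ℤ_[p]⟦X⟧) ^ 2) c =
        X * Polynomial.aeval ((X : ℤ_[p]⟦X⟧) ^ 2) (Polynomial.C η * Polynomial.reflect n c) ∧
      R' = C (p : ℤ_[p]) * (X * A) + X ^ p * B := by
  have hcc : constantCoeff (Polynomial.aeval ((X : ℤ_[p]⟦X⟧) ^ 2) c) = 1 := by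
    rw [← coeff_zero_eq_constantCoeff_apply, ← mul_zero 2, coeff_aeval_X2, h0]
  obtain ⟨I, hI⟩ : ∃ I : ℤ_[p]⟦X⟧, Polynomial.aeval ((X : ℤ_[p]⟦X⟧) ^ 2) c * I = 1 :=
    ⟨_, mul_invOfUnit _ 1 (by rw [hcc]; simp)⟩
  obtain ⟨e, rfl⟩ := one_add_p h0 hc
  set ce := (1 + Polynomial.C (p : ℤ_[p]) * e) with hce
  refine ⟨X * Polynomial.aeval ((X : ℤ_[p]⟦X⟧) ^ 2) (Polynomial.C η * Polynomial.reflect n ce) * I,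
    C η * Polynomial.aeval ((X : ℤ_[p]⟦X⟧) ^ 2) (Polynomial.reflect n e) * I, C η * I, ?_, ?_, ?_⟩
  · have hne : PowerSeries.map (algebraMap ℤ_[p] ℚ_[p]) (Polynomial.aeval ((X : ℤ_[p]⟦X⟧) ^ 2) ce) ≠ 0 := by
      intro hh
      have := congrArg constantCoeff hh
      rw [← coeff_zero_eq_constantCoeff_apply, coeff_map, coeff_zero_eq_constantCoeff_apply, hcc] at this
      simp at this
    apply mul_right_cancel₀ hne
    rw [map_aeval_X2 _ ce, h, ← map_aeval_X2, ← map_aeval_X2, ← map_mul, mul_assoc, mul_comm I, hI, mul_one, map_mul,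
      PowerSeries.map_X]
  · rw [mul_assoc, mul_comm I, hI, mul_one]
  · rw [hce, Polynomial.reflect_add, reflect_one', Polynomial.reflect_C_mul]
    simp only [map_mul, map_add, map_pow, Polynomial.aeval_C, Polynomial.aeval_X, PowerSeries.algebraMap_apply,
      Algebra.algebraMap_self, RingHom.id_apply]
    have hX : (X : ℤ_[p]⟦X⟧) ^ p = (X ^ 2) ^ n * X := by
      have : (X : ℤ_[p]⟦X⟧) ^ p = X ^ (2 * n + 1) := congrArg (fun k => (X : ℤ_[p]⟦X⟧) ^ k) hn
      rw [this]; ring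
    rw [hX]
    ring

theorem ser_one {R A B : ℤ_[p]⟦X⟧} (h : R = C (p : ℤ_[p]) * (X * A) + X ^ p * B) (m : ℕ) (hm : m < p) :
    (p : ℤ_[p]) ∣ coeff m R := by
  rw [h, map_add, coeff_C_mul, coeff_X_pow_mul', if_neg (by omega), add_zero]
  exact dvd_mul_right _ _

theorem ser_three {R A B : ℤ_[p]⟦X⟧} (h : R = C (p : ℤ_[p]) * (X * A) + X ^ p * B) (k m : ℕ) (hk : 1 ≤ k) (hm : m ≤ p) :
    (p : ℤ_[p]) ^ 3 ∣ coeff m (R ^ (2 * k + 1)) := by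
  obtain ⟨k, rfl⟩ : ∃ l, k = l + 1 := ⟨k - 1, by omega⟩
  obtain ⟨q, hq⟩ : ∃ q, p = q + 1 := ⟨p - 1, by have := hp.1.pos; omega⟩
  have hX : (X : ℤ_[p]⟦X⟧) ^ p = X ^ q * X := by
    have : (X : ℤ_[p]⟦X⟧) ^ p = X ^ (q + 1) := congrArg (fun k => (X : ℤ_[p]⟦X⟧) ^ k) hq
    rw [this, pow_succ]
  have e : R ^ (2 * (k + 1) + 1) = C ((p : ℤ_[p]) ^ 3) * ((X * A) ^ 3 * R ^ (2 * k)) + X ^ (p + 1) *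
      ((3 * C (p : ℤ_[p]) ^ 2 * X * A ^ 2 * B + 3 * C (p : ℤ_[p]) * A * X ^ p * B ^ 2 + X ^ q * X ^ p * B ^ 3) * R ^ (2 * k)) := by
    have : R ^ (2 * (k + 1) + 1) = R ^ 3 * R ^ (2 * k) := by ring
    rw [this]
    nth_rw 1 [h]
    rw [map_pow, pow_succ X p, hX]
    ring
  rw [e, map_add, coeff_C_mul, coeff_X_pow_mul', if_neg (by omega), add_zero]
  exact dvd_mul_right _ _

theorem ser_conv {n : ℕ} {R : ℤ_[p]⟦X⟧} {c : Polynomial ℤ_[p]} {η : ℤ_[p]} (hd : c.natDegree ≤ n)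
    (h : R * Polynomial.aeval ((X : ℤ_[p]⟦X⟧) ^ 2) c =
        X * Polynomial.aeval ((X : ℤ_[p]⟦X⟧) ^ 2) (Polynomial.C η * Polynomial.reflect n c)) (m : ℕ) (hm : m ≤ n) :
    ∑ j ∈ Finset.range (m + 1), c.coeff (m - j) * coeff (2 * j + 1) R = η * c.coeff (n - m) := by
  have h1 := congrArg (coeff (2 * m + 1)) h
  rw [coeff_succ_X_mul, coeff_aeval_X2, Polynomial.coeff_C_mul, Polynomial.coeff_reflect, Polynomial.revAt_le hm,
    aeval_X2_sum c n hd, Finset.mul_sum, map_sum] at h1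
  rw [← h1, ← Finset.sum_range_reflect, ← Finset.sum_subset (Finset.range_subset_range.2 (show m + 1 ≤ n + 1 by omega))]
  · refine Finset.sum_congr rfl fun j hj => ?_
    have hj : j < m + 1 := Finset.mem_range.1 hj
    rw [mul_left_comm, coeff_C_mul, coeff_mul_X_pow', if_pos (by omega)]
    rw [show m - (m + 1 - 1 - j) = j by omega, show 2 * (m + 1 - 1 - j) + 1 = 2 * m + 1 - 2 * j by omega]
  · intro j _ hj
    have hj : ¬ j < m + 1 := fun h => hj (Finset.mem_range.2 h)
    rw [mul_left_comm, coeff_C_mul, coeff_mul_X_pow', if_neg (by omega), mul_zero]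

theorem ser_p {n : ℕ} (hn : p = 2 * n + 1) {R A B : ℤ_[p]⟦X⟧} {c : Polynomial ℤ_[p]} {η : ℤ_[p]} (hd : c.natDegree ≤ n)
    (hη : η ^ 2 = 1)
    (h0 : c.coeff 0 = 1) (hc : ∀ i, 0 < i → (p : ℤ_[p]) ∣ c.coeff i)
    (h : R * Polynomial.aeval ((X : ℤ_[p]⟦X⟧) ^ 2) c =
        X * Polynomial.aeval ((X : ℤ_[p]⟦X⟧) ^ 2) (Polynomial.C η * Polynomial.reflect n c))
    (hR : R = C (p : ℤ_[p]) * (X * A) + X ^ p * B) :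
    (p : ℤ_[p]) ^ 3 ∣ coeff (2 * n + 1) R - η * (1 - ∑ j ∈ Finset.range n, coeff (2 * j + 1) R ^ 2) := by
  have h1 : ∀ m, m < n → (p : ℤ_[p]) ^ 2 ∣ η * c.coeff (n - m) - coeff (2 * m + 1) R := by
    intro m hm
    rw [← ser_conv hd h m hm.le, Finset.sum_range_succ, Nat.sub_self, h0, one_mul, add_sub_cancel_right]
    apply Finset.dvd_sum
    intro j hj
    have hj : j < m := Finset.mem_range.1 hj
    rw [sq]
    exact mul_dvd_mul (hc _ (by omega)) (ser_one hR _ (by omega))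
  have h2 := ser_conv hd h n le_rfl
  rw [Finset.sum_range_succ, Nat.sub_self, h0, one_mul, mul_one] at h2
  have e : coeff (2 * n + 1) R - η * (1 - ∑ j ∈ Finset.range n, coeff (2 * j + 1) R ^ 2) =
      - ∑ j ∈ Finset.range n, η * ((η * c.coeff (n - j) - coeff (2 * j + 1) R) * coeff (2 * j + 1) R) := by
    have : ∀ j, η * ((η * c.coeff (n - j) - coeff (2 * j + 1) R) * coeff (2 * j + 1) R) =
        c.coeff (n - j) * coeff (2 * j + 1) R - η * coeff (2 * j + 1) R ^ 2 := by
      intro j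
      linear_combination c.coeff (n - j) * coeff (2 * j + 1) R * hη
    rw [Finset.sum_congr rfl fun j _ => this j, Finset.sum_sub_distrib, ← Finset.mul_sum]
    linear_combination h2
  rw [e, dvd_neg]
  apply Finset.dvd_sum
  intro j hj
  have hj : j < n := Finset.mem_range.1 hj
  apply Dvd.dvd.mul_left
  rw [pow_succ (p : ℤ_[p]) 2]
  exact mul_dvd_mul (h1 j hj) (ser_one hR _ (by omega))

end cmser


set_option linter.unusedSectionVars false
section cmfinal
variable {p : ℕ} [hp : Fact p.Prime]
open PowerSeries

theorem Pd.of_int_dvd {a : ℤ_[p]} {k : ℕ} (h : (p : ℤ_[p]) ^ k ∣ a) : Pd p k (algebraMap ℤ_[p] ℚ_[p] a) := by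
  obtain ⟨c, rfl⟩ := h
  refine ⟨c, ?_⟩
  rw [map_mul, map_pow, map_natCast]; rfl

theorem Pd.cancel_p {b : ℚ_[p]} {k : ℕ} (h : Pd p (k + 1) ((p : ℚ_[p]) * b)) : Pd p k b := by
  obtain ⟨c, hc⟩ := h
  refine ⟨c, ?_⟩
  have hp0 : (p : ℚ_[p]) ≠ 0 := by exact_mod_cast hp.out.ne_zero
  apply mul_left_cancel₀ hp0
  rw [hc]; ring

theorem Pk_int (hp7 : p ≠ 7) (r : ℤ_[p]) (k : ℕ) (hk : k < p) : Pd p 0 (Pk (algebraMap ℤ_[p] ℚ_[p] r) k) := by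
  unfold Pk
  refine Pd.mul_left (Pd.pow0 ?_ k) (mm_int hp7 k hk)
  exact Pd.of_int_dvd (k := 0) (by simp)

theorem Pk_sq (r : ℚ_[p]) (hr : r ^ 2 = -7) (k : ℕ) : Pk r k ^ 2 = (cc k : ℚ_[p]) := by
  have := congrArg (Rat.cast (K := ℚ_[p])) (clausen k)
  push_cast at this
  rw [this, Pk, mul_pow, ← pow_mul, mul_comm k 2, pow_mul, hr]

theorem S_ode {r u : ℚ_[p]} (hr : r ^ 2 = -7) {R Y : ℚ_[p]⟦X⟧} (hS : MulS (3 * r) (ww r) u R Y) :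
    (d⁄dX ℚ_[p] R) ^ 2 * (1 - C (2 * (3 * r)) * X ^ 2 + X ^ 4)
      = C u ^ 2 * (1 - C (2 * (3 * r)) * R ^ 2 + R ^ 4) := by
  have h2 : (C (2 * (3 * r)) : ℚ_[p]⟦X⟧) = 2 * C (3 * r) := by rw [map_mul, map_ofNat]
  have hw := ww_sq r hr
  unfold ff at hw
  rw [hS.dr, h2, ← hS.sq]
  linear_combination C u ^ 2 * Y ^ 2 * hw

/-- common data for the split case -/
structure Dat (p : ℕ) [Fact p.Prime] (n : ℕ) (r : ℤ_[p]) (u u' : ℚ_[p]) (η : ℚ_[p]) (ρ : ℕ → ℚ_[p]) : Prop where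
  uu : u * u' = p
  ui : Pd p 1 u
  ui' : Pd p 0 u'
  eta : η ^ 2 = 1
  etai : Pd p 0 η
  low : ∀ m, m < n → Pd p 3 ((2 * (m : ℚ_[p]) + 1) * ρ m - u * Pk (algebraMap ℤ_[p] ℚ_[p] r) m)
  top : Pd p 3 (u' * ρ n - Pk (algebraMap ℤ_[p] ℚ_[p] r) n)
  conv : Pd p 3 (ρ n - η * (1 - ∑ j ∈ Finset.range n, ρ j ^ 2))
  one : ∀ m, m < n → Pd p 1 (ρ m)

theorem dat_exists (hp2 : p ≠ 2) (hp3 : p ≠ 3) (hp7 : p ≠ 7) {r : ℤ_[p]} (hr : r ^ 2 = -7) {x y : ℤ} {n : ℕ}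
    (hn : p = 2 * n + 1) (h : x ^ 2 + 7 * y ^ 2 = p) (hα : (p : ℤ_[p]) ∣ (x + y * r)) :
    ∃ η ρ, Dat p n r (algebraMap ℤ_[p] ℚ_[p] (x + y * r)) (algebraMap ℤ_[p] ℚ_[p] (x - y * r)) η ρ := by
  have hr' : (algebraMap ℤ_[p] ℚ_[p] r) ^ 2 = -7 := by rw [← map_pow, hr, map_neg, map_ofNat]
  have hαα : ((x : ℤ_[p]) + y * r) * (x - y * r) = p := by
    have : ((x : ℤ_[p]) ^ 2 + 7 * y ^ 2) = p := by exact_mod_cast congrArg (Int.cast (R := ℤ_[p])) h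
    linear_combination this - (y : ℤ_[p]) ^ 2 * hr
  have hp0 : (p : ℚ_[p]) ≠ 0 := by exact_mod_cast hp.out.ne_zero
  have hp2' := hp.out.two_le
  obtain ⟨R, Y, hS, c, η, hη, hcd, hc0, hcp, hR⟩ := cm_int hr hn h hα
  have hη1 := eta_one hr hp2 hp3 hp7 hn hαα hη hc0 hcp (J_int hr hS hR)
  obtain ⟨R', A, B, hmap, hR', hAB⟩ := int_series hn R c η hc0 hcp hR
  obtain ⟨u, hu⟩ : ∃ u, u = algebraMap ℤ_[p] ℚ_[p] (x + y * r) := ⟨_, rfl⟩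
  obtain ⟨u', hu'⟩ : ∃ u', u' = algebraMap ℤ_[p] ℚ_[p] (x - y * r) := ⟨_, rfl⟩
  rw [← hu] at hS
  have huu : u * u' = p := by rw [hu, hu', ← map_mul, hαα, map_natCast]
  have hu0 : u ≠ 0 := by rintro h0; rw [h0, zero_mul] at huu; exact hp0 huu.symm
  have hui : Pd p 1 u := by rw [hu]; exact Pd.of_int_dvd (k := 1) (by rwa [pow_one])
  have hui' : Pd p 0 u' := by rw [hu']; exact Pd.of_int_dvd (k := 0) (by simp)
  have hR1 := mulS_c1 hS
  have hR0 := hS.r0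
  have hE := extract_coeff (3 * algebraMap ℤ_[p] ℚ_[p] r) u (Pk (algebraMap ℤ_[p] ℚ_[p] r)) n (Pk_zero _) (Pk_one _)
    (fun k _ => Pk_rec _ hr' k) (fun i _ => by exact_mod_cast Nat.succ_ne_zero i) two_ne_zero hu0 R hR0 hR1 (S_ode hr' hS)
  have hk0 : ∀ m, coeff m (R ^ (2 * 0) * d⁄dX ℚ_[p] R) = coeff (m + 1) R * (m + 1) := by
    intro m; rw [mul_zero, pow_zero, one_mul, coeff_derivative]
  have hthree : ∀ k m, 1 ≤ k → m ≤ p → Pd p 3 (coeff m (R ^ (2 * k + 1))) := by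
    intro k m hk hm
    rw [← hmap, ← map_pow, coeff_map]
    exact Pd.of_int_dvd (ser_three hAB k m hk hm)
  have hmid : ∀ k m, 1 ≤ k → k < n → m < p → coeff m (R ^ (2 * k) * d⁄dX ℚ_[p] R) =
      (m + 1) * ((2 * (k : ℚ_[p]) + 1)⁻¹ * coeff (m + 1) (R ^ (2 * k + 1))) := by
    intro k m hk hkn hm
    have hne : (2 * (k : ℚ_[p]) + 1) ≠ 0 := by exact_mod_cast Nat.succ_ne_zero (2 * k)
    apply mul_left_cancel₀ hne
    rw [coeff_pow_deriv]
    field_simp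
  have hpn : ((2 * n : ℕ) : ℚ_[p]) + 1 = p := by exact_mod_cast congrArg (Nat.cast (R := ℚ_[p])) hn.symm
  refine ⟨algebraMap ℤ_[p] ℚ_[p] η, fun m => coeff (2 * m + 1) R, ?_⟩
  rw [← hu, ← hu']
  refine ⟨huu, hui, hui', by rw [← map_pow, hη1, map_one], Pd.of_int_dvd (k := 0) (by simp), ?_, ?_, ?_, ?_⟩
  · intro m hm
    have h1 := hE m hm.le
    rw [Finset.sum_range_succ', hk0, Pk_zero, one_mul] at h1
    have h2 : Pd p 3 (∑ k ∈ Finset.range n, Pk (algebraMap ℤ_[p] ℚ_[p] r) (k + 1) *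
        coeff (2 * m) (R ^ (2 * (k + 1)) * d⁄dX ℚ_[p] R)) := by
      refine Pd.sum _ _ fun k hk => ?_
      have hk : k < n := Finset.mem_range.1 hk
      refine (Pk_int hp7 r (k + 1) (by omega)).mul_left ?_
      by_cases hkn : k + 1 < n
      · rw [hmid (k + 1) (2 * m) (by omega) hkn (by omega)]
        refine Pd.mul_left ?_ ((odd_inv hn hkn).mul_left (hthree _ _ (by omega) (by omega)))
        exact_mod_cast Pd.natCast (p := p) (2 * m + 1)
      · have hd : X ^ (2 * n) ∣ R ^ (2 * (k + 1)) * d⁄dX ℚ_[p] R := by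
          rw [show k + 1 = n by omega]
          exact Dvd.dvd.mul_right (pow_dvd_pow_of_dvd (X_dvd_iff.2 hR0) _) _
        rw [X_pow_dvd_iff.1 hd _ (by omega)]
        exact Pd.zero 3
    convert h2.neg using 1
    push_cast at h1
    linear_combination h1
  · have h1 := hE n le_rfl
    rw [Finset.sum_range_succ', hk0, Pk_zero, one_mul, hpn] at h1
    have hn1 : 1 ≤ n := by omega
    have h2 : Pd p 4 (∑ k ∈ Finset.range n, Pk (algebraMap ℤ_[p] ℚ_[p] r) (k + 1) *
        coeff (2 * n) (R ^ (2 * (k + 1)) * d⁄dX ℚ_[p] R)) := by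
      refine Pd.sum _ _ fun k hk => ?_
      have hk : k < n := Finset.mem_range.1 hk
      refine (Pk_int hp7 r (k + 1) (by omega)).mul_left ?_
      by_cases hkn : k + 1 < n
      · rw [hmid (k + 1) (2 * n) (by omega) hkn (by omega), hpn]
        exact (Pd.p1.mul ((odd_inv hn hkn).mul_left (hthree _ _ (by omega) (by omega))))
      · have e : coeff (2 * n) (R ^ (2 * (k + 1)) * d⁄dX ℚ_[p] R) = u ^ (2 * n + 1) := by
          apply mul_left_cancel₀ hp0
          have := coeff_pow_deriv R n (2 * n)
          rw [show k + 1 = n by omega]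
          rw [coeff_lead R u hR0 hR1, hpn] at this
          push_cast at hpn
          rw [hpn] at this
          linear_combination this
        rw [e]
        exact (hui.pow (2 * n + 1)).mono (by omega)
    have h3 : Pd p 4 ((p : ℚ_[p]) * (u' * coeff (2 * n + 1) R - Pk (algebraMap ℤ_[p] ℚ_[p] r) n)) := by
      convert (hui'.mul_left h2).neg using 1
      linear_combination Pk (algebraMap ℤ_[p] ℚ_[p] r) n * huu + u' * h1
    exact h3.cancel_p
  · have h1 := Pd.of_int_dvd (ser_p hn hcd hη1 hc0 hcp hR' hAB)
    rw [map_sub, map_mul, map_sub, map_one, map_sum] at h1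
    simp only [map_pow, ← coeff_map, hmap] at h1
    exact h1
  · intro m hm
    have := ser_one hAB (2 * m + 1) (by omega)
    rw [← pow_one (p : ℤ_[p])] at this
    have h1 := Pd.of_int_dvd this
    rw [← coeff_map, hmap] at h1
    exact h1

theorem dat_sq {n : ℕ} (hp7 : p ≠ 7) (hn : p = 2 * n + 1) {r : ℤ_[p]} (hr : r ^ 2 = -7) {u u' η : ℚ_[p]} {ρ : ℕ → ℚ_[p]}
    (D : Dat p n r u u' η ρ) :
    Pd p 3 ((cc n + 2 * p ^ 2 * ∑ k ∈ Finset.range n, (cc k : ℚ_[p]) * ((2 * (k : ℚ_[p]) + 1)⁻¹) ^ 2) - u' ^ 2) := by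
  have hr' : (algebraMap ℤ_[p] ℚ_[p] r) ^ 2 = -7 := by rw [← map_pow, hr, map_neg, map_ofNat]
  have hp2' := hp.out.two_le
  obtain ⟨T, hT⟩ : ∃ T, T = ∑ j ∈ Finset.range n, ρ j ^ 2 := ⟨_, rfl⟩
  obtain ⟨S, hS⟩ : ∃ S, S = ∑ k ∈ Finset.range n, (cc k : ℚ_[p]) * ((2 * (k : ℚ_[p]) + 1)⁻¹) ^ 2 := ⟨_, rfl⟩
  have hT2 : Pd p 2 T := by
    rw [hT]; exact Pd.sum _ _ fun j hj => (D.one j (Finset.mem_range.1 hj)).pow 2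
  have hTS : Pd p 3 (T - u ^ 2 * S) := by
    rw [hT, hS, Finset.mul_sum, ← Finset.sum_sub_distrib]
    refine Pd.sum _ _ fun j hj => ?_
    have hj : j < n := Finset.mem_range.1 hj
    have hne : (2 * (j : ℚ_[p]) + 1) ≠ 0 := by exact_mod_cast Nat.succ_ne_zero (2 * j)
    have hi := odd_inv hn hj
    have hP := Pk_int hp7 r j (by omega)
    rw [← Pk_sq _ hr']
    have h1 := (hi.mul_left (D.low j hj)).mul_right
      ((D.one j hj).mono (Nat.zero_le 1) |>.add ((hi.mul_left ((D.ui.mono (Nat.zero_le 1)).mul_left hP))))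
    convert h1 using 1
    field_simp
    ring
  have hPn : Pd p 3 (Pk (algebraMap ℤ_[p] ℚ_[p] r) n - u' * η * (1 - T)) := by
    rw [hT]
    convert (D.ui'.mul_left D.conv).sub D.top using 1
    ring
  have hsq : Pd p 3 (Pk (algebraMap ℤ_[p] ℚ_[p] r) n ^ 2 - (u' * η * (1 - T)) ^ 2) := by
    have := hPn.mul_right ((Pk_int hp7 r n (by omega)).add
      ((D.ui'.mul_left D.etai).mul_left (Pd.one.sub (hT2.mono (Nat.zero_le 2)))))
    convert this using 1
    ring
  rw [Pk_sq _ hr'] at hsq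
  rw [← hS]
  have hT4 : Pd p 3 (u' ^ 2 * T ^ 2) := (D.ui'.pow0 2).mul_left ((hT2.pow 2).mono (by norm_num))
  have hX : Pd p 3 (2 * u' ^ 2 * (T - u ^ 2 * S)) := ((Pd.ofNat 2).mul_left (D.ui'.pow0 2)).mul_left hTS
  convert (hsq.add hT4).sub hX using 1
  have hp : (p : ℚ_[p]) ^ 2 = u ^ 2 * u' ^ 2 := by rw [← D.uu]; ring
  rw [hp, mul_pow, mul_pow, D.eta]
  ring

theorem split_S0 (hp2 : p ≠ 2) (hp3 : p ≠ 3) (hp7 : p ≠ 7) {r : ℤ_[p]} (hr : r ^ 2 = -7) {x y : ℤ}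
    (h : x ^ 2 + 7 * y ^ 2 = p) (hα : (p : ℤ_[p]) ∣ (x + y * r)) (hx : ¬ (p : ℤ) ∣ x) :
    Pd p 3 ((SS p 0 : ℚ_[p]) - (4 * x ^ 2 - 2 * p - p ^ 2 / (4 * x ^ 2))) := by
  obtain ⟨n, hn⟩ := hp.out.odd_of_ne_two hp2
  have hp2' := hp.out.two_le
  obtain ⟨η, ρ, D⟩ := dat_exists hp2 hp3 hp7 hr hn h hα
  have h1 := S0_cong hn (by omega)
  have h2 := dat_sq hp7 hn hr D
  obtain ⟨u, hu⟩ : ∃ u, u = algebraMap ℤ_[p] ℚ_[p] (x + y * r) := ⟨_, rfl⟩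
  obtain ⟨u', hu'⟩ : ∃ u', u' = algebraMap ℤ_[p] ℚ_[p] (x - y * r) := ⟨_, rfl⟩
  have huu := D.uu
  have hui := D.ui
  rw [← hu'] at h2
  rw [← hu, ← hu'] at huu
  rw [← hu] at hui
  have hs : u + u' = 2 * x := by
    rw [hu, hu', ← map_add]
    have : (x : ℤ_[p]) + y * r + (x - y * r) = ((2 * x : ℤ) : ℤ_[p]) := by push_cast; ring
    rw [this, map_intCast]; push_cast; ring
  have hx0 : (x : ℚ_[p]) ≠ 0 := by
    have : x ≠ 0 := by rintro rfl; simp at hx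
    exact_mod_cast this
  have hi2 : Pd p 0 ((2 * x : ℚ_[p])⁻¹) := by
    have : ¬ (p : ℤ) ∣ 2 * x := by
      intro hd
      rcases (Nat.prime_iff_prime_int.1 hp.out).dvd_or_dvd hd with h | h
      · have h' : p ∣ 2 := by exact_mod_cast h
        exact hp2 ((Nat.prime_dvd_prime_iff_eq hp.out Nat.prime_two).1 h')
      · exact hx h
    have := Pd.inv_int this
    push_cast at this
    exact this
  -- u - p / (2 x) = u ^ 2 / (2 x)
  have e1 : Pd p 3 (u ^ 2 - p ^ 2 / (4 * x ^ 2)) := by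
    have h3 : Pd p 2 (u - p * (2 * x : ℚ_[p])⁻¹) := by
      convert (hui.pow 2).mul_right hi2 using 1
      rw [← huu]
      field_simp
      linear_combination - u * hs
    have h4 : Pd p 1 (u + p * (2 * x : ℚ_[p])⁻¹) := hui.add (Pd.p1.mul_right hi2)
    convert h3.mul h4 using 1
    field_simp
    ring
  convert (h1.add h2).add e1.neg using 1
  have e2 : (4 * x ^ 2 : ℚ_[p]) - 2 * p = u' ^ 2 + u ^ 2 := by
    rw [← huu]; linear_combination -(2 * (x : ℚ_[p]) + u + u') * hs
  rw [e2]
  ring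

end cmfinal


set_option linter.unusedSectionVars false
section assemble
variable {p : ℕ} [hp : Fact p.Prime]

theorem form_not_dvd (hp7 : p ≠ 7) {x y : ℤ} (h : x ^ 2 + 7 * y ^ 2 = p) : ¬ (p : ℤ) ∣ x ∧ ¬ (p : ℤ) ∣ y := by
  have hpp := Nat.prime_iff_prime_int.1 hp.out
  have both : (p : ℤ) ∣ x → (p : ℤ) ∣ y → False := by
    rintro ⟨a, rfl⟩ ⟨b, rfl⟩
    have h1 : (p : ℤ) * (p * (a ^ 2 + 7 * b ^ 2)) = p * 1 := by linear_combination h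
    have h2 := mul_left_cancel₀ hpp.ne_zero h1
    exact hpp.not_dvd_one ⟨_, h2.symm⟩
  constructor
  · intro hx
    apply both hx
    have : (p : ℤ) ∣ 7 * y ^ 2 := by
      obtain ⟨a, rfl⟩ := hx
      exact ⟨1 - p * a ^ 2, by linear_combination h⟩
    rcases hpp.dvd_or_dvd this with h | h
    · have h' : p ∣ 7 := by exact_mod_cast h
      exact absurd ((Nat.prime_dvd_prime_iff_eq hp.out (by norm_num)).1 h') hp7
    · exact hpp.dvd_of_dvd_pow h
  · intro hy
    refine both ?_ hy
    have : (p : ℤ) ∣ x ^ 2 := by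
      obtain ⟨a, rfl⟩ := hy
      exact ⟨1 - 7 * p * a ^ 2, by linear_combination h⟩
    exact hpp.dvd_of_dvd_pow this

theorem unit_of_not_dvd {y : ℤ} (h : ¬ (p : ℤ) ∣ y) : IsUnit (y : ℤ_[p]) := by
  rw [PadicInt.isUnit_iff]
  refine le_antisymm (PadicInt.norm_le_one _) ?_
  by_contra hh
  exact h (PadicInt.norm_intCast_lt_one_iff.1 (not_le.1 hh))

theorem root_exists (hp2 : p ≠ 2) (hp7 : p ≠ 7) {x y : ℤ} (h : x ^ 2 + 7 * y ^ 2 = p) :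
    ∃ r : ℤ_[p], r ^ 2 = -7 ∧ (p : ℤ_[p]) ∣ (x + y * r) := by
  obtain ⟨hx, hy⟩ := form_not_dvd hp7 h
  have hx' := unit_of_not_dvd (p := p) hx
  obtain ⟨v, hv⟩ := (unit_of_not_dvd (p := p) hy).exists_left_inv
  have hv' : IsUnit v := IsUnit.of_mul_eq_one _ hv
  have h2 : IsUnit (2 : ℤ_[p]) := by
    have : ¬ (p : ℤ) ∣ 2 := by
      intro h
      have h' : p ∣ 2 := by exact_mod_cast h
      exact hp2 ((Nat.prime_dvd_prime_iff_eq hp.out Nat.prime_two).1 h')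
    have := unit_of_not_dvd (p := p) this
    exact_mod_cast this
  have hc : ((x : ℤ_[p]) ^ 2 + 7 * y ^ 2) = p := by exact_mod_cast congrArg (Int.cast (R := ℤ_[p])) h
  have hd : ‖(Polynomial.X ^ 2 + 7 : Polynomial ℤ_[p]).derivative.aeval (-x * v)‖ = 1 := by
    rw [← PadicInt.isUnit_iff]
    have : (Polynomial.X ^ 2 + 7 : Polynomial ℤ_[p]).derivative.aeval (-(x : ℤ_[p]) * v) = 2 * (-x * v) := by
      simp [one_add_one_eq_two]
    rw [this]
    exact h2.mul (hx'.neg.mul hv')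
  have hF : (Polynomial.X ^ 2 + 7 : Polynomial ℤ_[p]).aeval (-(x : ℤ_[p]) * v) = p * v ^ 2 := by
    simp only [map_add, map_pow, Polynomial.aeval_X, map_ofNat]
    linear_combination v ^ 2 * hc - 7 * (v * y + 1) * hv
  have hlt : ∀ a : ℤ_[p], ‖(p : ℤ_[p]) * a‖ < 1 := by
    intro a
    rw [PadicInt.norm_lt_one_iff_dvd]
    exact dvd_mul_right _ _
  obtain ⟨z, hz, hz2, -⟩ := hensels_lemma (p := p) (F := (Polynomial.X ^ 2 + 7 : Polynomial ℤ_[p])) (a := -(x : ℤ_[p]) * v)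
    (by rw [hd, hF, one_pow]; exact hlt _)
  refine ⟨z, ?_, ?_⟩
  · simp only [map_add, map_pow, Polynomial.aeval_X, map_ofNat] at hz
    linear_combination hz
  · rw [hd, PadicInt.norm_lt_one_iff_dvd] at hz2
    have e : (x : ℤ_[p]) + y * z = y * (z - -x * v) := by linear_combination -(x : ℤ_[p]) * hv
    rw [e]
    exact Dvd.dvd.mul_left hz2 _
end assemble

theorem statement6 (p : ℕ) (hp : p.Prime) (hp2 : p ≠ 2) (hp3 : p ≠ 3) (hp7 : p ≠ 7) :
    (∀ x y : ℤ, (p % 7 = 1 ∨ p % 7 = 2 ∨ p % 7 = 4) → (p : ℤ) = x^2 + 7*y^2 →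
      ratCongr p 3
        (∑ k ∈ Finset.range p, (k:ℚ)^2 * ((2*k).choose k : ℚ)^3)
        (736/1323*(x:ℚ)^2 - 272/441*(p:ℚ) + 20*(p:ℚ)^2/(1323*(x:ℚ)^2)) ∧
      ratCongr p 3
        (∑ k ∈ Finset.range p, (k:ℚ)^3 * ((2*k).choose k : ℚ)^3)
        (-(5408/27783)*(x:ℚ)^2 + 2992/9261*(p:ℚ) - 1774*(p:ℚ)^2/(27783*(x:ℚ)^2))) ∧
    ((p % 7 = 3 ∨ p % 7 = 5 ∨ p % 7 = 6) →
      ratCongr p 2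
        (∑ k ∈ Finset.range p, (k:ℚ)^2 * ((2*k).choose k : ℚ)^3)
        (8/63*R7 p - 256/1323*(p:ℚ)) ∧
      ratCongr p 2
        (∑ k ∈ Finset.range p, (k:ℚ)^3 * ((2*k).choose k : ℚ)^3)
        (-(256/1323)*R7 p + 128/27783*(p:ℚ))) := by
  haveI : Fact p.Prime := ⟨hp⟩
  constructor
  · intro x y _ hxy
    have hx := (form_not_dvd hp7 hxy.symm).1
    obtain ⟨r, hr, hα⟩ := root_exists hp2 hp7 hxy.symm
    exact final_split hp3 hp7 hp2 x hx (split_S0 hp2 hp3 hp7 hr hxy.symm hα hx)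
  · intro h
    exact final_inert hp2 hp3 hp7 (inert_S0 hp2 hp3 hp7 h)
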